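/- Let n ≥ 1, let Ω ⊂ ℝ^n be open, and let f ∈ L^1_loc(Ω). Then for every family {f_ε}_{ε>0} with f_ε − f ∈ L^∞_loc(Ω) and f_ε − f → 0 in L^∞_loc(Ω) as ε → 0, one has (1/2)·|D^j f|(Ω) ≤ liminf_{ε→0} κ_ε(f_ε, Ω). -/

import Mathlib

open MeasureTheory Filter Topology Metric
open scoped ENNReal RealInnerProductSpace Classical

noncomputable section

/-- An open cube in `ℝⁿ` with side length `ε` and arbitrary orientation. -/
def IsCube (n : ℕ) (ε : ℝ) (Q : Set (EuclideanSpace ℝ (Fin n))) : Prop :=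
  ∃ (T : EuclideanSpace ℝ (Fin n) ≃ₗᵢ[ℝ] EuclideanSpace ℝ (Fin n))
    (x : EuclideanSpace ℝ (Fin n)),
    Q = (fun y => x + T y) '' {y : EuclideanSpace ℝ (Fin n) | ∀ i, |y i| < ε / 2}

/-- The BMO-type functional `κ_ε(f, Ω)`. -/
def kappa (n : ℕ) (ε : ℝ) (f : EuclideanSpace ℝ (Fin n) → ℝ)
    (Ω : Set (EuclideanSpace ℝ (Fin n))) : ℝ≥0∞ :=
  ENNReal.ofReal (ε ^ (n - 1)) *
    ⨆ (F : Set (Set (EuclideanSpace ℝ (Fin n))))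
      (_ : ∀ Q ∈ F, IsCube n ε Q ∧ Q ⊆ Ω) (_ : F.Pairwise Disjoint),
      ∑' Q : F, ENNReal.ofReal
        (⨍ x in (Q : Set (EuclideanSpace ℝ (Fin n))),
          |f x - ⨍ y in (Q : Set (EuclideanSpace ℝ (Fin n))), f y ∂volume| ∂volume)

/-- The divergence of a vector field on `ℝⁿ`. -/
def vdiv (n : ℕ) (Φ : EuclideanSpace ℝ (Fin n) → EuclideanSpace ℝ (Fin n))
    (x : EuclideanSpace ℝ (Fin n)) : ℝ :=
  ∑ i : Fin n, fderiv ℝ Φ x (EuclideanSpace.single i 1) i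

/-- The variation `Var(f, Ω)`. -/
def variation (n : ℕ) (f : EuclideanSpace ℝ (Fin n) → ℝ)
    (Ω : Set (EuclideanSpace ℝ (Fin n))) : ℝ≥0∞ :=
  ⨆ (Φ : EuclideanSpace ℝ (Fin n) → EuclideanSpace ℝ (Fin n))
    (_ : ContDiff ℝ 1 Φ) (_ : HasCompactSupport Φ) (_ : tsupport Φ ⊆ Ω)
    (_ : ∀ x, ‖Φ x‖ ≤ 1),
    ENNReal.ofReal (∫ x in Ω, f x * vdiv n Φ x)

/-- The approximate jump set `J_f`. -/
def jumpSet (n : ℕ) (f : EuclideanSpace ℝ (Fin n) → ℝ) : Set (EuclideanSpace ℝ (Fin n)) :=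
  {x | ∃ ν : EuclideanSpace ℝ (Fin n), ‖ν‖ = 1 ∧ ∃ a b : ℝ, a ≠ b ∧
    Tendsto (fun r : ℝ =>
        ⨍ y in {y ∈ ball x r | 0 < ⟪y - x, ν⟫}, |f y - a| ∂volume)
      (𝓝[>] 0) (𝓝 0) ∧
    Tendsto (fun r : ℝ =>
        ⨍ y in {y ∈ ball x r | ⟪y - x, ν⟫ < 0}, |f y - b| ∂volume)
      (𝓝[>] 0) (𝓝 0)}

/-- The approximate discontinuity set `S_f` (the set of non-Lebesgue points). -/
def approxDiscontSet (n : ℕ) (f : EuclideanSpace ℝ (Fin n) → ℝ) :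
    Set (EuclideanSpace ℝ (Fin n)) :=
  {x | ¬ ∃ c : ℝ,
    Tendsto (fun r : ℝ => ⨍ y in ball x r, |f y - c| ∂volume) (𝓝[>] 0) (𝓝 0)}

/-- `(μ, σ)` is the polar decomposition `Df = σ |Df|` of the gradient measure of `f` on `Ω`:
`μ` plays the role of the total variation measure `|Df|` and `σ` of the polar vector field. -/
def IsVariationPair (n : ℕ) (f : EuclideanSpace ℝ (Fin n) → ℝ)
    (Ω : Set (EuclideanSpace ℝ (Fin n))) (μ : Measure (EuclideanSpace ℝ (Fin n)))
    (σ : EuclideanSpace ℝ (Fin n) → EuclideanSpace ℝ (Fin n)) : Prop :=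
  IsFiniteMeasure μ ∧ μ Ωᶜ = 0 ∧ AEStronglyMeasurable σ μ ∧ (∀ᵐ x ∂μ, ‖σ x‖ = 1) ∧
  ∀ Φ : EuclideanSpace ℝ (Fin n) → EuclideanSpace ℝ (Fin n),
    ContDiff ℝ 1 Φ → HasCompactSupport Φ → tsupport Φ ⊆ Ω →
    ∫ x in Ω, f x * vdiv n Φ x = - ∫ x, ⟪Φ x, σ x⟫ ∂μ

/-- `|D^a f|(Ω)`, the total variation of the absolutely continuous part of `Df`,
with the convention that it is `∞` if `f` is not of bounded variation in `Ω`. -/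
def absVar (n : ℕ) (f : EuclideanSpace ℝ (Fin n) → ℝ)
    (Ω : Set (EuclideanSpace ℝ (Fin n))) : ℝ≥0∞ :=
  if h : ∃ p : Measure (EuclideanSpace ℝ (Fin n)) ×
      (EuclideanSpace ℝ (Fin n) → EuclideanSpace ℝ (Fin n)),
      IsVariationPair n f Ω p.1 p.2 then
    volume.withDensity ((h.choose.1).rnDeriv volume) Ω
  else ⊤

/-- `|D^c f|(Ω)`, the total variation of the Cantor part of `Df`,
with the convention that it is `∞` if `f` is not of bounded variation in `Ω`. -/
def cantorVar (n : ℕ) (f : EuclideanSpace ℝ (Fin n) → ℝ)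
    (Ω : Set (EuclideanSpace ℝ (Fin n))) : ℝ≥0∞ :=
  if h : ∃ p : Measure (EuclideanSpace ℝ (Fin n)) ×
      (EuclideanSpace ℝ (Fin n) → EuclideanSpace ℝ (Fin n)),
      IsVariationPair n f Ω p.1 p.2 then
    (h.choose.1.singularPart volume) (Ω \ approxDiscontSet n f)
  else ⊤

/-- `|D^j f|(Ω)`, the total variation of the jump part of `Df`,
with the convention that it is `∞` if `f` is not of bounded variation in `Ω`. -/
def jumpVar (n : ℕ) (f : EuclideanSpace ℝ (Fin n) → ℝ)
    (Ω : Set (EuclideanSpace ℝ (Fin n))) : ℝ≥0∞ :=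
  if h : ∃ p : Measure (EuclideanSpace ℝ (Fin n)) ×
      (EuclideanSpace ℝ (Fin n) → EuclideanSpace ℝ (Fin n)),
      IsVariationPair n f Ω p.1 p.2 then
    (h.choose.1.singularPart volume) (jumpSet n f ∩ Ω)
  else ⊤

/-- `g` is the weak (distributional) gradient of `u` on `Ω`. -/
def HasWeakGradientOn (n : ℕ) (u : EuclideanSpace ℝ (Fin n) → ℝ)
    (g : EuclideanSpace ℝ (Fin n) → EuclideanSpace ℝ (Fin n))
    (Ω : Set (EuclideanSpace ℝ (Fin n))) : Prop :=
  ∀ φ : EuclideanSpace ℝ (Fin n) → ℝ,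
    ContDiff ℝ 1 φ → HasCompactSupport φ → tsupport φ ⊆ Ω →
    ∀ k : Fin n,
      ∫ x in Ω, u x * fderiv ℝ φ x (EuclideanSpace.single k 1) =
        - ∫ x in Ω, φ x * g x k

/-- `f ∈ BV(Ω)`: `f` is integrable on `Ω` and has finite variation in `Ω`. -/
def IsBVOn (n : ℕ) (f : EuclideanSpace ℝ (Fin n) → ℝ)
    (Ω : Set (EuclideanSpace ℝ (Fin n))) : Prop :=
  IntegrableOn f Ω volume ∧ variation n f Ω < ⊤

/-- `f ∈ SBV(Ω)`: `f ∈ BV(Ω)` and the Cantor part of `Df` vanishes. -/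
def IsSBVOn (n : ℕ) (f : EuclideanSpace ℝ (Fin n) → ℝ)
    (Ω : Set (EuclideanSpace ℝ (Fin n))) : Prop :=
  IsBVOn n f Ω ∧ cantorVar n f Ω = 0

section Cubes

variable {n : ℕ}

local notation "𝔼" => EuclideanSpace ℝ (Fin n)

/-- The map sending a point to its coordinates in the frame `T` based at `c`. -/
def frameCoord (T : 𝔼 ≃ₗᵢ[ℝ] 𝔼) (c z : 𝔼) : Fin n → ℝ := fun i => T.symm (z - c) i

/-- The open cube with center `c`, side `r` and orientation `T`. -/
def openCube (T : 𝔼 ≃ₗᵢ[ℝ] 𝔼) (c : 𝔼) (r : ℝ) : Set 𝔼 :=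
  {z | ∀ i, |frameCoord T c z i| < r / 2}

/-- The closed cube with center `c`, side `r` and orientation `T`. -/
def closedCube (T : 𝔼 ≃ₗᵢ[ℝ] 𝔼) (c : 𝔼) (r : ℝ) : Set 𝔼 :=
  {z | ∀ i, |frameCoord T c z i| ≤ r / 2}

lemma continuous_frameCoord (T : 𝔼 ≃ₗᵢ[ℝ] 𝔼) (c : 𝔼) : Continuous (frameCoord T c) := by
  unfold frameCoord
  fun_prop

lemma isCube_openCube (T : 𝔼 ≃ₗᵢ[ℝ] 𝔼) (c : 𝔼) (r : ℝ) : IsCube n r (openCube T c r) := by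
  refine ⟨T, c, ?_⟩
  ext z
  constructor
  · intro hz
    exact ⟨T.symm (z - c), hz, by simp⟩
  · rintro ⟨y, hy, rfl⟩
    simpa [openCube, frameCoord] using hy

lemma isOpen_openCube (T : 𝔼 ≃ₗᵢ[ℝ] 𝔼) (c : 𝔼) (r : ℝ) : IsOpen (openCube T c r) := by
  have : openCube T c r = ⋂ i, {z | |frameCoord T c z i| < r / 2} := by
    ext z; simp [openCube]
  rw [this]
  refine isOpen_iInter_of_finite fun i => isOpen_lt ?_ continuous_const
  exact ((continuous_apply i).comp (continuous_frameCoord T c)).abs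

lemma isClosed_closedCube (T : 𝔼 ≃ₗᵢ[ℝ] 𝔼) (c : 𝔼) (r : ℝ) : IsClosed (closedCube T c r) := by
  have : closedCube T c r = ⋂ i, {z | |frameCoord T c z i| ≤ r / 2} := by
    ext z; simp [closedCube]
  rw [this]
  refine isClosed_iInter fun i => isClosed_le ?_ continuous_const
  exact ((continuous_apply i).comp (continuous_frameCoord T c)).abs

lemma openCube_subset_closedCube (T : 𝔼 ≃ₗᵢ[ℝ] 𝔼) (c : 𝔼) (r : ℝ) :
    openCube T c r ⊆ closedCube T c r := fun _ hz i => (hz i).le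

lemma center_mem_openCube (T : 𝔼 ≃ₗᵢ[ℝ] 𝔼) (c : 𝔼) {r : ℝ} (hr : 0 < r) :
    c ∈ openCube T c r := by
  intro i
  simp [frameCoord, hr]

/-- A vector all of whose coordinates are bounded by `b` has norm at most `n b`. -/
lemma norm_le_of_forall_coord_le {v : 𝔼} {b : ℝ} (h : ∀ i, |v i| ≤ b) : ‖v‖ ≤ n * b := by
  calc ‖v‖ = ‖∑ i, EuclideanSpace.single i (v i)‖ := by
        congr 1
        ext j
        simp
    _ ≤ ∑ i, ‖EuclideanSpace.single i (v i)‖ := norm_sum_le _ _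
    _ ≤ ∑ _i : Fin n, b := Finset.sum_le_sum fun i _ => by simpa using h i
    _ = n * b := by simp

lemma abs_coord_le_norm (v : 𝔼) (i : Fin n) : |v i| ≤ ‖v‖ := by
  simpa using PiLp.norm_apply_le v i

lemma norm_sub_le_of_frameCoord {T : 𝔼 ≃ₗᵢ[ℝ] 𝔼} {c z : 𝔼} {b : ℝ}
    (h : ∀ i, |frameCoord T c z i| ≤ b) : ‖z - c‖ ≤ n * b := by
  rw [← T.symm.norm_map]
  exact norm_le_of_forall_coord_le h

lemma closedCube_subset_closedBall (T : 𝔼 ≃ₗᵢ[ℝ] 𝔼) (c : 𝔼) (r : ℝ) :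
    closedCube T c r ⊆ closedBall c (n * (r / 2)) := by
  intro z hz
  rw [mem_closedBall, dist_eq_norm]
  exact norm_sub_le_of_frameCoord hz

lemma closedBall_subset_closedCube (T : 𝔼 ≃ₗᵢ[ℝ] 𝔼) (c : 𝔼) (r : ℝ) :
    closedBall c (r / 2) ⊆ closedCube T c r := by
  intro z hz i
  rw [mem_closedBall, dist_eq_norm, ← T.symm.norm_map] at hz
  exact (abs_coord_le_norm _ i).trans hz

lemma measurePreserving_frameCoord (T : 𝔼 ≃ₗᵢ[ℝ] 𝔼) (c : 𝔼) :
    MeasurePreserving (frameCoord T c) volume volume :=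
  (PiLp.volume_preserving_ofLp (Fin n)).comp
    (T.symm.measurePreserving.comp (measurePreserving_sub_right volume c))

lemma measurableEmbedding_frameCoord (T : 𝔼 ≃ₗᵢ[ℝ] 𝔼) (c : 𝔼) :
    MeasurableEmbedding (frameCoord T c) := by
  have h1 : MeasurableEmbedding (fun z : 𝔼 => z - c) := measurableEmbedding_subRight c
  have h2 : MeasurableEmbedding (T.symm : 𝔼 → 𝔼) :=
    T.symm.toHomeomorph.measurableEmbedding
  have h3 : MeasurableEmbedding (@WithLp.ofLp 2 (Fin n → ℝ)) :=
    (MeasurableEquiv.toLp 2 (Fin n → ℝ)).symm.measurableEmbedding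
  exact h3.comp (h2.comp h1)

/-- The volume of a box in the frame `T` based at `c`. -/
lemma volume_frameCoord_preimage_pi (T : 𝔼 ≃ₗᵢ[ℝ] 𝔼) (c : 𝔼) (s : Fin n → Set ℝ) :
    volume {z : 𝔼 | ∀ i, frameCoord T c z i ∈ s i} = ∏ i, volume (s i) := by
  have h := (measurePreserving_frameCoord T c).measure_preimage_emb
    (measurableEmbedding_frameCoord T c) (Set.univ.pi s)
  rw [volume_pi_pi] at h
  rw [← h]
  congr 1
  ext z
  simp

lemma volume_openCube (T : 𝔼 ≃ₗᵢ[ℝ] 𝔼) (c : 𝔼) {r : ℝ} (hr : 0 ≤ r) :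
    volume (openCube T c r) = ENNReal.ofReal (r ^ n) := by
  have : openCube T c r = {z | ∀ i, frameCoord T c z i ∈ Set.Ioo (-(r / 2)) (r / 2)} := by
    ext z; simp [openCube, abs_lt]
  rw [this, volume_frameCoord_preimage_pi T c fun _ => Set.Ioo (-(r / 2)) (r / 2)]
  simp [Real.volume_Ioo, ENNReal.ofReal_pow hr]

lemma volume_closedCube (T : 𝔼 ≃ₗᵢ[ℝ] 𝔼) (c : 𝔼) {r : ℝ} (hr : 0 ≤ r) :
    volume (closedCube T c r) = ENNReal.ofReal (r ^ n) := by
  have : closedCube T c r = {z | ∀ i, frameCoord T c z i ∈ Set.Icc (-(r / 2)) (r / 2)} := by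
    ext z; simp [closedCube, abs_le]
  rw [this, volume_frameCoord_preimage_pi T c fun _ => Set.Icc (-(r / 2)) (r / 2)]
  simp [Real.volume_Icc, ENNReal.ofReal_pow hr]

lemma openCube_ae_eq_closedCube (T : 𝔼 ≃ₗᵢ[ℝ] 𝔼) (c : 𝔼) {r : ℝ} (hr : 0 ≤ r) :
    openCube T c r =ᵐ[volume] closedCube T c r := by
  refine ae_eq_of_subset_of_measure_ge (openCube_subset_closedCube T c r) ?_
    (isOpen_openCube T c r).measurableSet.nullMeasurableSet ?_
  · rw [volume_openCube T c hr, volume_closedCube T c hr]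
  · rw [volume_closedCube T c hr]
    exact ENNReal.ofReal_ne_top

/-- The integral of a product function in the frame `T` based at `c`. -/
lemma integral_prod_frameCoord (T : 𝔼 ≃ₗᵢ[ℝ] 𝔼) (c : 𝔼) (g : Fin n → ℝ → ℝ) :
    ∫ z : 𝔼, ∏ i, g i (frameCoord T c z i) = ∏ i, ∫ t, g i t := by
  rw [← integral_fintype_prod_volume_eq_prod]
  exact (measurePreserving_frameCoord T c).integral_comp (measurableEmbedding_frameCoord T c)
    (fun y => ∏ i, g i (y i))

/-- Every unit vector is the `i`-th vector of an orthonormal frame. -/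
lemma exists_linearIsometryEquiv_single (i : Fin n) {e : 𝔼} (he : ‖e‖ = 1) :
    ∃ T : 𝔼 ≃ₗᵢ[ℝ] 𝔼, T (EuclideanSpace.single i 1) = e := by
  refine ⟨(ℝ ∙ (EuclideanSpace.single i (1 : ℝ) - e))ᗮ.reflection, ?_⟩
  exact Submodule.reflection_sub (by simp [he])

lemma frameCoord_eq_inner {T : 𝔼 ≃ₗᵢ[ℝ] 𝔼} {i : Fin n} {e : 𝔼}
    (hT : T (EuclideanSpace.single i 1) = e) (c z : 𝔼) :
    frameCoord T c z i = ⟪z - c, e⟫ := by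
  rw [← hT, ← T.symm.inner_map_map]
  simp [frameCoord, EuclideanSpace.inner_single_right]

/-- The mean oscillation of `u` on `Q`. -/
def meanOsc (u : 𝔼 → ℝ) (Q : Set 𝔼) : ℝ := ⨍ x in Q, |u x - ⨍ y in Q, u y|

/-- Any countable disjoint family of cubes gives a lower bound of `κ_ε`. -/
lemma tsum_meanOsc_le_kappa {ι : Type*} {ε : ℝ} {u : 𝔼 → ℝ} {Ω : Set 𝔼} (Q : ι → Set 𝔼)
    (hQ : ∀ i, IsCube n ε (Q i)) (hne : ∀ i, (Q i).Nonempty) (hΩ : ∀ i, Q i ⊆ Ω)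
    (hd : Pairwise (Function.onFun Disjoint Q)) :
    ENNReal.ofReal (ε ^ (n - 1)) * ∑' i, ENNReal.ofReal (meanOsc u (Q i)) ≤ kappa n ε u Ω := by
  have hinj : Function.Injective Q := by
    intro i j hij
    by_contra hne'
    have := hd hne'
    rw [Function.onFun, hij, disjoint_self] at this
    exact (hne j).ne_empty this
  unfold kappa
  gcongr
  refine le_iSup_of_le (Set.range Q) (le_iSup_of_le ?_ (le_iSup_of_le ?_ ?_))
  · rintro _ ⟨i, rfl⟩
    exact ⟨hQ i, hΩ i⟩
  · rintro _ ⟨i, rfl⟩ _ ⟨j, rfl⟩ hij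
    exact hd fun h => hij (by rw [h])
  · exact (tsum_range (f := fun Q : Set 𝔼 => ENNReal.ofReal (meanOsc u Q)) hinj).ge

end Cubes

section Density

variable {n : ℕ}

local notation "𝔼" => EuclideanSpace ℝ (Fin n)

/-- Smooth cutoff functions of a cube, with a gradient bound scaling like the inverse side. -/
lemma exists_cutoff {δ : ℝ} (hδ : 0 < δ) :
    ∃ M : ℝ, 0 ≤ M ∧ ∀ (T : 𝔼 ≃ₗᵢ[ℝ] 𝔼) (c : 𝔼) (r : ℝ), 0 < r →
      ∃ ψ : 𝔼 → ℝ, ContDiff ℝ 1 ψ ∧ (∀ y, 0 ≤ ψ y) ∧ (∀ y, ψ y ≤ 1) ∧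
        (∀ y ∈ closedCube T c r, ψ y = 1) ∧ tsupport ψ ⊆ closedCube T c ((1 + δ) * r) ∧
        ∀ y, ‖fderiv ℝ ψ y‖ ≤ M / r := by
  let θ : ContDiffBump (0 : ℝ) := ⟨1 / 2, (1 + δ) / 2, by norm_num, by linarith⟩
  let ψ₀ : 𝔼 → ℝ := fun v => ∏ i, θ (v i)
  have hψ₀ : ContDiff ℝ 1 ψ₀ := by
    refine contDiff_prod fun i _ => ?_
    exact θ.contDiff.comp (by fun_prop)
  have hzero : ∀ v : 𝔼, ψ₀ v ≠ 0 → ∀ i, |v i| ≤ (1 + δ) / 2 := by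
    intro v hv i
    by_contra! hlt
    refine hv (Finset.prod_eq_zero (Finset.mem_univ i) (θ.zero_of_le_dist ?_))
    simpa [θ] using hlt.le
  have hcs : HasCompactSupport ψ₀ := by
    refine HasCompactSupport.of_support_subset_isCompact
      (isCompact_closedBall (0 : 𝔼) (n * ((1 + δ) / 2))) fun v hv => ?_
    rw [mem_closedBall_zero_iff]
    exact norm_le_of_forall_coord_le (hzero v hv)
  obtain ⟨M, hM⟩ := hcs.fderiv (𝕜 := ℝ) |>.exists_bound_of_continuous
    (hψ₀.continuous_fderiv one_ne_zero)
  refine ⟨M, (norm_nonneg _).trans (hM 0), fun T c r hr => ?_⟩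
  let A : 𝔼 →L[ℝ] 𝔼 := r⁻¹ • (T.symm : 𝔼 →L[ℝ] 𝔼)
  have hA : ∀ y i, A (y - c) i = r⁻¹ * frameCoord T c y i := by
    intro y i
    simp [A, frameCoord]
  have hA' : ‖A‖ ≤ r⁻¹ := by
    refine A.opNorm_le_bound (by positivity) fun y => ?_
    simp [A, norm_smul, abs_of_pos hr]
  have hAd : ∀ y, HasFDerivAt (fun y => A (y - c)) A y := fun y =>
    A.hasFDerivAt.comp y ((hasFDerivAt_id y).sub_const c)
  have hsc : ∀ y i (s : ℝ), |A (y - c) i| ≤ s / 2 ↔ |frameCoord T c y i| ≤ s * r / 2 := by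
    intro y i s
    rw [hA, abs_mul, abs_of_pos (inv_pos.2 hr), inv_mul_le_iff₀ hr]
    constructor <;> intro h <;> linarith
  refine ⟨fun y => ψ₀ (A (y - c)), ?_, ?_, ?_, ?_, ?_, ?_⟩
  · exact hψ₀.comp (by fun_prop)
  · exact fun y => Finset.prod_nonneg fun i _ => θ.nonneg
  · exact fun y => Finset.prod_le_one (fun i _ => θ.nonneg) fun i _ => θ.le_one
  · intro y hy
    refine Finset.prod_eq_one fun i _ => θ.one_of_mem_closedBall ?_
    rw [mem_closedBall_zero_iff, Real.norm_eq_abs]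
    exact (hsc y i 1).2 (by simpa using hy i)
  · refine closure_minimal (fun y hy i => ?_) (isClosed_closedCube _ _ _)
    exact (hsc y i _).1 (hzero _ hy i)
  · intro y
    have h1 : HasFDerivAt (fun y => ψ₀ (A (y - c))) ((fderiv ℝ ψ₀ (A (y - c))).comp A) y :=
      ((hψ₀.differentiable one_ne_zero) _).hasFDerivAt.comp y (hAd y)
    rw [h1.fderiv]
    calc _ ≤ ‖fderiv ℝ ψ₀ (A (y - c))‖ * ‖A‖ := ContinuousLinearMap.opNorm_comp_le _ _
      _ ≤ M * r⁻¹ := by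
        gcongr
        · exact (norm_nonneg _).trans (hM 0)
        · exact hM _
      _ = M / r := rfl

lemma vdiv_smul_const {ψ : 𝔼 → ℝ} (hψ : Differentiable ℝ ψ) (s y : 𝔼) :
    vdiv n (fun y => ψ y • s) y = fderiv ℝ ψ y s := by
  have h : ∀ v, fderiv ℝ (fun y => ψ y • s) y v = fderiv ℝ ψ y v • s := by
    intro v
    rw [fderiv_smul_const (hψ y)]
    simp
  have hs : s = ∑ i, s i • EuclideanSpace.single i (1 : ℝ) := by
    ext j
    simp [Pi.single_apply]
  simp only [vdiv, h]
  conv_rhs => rw [hs, map_sum]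
  refine Finset.sum_congr rfl fun i _ => ?_
  simp [mul_comm]

/-- Testing the gradient measure against `ψ s` for a cutoff `ψ` and a unit vector `s`. -/
lemma IsVariationPair.integral_le {f : 𝔼 → ℝ} {Ω : Set 𝔼} {μ : Measure 𝔼} {σ : 𝔼 → 𝔼}
    (h : IsVariationPair n f Ω μ σ) (hΩ : IsOpen Ω) (hf : LocallyIntegrableOn f Ω volume)
    {x : 𝔼} {ρ M : ℝ} (hx : closedBall x ρ ⊆ Ω) {s : 𝔼} (hs : ‖s‖ = 1) {ψ : 𝔼 → ℝ}
    (hψ : ContDiff ℝ 1 ψ) (hψ0 : ∀ y, 0 ≤ ψ y) (hψ1 : ∀ y, ψ y ≤ 1)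
    (hsupp : tsupport ψ ⊆ ball x ρ) (hM : ∀ y, ‖fderiv ℝ ψ y‖ ≤ M)
    {g : 𝔼 → ℝ} (hg : ContDiff ℝ 1 g) :
    ∫ y, ψ y ∂μ ≤ M * (∫ y in ball x ρ, |f y - g y|) + (∫ y, |fderiv ℝ g y s| * ψ y)
      + ∫ y in ball x ρ, ‖σ y - s‖ ∂μ := by
  obtain ⟨hfin, -, hσm, hσ1, hdiv⟩ := h
  have hcs : HasCompactSupport ψ :=
    HasCompactSupport.of_support_subset_isCompact (isCompact_closedBall x ρ)
      ((subset_tsupport ψ).trans (hsupp.trans ball_subset_closedBall))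
  have hψd : Differentiable ℝ ψ := hψ.differentiable one_ne_zero
  have hdψc : Continuous fun y => fderiv ℝ ψ y s :=
    (hψ.continuous_fderiv one_ne_zero).clm_apply continuous_const
  have hdgc : Continuous fun y => fderiv ℝ g y s :=
    (hg.continuous_fderiv one_ne_zero).clm_apply continuous_const
  have hdψs : HasCompactSupport fun y => fderiv ℝ ψ y s := hcs.fderiv_apply (𝕜 := ℝ) s
  have hdψ0 : ∀ y, y ∉ ball x ρ → fderiv ℝ ψ y s = 0 := by
    intro y hy
    have : y ∉ tsupport (fderiv ℝ ψ) := fun hy' => hy (hsupp (tsupport_fderiv_subset ℝ hy'))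
    rw [image_eq_zero_of_notMem_tsupport this]
    rfl
  have hfB : IntegrableOn f (ball x ρ) volume :=
    (hf.integrableOn_compact_subset hx (isCompact_closedBall x ρ)).mono_set ball_subset_closedBall
  have hgB : IntegrableOn g (ball x ρ) volume :=
    (hg.continuous.continuousOn.integrableOn_compact (isCompact_closedBall x ρ)).mono_set
      ball_subset_closedBall
  have hMn : ∀ y, |fderiv ℝ ψ y s| ≤ M := fun y => by
    have := (fderiv ℝ ψ y).le_opNorm s
    rw [hs, mul_one] at this
    exact this.trans (hM y)
  have hM0 : 0 ≤ M := (abs_nonneg _).trans (hMn x)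
  have hprod : ∀ u : 𝔼 → ℝ, IntegrableOn u (ball x ρ) volume →
      IntegrableOn (fun y => u y * fderiv ℝ ψ y s) (ball x ρ) volume := fun u hu =>
    hu.mul_bdd (c := M) hdψc.aestronglyMeasurable (Eventually.of_forall hMn)
  -- the distributional gradient
  have e1 : ∫ y in ball x ρ, f y * fderiv ℝ ψ y s = - ∫ y, ψ y * ⟪s, σ y⟫ ∂μ := by
    have h1 := hdiv (fun y => ψ y • s) (hψ.smul contDiff_const) hcs.smul_right
      ((closure_mono (Function.support_smul_subset_left ψ fun _ => s)).trans
        (hsupp.trans (ball_subset_closedBall.trans hx)))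
    simp only [vdiv_smul_const hψd, real_inner_smul_left] at h1
    rw [← h1]
    refine (setIntegral_eq_of_subset_of_forall_sdiff_eq_zero hΩ.measurableSet
      (ball_subset_closedBall.trans hx) fun y hy => ?_).symm
    rw [hdψ0 y hy.2, mul_zero]
  have e2 : ∫ y in ball x ρ, g y * fderiv ℝ ψ y s = - ∫ y, fderiv ℝ g y s * ψ y := by
    rw [← integral_mul_fderiv_eq_neg_fderiv_mul_of_integrable (f := g) (g := ψ) (v := s)
      ((hdgc.mul hψ.continuous).integrable_of_hasCompactSupport hcs.mul_left)
      ((hg.continuous.mul hdψc).integrable_of_hasCompactSupport hdψs.mul_left)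
      ((hg.continuous.mul hψ.continuous).integrable_of_hasCompactSupport hcs.mul_left)
      (fun y _ => hg.differentiable one_ne_zero y) fun y _ => hψd y]
    exact setIntegral_eq_integral_of_forall_compl_eq_zero fun y hy => by rw [hdψ0 y hy, mul_zero]
  have hψμ : Integrable ψ μ := hψ.continuous.integrable_of_hasCompactSupport hcs
  have hσs : Integrable (fun y => σ y - s) μ := by
    refine Integrable.sub ?_ (integrable_const s)
    exact Integrable.of_bound hσm 1 (hσ1.mono fun y hy => hy.le)
  have e3 : ∫ y, ψ y ∂μ ≤ (∫ y, ψ y * ⟪s, σ y⟫ ∂μ) + ∫ y in ball x ρ, ‖σ y - s‖ ∂μ := by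
    have hI : Integrable (fun y => ψ y * ⟪s, σ y⟫) μ := by
      refine hψμ.mul_bdd (c := 1) (aestronglyMeasurable_const.inner hσm) ?_
      filter_upwards [hσ1] with y hy
      calc ‖⟪s, σ y⟫‖ ≤ ‖s‖ * ‖σ y‖ := norm_inner_le_norm _ _
        _ = 1 := by rw [hs, hy, mul_one]
    rw [← sub_le_iff_le_add', ← integral_sub hψμ hI, ← integral_indicator measurableSet_ball]
    refine integral_mono (hψμ.sub hI) (hσs.norm.indicator measurableSet_ball) fun y => ?_
    by_cases hy : y ∈ ball x ρ
    · simp only [Set.indicator_of_mem hy]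
      have h1 : 1 - ⟪s, σ y⟫ ≤ ‖σ y - s‖ := by
        have : ⟪s, s - σ y⟫ = 1 - ⟪s, σ y⟫ := by
          rw [inner_sub_right, real_inner_self_eq_norm_sq, hs, one_pow]
        rw [← this]
        refine (real_inner_le_norm _ _).trans ?_
        rw [hs, one_mul, norm_sub_rev]
      nlinarith [hψ0 y, hψ1 y, norm_nonneg (σ y - s)]
    · have : ψ y = 0 := image_eq_zero_of_notMem_tsupport fun hy' => hy (hsupp hy')
      simp [Set.indicator_of_notMem hy, this]
  have e4 : ∫ y, ψ y * ⟪s, σ y⟫ ∂μ =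
      -(∫ y in ball x ρ, (f y - g y) * fderiv ℝ ψ y s) + ∫ y, fderiv ℝ g y s * ψ y := by
    simp only [sub_mul]
    rw [integral_sub (hprod f hfB) (hprod g hgB), e1, e2]
    ring
  have e5 : -(∫ y in ball x ρ, (f y - g y) * fderiv ℝ ψ y s) ≤
      M * ∫ y in ball x ρ, |f y - g y| := by
    rw [← integral_const_mul, ← integral_neg]
    refine integral_mono (hprod _ (hfB.sub hgB)).neg ((hfB.sub hgB).abs.const_mul M) fun y => ?_
    calc -((f y - g y) * fderiv ℝ ψ y s) ≤ |(f y - g y) * fderiv ℝ ψ y s| := neg_le_abs _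
      _ = |fderiv ℝ ψ y s| * |f y - g y| := by rw [abs_mul, mul_comm]
      _ ≤ M * |f y - g y| := by gcongr; exact hMn y
  have e6 : ∫ y, fderiv ℝ g y s * ψ y ≤ ∫ y, |fderiv ℝ g y s| * ψ y := by
    refine integral_mono ((hdgc.mul hψ.continuous).integrable_of_hasCompactSupport hcs.mul_left)
      ((hdgc.abs.mul hψ.continuous).integrable_of_hasCompactSupport hcs.mul_left) fun y => ?_
    exact mul_le_mul_of_nonneg_right (le_abs_self _) (hψ0 y)
  linarith

end Density

section Blowup

variable {n : ℕ}

local notation "𝔼" => EuclideanSpace ℝ (Fin n)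

lemma exists_measureReal_closedCube_le {δ : ℝ} (hδ : 0 < δ) :
    ∃ M : ℝ, 0 ≤ M ∧ ∀ {f : 𝔼 → ℝ} {Ω : Set 𝔼} {μ : Measure 𝔼} {σ : 𝔼 → 𝔼},
      IsVariationPair n f Ω μ σ → IsOpen Ω → LocallyIntegrableOn f Ω volume →
      ∀ {x : 𝔼} {ρ : ℝ}, closedBall x ρ ⊆ Ω → ‖σ x‖ = 1 →
      ∀ {T : 𝔼 ≃ₗᵢ[ℝ] 𝔼} {c : 𝔼} {r : ℝ}, 0 < r → closedCube T c ((1 + δ) * r) ⊆ ball x ρ →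
      ∀ {g : 𝔼 → ℝ}, ContDiff ℝ 1 g →
      μ.real (closedCube T c r) ≤ M / r * (∫ y in ball x ρ, |f y - g y|)
        + (∫ y in closedCube T c ((1 + δ) * r), |fderiv ℝ g y (σ x)|)
        + ∫ y in ball x ρ, ‖σ y - σ x‖ ∂μ := by
  obtain ⟨M, hM0, hM⟩ := exists_cutoff (n := n) hδ
  refine ⟨M, hM0, ?_⟩
  intro f Ω μ σ h hΩ hf x ρ hx hσ T c r hr hsub g hg
  obtain ⟨ψ, hψ, hψ0, hψ1, hψe, hψs, hψd⟩ := hM T c r hr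
  have hfin := h.1
  have hmain := h.integral_le hΩ hf hx hσ hψ hψ0 hψ1 (hψs.trans hsub) hψd hg
  have hcK : IsCompact (closedCube T c ((1 + δ) * r)) :=
    (isCompact_closedBall _ _).of_isClosed_subset (isClosed_closedCube _ _ _)
      (closedCube_subset_closedBall _ _ _)
  have hcs : HasCompactSupport ψ := hcK.of_isClosed_subset (isClosed_tsupport ψ) hψs
  have hdgc : Continuous fun y => fderiv ℝ g y (σ x) :=
    (hg.continuous_fderiv one_ne_zero).clm_apply continuous_const
  have h1 : μ.real (closedCube T c r) ≤ ∫ y, ψ y ∂μ := by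
    rw [← integral_indicator_one (isClosed_closedCube T c r).measurableSet]
    refine integral_mono ?_ (hψ.continuous.integrable_of_hasCompactSupport hcs) fun y => ?_
    · exact (integrable_indicator_iff (isClosed_closedCube T c r).measurableSet).2
        (integrable_const 1).integrableOn
    · by_cases hy : y ∈ closedCube T c r
      · simp [hy, hψe y hy]
      · simp [hy, hψ0 y]
  have h2 : ∫ y, |fderiv ℝ g y (σ x)| * ψ y ≤
      ∫ y in closedCube T c ((1 + δ) * r), |fderiv ℝ g y (σ x)| := by
    rw [← integral_indicator (isClosed_closedCube T c _).measurableSet]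
    refine integral_mono
      ((hdgc.abs.mul hψ.continuous).integrable_of_hasCompactSupport hcs.mul_left)
      ((integrable_indicator_iff (isClosed_closedCube T c _).measurableSet).2
        (hdgc.abs.continuousOn.integrableOn_compact hcK)) fun y => ?_
    by_cases hy : y ∈ closedCube T c ((1 + δ) * r)
    · simp only [Set.indicator_of_mem hy]
      exact mul_le_of_le_one_right (abs_nonneg _) (hψ1 y)
    · have : ψ y = 0 := image_eq_zero_of_notMem_tsupport fun hy' => hy (hψs hy')
      simp [hy, this]
  linarith

/-- The two-valued function jumping from `b` to `a` across the hyperplane through `x`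
orthogonal to `e`. -/
def stepFun (x : 𝔼) (a b : ℝ) (e y : 𝔼) : ℝ := if 0 < ⟪y - x, e⟫ then a else b

lemma measurable_stepFun (x : 𝔼) (a b : ℝ) (e : 𝔼) : Measurable (stepFun x a b e) := by
  refine Measurable.ite ?_ measurable_const measurable_const
  exact measurableSet_lt measurable_const (by fun_prop)

lemma integrableOn_stepFun (x : 𝔼) (a b : ℝ) (e : 𝔼) {s : Set 𝔼} (hs : volume s ≠ ⊤) :
    IntegrableOn (stepFun x a b e) s volume := by
  refine Measure.integrableOn_of_bounded (M := |a| + |b|) hs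
    (measurable_stepFun x a b e).aestronglyMeasurable (Eventually.of_forall fun y => ?_)
  unfold stepFun
  split_ifs <;> rw [Real.norm_eq_abs] <;> linarith [abs_nonneg a, abs_nonneg b]

/-- At scale `r` around `x`, the function `f` is `L¹`-close to a jump from `b` to `a`. -/
def IsFlatAt (f : 𝔼 → ℝ) (Ω : Set 𝔼) (θ : ℝ) (x : 𝔼) (a b : ℝ) (e : 𝔼) (r : ℝ) : Prop :=
  closedBall x r ⊆ Ω ∧ ∫ y in ball x r, |f y - stepFun x a b e y| ≤ θ * |a - b| * r ^ n

lemma measureReal_ball_le (x : 𝔼) {r : ℝ} (hr : 0 ≤ r) : volume.real (ball x r) ≤ (2 * r) ^ n := by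
  have h1 : ball x r ⊆ closedCube (LinearIsometryEquiv.refl ℝ 𝔼) x (2 * r) := by
    have := closedBall_subset_closedCube (LinearIsometryEquiv.refl ℝ 𝔼) x (2 * r)
    rw [mul_div_cancel_left₀ _ two_ne_zero] at this
    exact ball_subset_closedBall.trans this
  have h2 := measure_mono (μ := volume) h1
  rw [volume_closedCube _ _ (by positivity)] at h2
  exact ENNReal.toReal_le_of_le_ofReal (by positivity) h2

/-- A self-improving scaling inequality gives a power bound. -/
lemma exists_le_const_mul_pow {m : ℝ → ℝ} {k : ℕ} {A C r₀ S : ℝ} (hA : 1 < A) (hC : 0 ≤ C)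
    (hr₀ : 0 < r₀) (hS : ∀ r, m r ≤ S) (hS0 : 0 ≤ S)
    (h : ∀ r, 0 < r → r < r₀ → m r ≤ C * r ^ k + (2 * A ^ k)⁻¹ * m (A * r)) :
    ∃ C', 0 ≤ C' ∧ ∀ r, 0 < r → m r ≤ C' * r ^ k := by
  have hA0 : 0 < A := by linarith
  set C' := 2 * C + S / r₀ ^ k with hC'
  have hSr : 0 ≤ S / r₀ ^ k := by positivity
  have hC'0 : 0 ≤ C' := by positivity
  have hbase : ∀ r, r₀ ≤ r → m r ≤ C' * r ^ k := by
    intro r hr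
    calc m r ≤ S := hS r
      _ = S / r₀ ^ k * r₀ ^ k := by field_simp
      _ ≤ C' * r ^ k := by
        gcongr
        linarith
  have hind : ∀ j : ℕ, ∀ r, r₀ / A ^ j ≤ r → m r ≤ C' * r ^ k := by
    intro j
    induction j with
    | zero => simpa using hbase
    | succ j ih =>
      intro r hr
      rcases le_or_gt r₀ r with hr' | hr'
      · exact hbase r hr'
      have hr0 : 0 < r := lt_of_lt_of_le (by positivity) hr
      have h1 := ih (A * r) (by
        rw [div_le_iff₀ (by positivity)] at hr ⊢
        calc r₀ ≤ r * A ^ (j + 1) := hr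
          _ = A * r * A ^ j := by ring)
      calc m r ≤ C * r ^ k + (2 * A ^ k)⁻¹ * m (A * r) := h r hr0 hr'
        _ ≤ C * r ^ k + (2 * A ^ k)⁻¹ * (C' * (A * r) ^ k) := by gcongr
        _ = (C + C' / 2) * r ^ k := by
          rw [mul_pow]
          field_simp
        _ ≤ C' * r ^ k := by
          gcongr
          rw [hC']
          linarith
  refine ⟨C', hC'0, fun r hr => ?_⟩
  obtain ⟨j, hj⟩ := pow_unbounded_of_one_lt (r₀ / r) hA
  refine hind j r ?_
  rw [div_le_iff₀ (by positivity)]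
  rw [div_lt_iff₀ hr] at hj
  linarith

/-- Integrals over balls of `‖σ - σ x‖` at a Lebesgue point of `σ`. -/
lemma eventually_setIntegral_norm_sub_le {μ : Measure 𝔼} [IsFiniteMeasure μ] {σ : 𝔼 → 𝔼}
    (hσ : Integrable σ μ) {x : 𝔼}
    (hx : Tendsto (fun r => ⨍ y in closedBall x r, ‖σ y - σ x‖ ∂μ) (𝓝[>] 0) (𝓝 0))
    {κ : ℝ} (hκ : 0 < κ) :
    ∀ᶠ r in 𝓝[>] 0, ∫ y in ball x r, ‖σ y - σ x‖ ∂μ ≤ κ * μ.real (closedBall x r) := by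
  filter_upwards [hx.eventually_lt_const hκ] with r hr
  calc ∫ y in ball x r, ‖σ y - σ x‖ ∂μ ≤ ∫ y in closedBall x r, ‖σ y - σ x‖ ∂μ := by
        refine setIntegral_mono_set ((hσ.sub (integrable_const _)).norm.integrableOn) ?_ ?_
        · exact Eventually.of_forall fun y => norm_nonneg _
        · exact ball_subset_closedBall.eventuallyLE
    _ = μ.real (closedBall x r) * ⨍ y in closedBall x r, ‖σ y - σ x‖ ∂μ := by
        rw [← smul_eq_mul, measure_smul_setAverage _ (measure_ne_top μ _)]
    _ ≤ κ * μ.real (closedBall x r) := by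
        rw [mul_comm]
        gcongr

/-- Any eventual property at `0⁺` also holds eventually at a positive multiple. -/
lemma eventually_const_mul {p : ℝ → Prop} (h : ∀ᶠ r in 𝓝[>] (0 : ℝ), p r) {A : ℝ} (hA : 0 < A) :
    ∀ᶠ r in 𝓝[>] (0 : ℝ), p (A * r) := by
  have : Tendsto (fun r : ℝ => A * r) (𝓝[>] 0) (𝓝[>] 0) := by
    refine tendsto_nhdsWithin_iff.2 ⟨?_, ?_⟩
    · have : Tendsto (fun r : ℝ => A * r) (𝓝 0) (𝓝 (A * 0)) := tendsto_id.const_mul A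
      rw [mul_zero] at this
      exact this.mono_left nhdsWithin_le_nhds
    · filter_upwards [self_mem_nhdsWithin] with r hr
      exact mul_pos hA hr
  exact this.eventually h

/-- The gradient measure has at most codimension-one growth at points of flatness. -/
lemma exists_measureReal_closedBall_le (hn : 1 ≤ n) {f : 𝔼 → ℝ} {Ω : Set 𝔼} {μ : Measure 𝔼}
    {σ : 𝔼 → 𝔼} (h : IsVariationPair n f Ω μ σ) (hΩ : IsOpen Ω)
    (hf : LocallyIntegrableOn f Ω volume) {x : 𝔼} (hσ : ‖σ x‖ = 1)
    (hx : Tendsto (fun r => ⨍ y in closedBall x r, ‖σ y - σ x‖ ∂μ) (𝓝[>] 0) (𝓝 0))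
    {θ : ℝ} (hθ : 0 ≤ θ) {a b : ℝ} {e : 𝔼} (hfl : ∀ᶠ r in 𝓝[>] 0, IsFlatAt f Ω θ x a b e r) :
    ∃ C, 0 ≤ C ∧ ∀ r, 0 < r → μ.real (closedBall x r) ≤ C * r ^ (n - 1) := by
  have hfin := h.1
  have hn1 : (1 : ℝ) ≤ n := by exact_mod_cast hn
  obtain ⟨M, hM0, hM⟩ := exists_measureReal_closedCube_le (n := n) one_pos
  have hσi : Integrable σ μ := Integrable.of_bound h.2.2.1 1 (h.2.2.2.1.mono fun y hy => hy.le)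
  set A : ℝ := 4 * n with hA
  have hA1 : 1 < A := by linarith
  have hev := eventually_const_mul (hfl.and (eventually_setIntegral_norm_sub_le hσi hx
    (κ := (2 * A ^ (n - 1))⁻¹) (by positivity))) (A := A) (by linarith)
  obtain ⟨r₀, hr₀, hr₀'⟩ := mem_nhdsGT_iff_exists_Ioo_subset.1 hev
  have hr₀ : 0 < r₀ := hr₀
  refine exists_le_const_mul_pow (C := M / 2 * (θ * |a - b| * A ^ n + |a - b| * (2 * A) ^ n))
    hA1 (by positivity) hr₀ (fun r => measureReal_mono (Set.subset_univ _)) measureReal_nonneg ?_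
  intro r hr hrr
  obtain ⟨⟨hsub, hflat⟩, hleb⟩ := hr₀' ⟨hr, hrr⟩
  have hρ : 0 < A * r := by positivity
  have h1 := hM h hΩ hf hsub hσ (T := LinearIsometryEquiv.refl ℝ 𝔼) (c := x) (r := 2 * r)
    (by positivity) (by
      refine (closedCube_subset_closedBall _ _ _).trans (closedBall_subset_ball ?_)
      rw [hA]
      nlinarith) (g := fun _ => b) contDiff_const
  simp only [fderiv_const_apply, zero_apply, abs_zero, integral_zero,
    add_zero] at h1
  have h2 : μ.real (closedBall x r) ≤
      μ.real (closedCube (LinearIsometryEquiv.refl ℝ 𝔼) x (2 * r)) := by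
    refine measureReal_mono ?_
    have := closedBall_subset_closedCube (LinearIsometryEquiv.refl ℝ 𝔼) x (2 * r)
    rwa [mul_div_cancel_left₀ _ two_ne_zero] at this
  have hfB : IntegrableOn f (ball x (A * r)) volume :=
    (hf.integrableOn_compact_subset hsub (isCompact_closedBall x _)).mono_set ball_subset_closedBall
  have hsB : IntegrableOn (stepFun x a b e) (ball x (A * r)) volume :=
    integrableOn_stepFun _ _ _ _ measure_ball_lt_top.ne
  have : Fact (volume (ball x (A * r)) < ⊤) := ⟨measure_ball_lt_top⟩
  have h3 : ∫ y in ball x (A * r), |f y - b| ≤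
      θ * |a - b| * (A * r) ^ n + |a - b| * (2 * (A * r)) ^ n := by
    calc ∫ y in ball x (A * r), |f y - b|
        ≤ ∫ y in ball x (A * r), (|f y - stepFun x a b e y| + |a - b|) := by
          refine integral_mono (hfB.sub (integrable_const b)).abs
            ((hfB.sub hsB).abs.add (integrable_const _)) fun y => ?_
          have hs : |stepFun x a b e y - b| ≤ |a - b| := by
            unfold stepFun
            split_ifs <;> simp
          linarith [abs_sub_le (f y) (stepFun x a b e y) b]
      _ = (∫ y in ball x (A * r), |f y - stepFun x a b e y|)
            + volume.real (ball x (A * r)) * |a - b| := by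
          have hI : IntegrableOn (fun y => |f y - stepFun x a b e y|) (ball x (A * r)) volume :=
            (hfB.sub hsB).abs
          rw [integral_add hI (integrable_const _)]
          simp
      _ ≤ _ := by
          rw [mul_comm (volume.real _)]
          gcongr
          exact measureReal_ball_le x hρ.le
  have h4 : r ^ n = r * r ^ (n - 1) := by
    rw [← pow_succ']
    congr 1
    omega
  calc μ.real (closedBall x r) ≤ _ := h2
    _ ≤ M / (2 * r) * (∫ y in ball x (A * r), |f y - b|)
        + ∫ y in ball x (A * r), ‖σ y - σ x‖ ∂μ := h1
    _ ≤ M / (2 * r) * (θ * |a - b| * (A * r) ^ n + |a - b| * (2 * (A * r)) ^ n)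
        + (2 * A ^ (n - 1))⁻¹ * μ.real (closedBall x (A * r)) := by gcongr
    _ = _ := by
        congr 1
        simp only [mul_pow, h4]
        field_simp

end Blowup

section Density

variable {n : ℕ}

local notation "𝔼" => EuclideanSpace ℝ (Fin n)

lemma prod_ite_eq_mul_pow {R : Type*} [CommMonoid R] (i₀ : Fin n) (p q : R) :
    ∏ i, (if i = i₀ then p else q) = p * q ^ (n - 1) := by
  rw [← Finset.mul_prod_erase Finset.univ _ (Finset.mem_univ i₀), if_pos rfl]
  congr 1
  rw [Finset.prod_congr rfl fun i hi => if_neg (Finset.ne_of_mem_erase hi)]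
  simp

lemma setIntegral_closedCube_comp (T : 𝔼 ≃ₗᵢ[ℝ] 𝔼) (c : 𝔼) {r : ℝ} (hr : 0 ≤ r) (i₀ : Fin n)
    (φ : ℝ → ℝ) :
    ∫ y in closedCube T c r, φ (frameCoord T c y i₀) =
      (∫ t in Set.Icc (-(r / 2)) (r / 2), φ t) * r ^ (n - 1) := by
  have h := integral_prod_frameCoord T c
    (fun i => (Set.Icc (-(r / 2)) (r / 2)).indicator (if i = i₀ then φ else fun _ => 1))
  have h2 : ∀ i, ∫ t, (Set.Icc (-(r / 2)) (r / 2)).indicator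
      (if i = i₀ then φ else fun _ => 1) t =
      if i = i₀ then (∫ t in Set.Icc (-(r / 2)) (r / 2), φ t) else r := by
    intro i
    rw [integral_indicator measurableSet_Icc]
    split_ifs
    · rfl
    · simp [hr]
  simp only [h2] at h
  rw [prod_ite_eq_mul_pow] at h
  rw [← h, ← integral_indicator (isClosed_closedCube T c r).measurableSet]
  refine integral_congr_ae (Eventually.of_forall fun y => ?_)
  by_cases hy : y ∈ closedCube T c r
  · have hy' : ∀ i, frameCoord T c y i ∈ Set.Icc (-(r / 2)) (r / 2) := fun i => abs_le.1 (hy i)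
    simp only [Set.indicator_of_mem hy, Set.indicator_of_mem (hy' _)]
    rw [Finset.prod_eq_single i₀ (fun i _ hi => by simp [hi]) (by simp)]
    simp
  · have : ∃ i, frameCoord T c y i ∉ Set.Icc (-(r / 2)) (r / 2) := by
      by_contra hcon
      push Not at hcon
      exact hy fun i => abs_le.2 (hcon i)
    obtain ⟨i, hi⟩ := this
    simp only [Set.indicator_of_notMem hy]
    rw [Finset.prod_eq_zero (Finset.mem_univ i) (by simp only [Set.indicator_of_notMem hi])]

/-- A smooth approximation of `stepFun`, with transition layer of width `s`. -/
def smoothStep (x : 𝔼) (a b : ℝ) (e : 𝔼) (s : ℝ) (y : 𝔼) : ℝ :=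
  b + (a - b) * Real.smoothTransition (⟪y - x, e⟫ / s)

lemma contDiff_smoothStep (x : 𝔼) (a b : ℝ) (e : 𝔼) (s : ℝ) :
    ContDiff ℝ 1 (smoothStep x a b e s) := by
  unfold smoothStep
  refine contDiff_const.add (contDiff_const.mul (Real.smoothTransition.contDiff.comp ?_))
  exact ((contDiff_id.sub contDiff_const).inner ℝ contDiff_const).div_const _

lemma abs_fderiv_smoothStep_le (x : 𝔼) (a b : ℝ) {e : 𝔼} (he : ‖e‖ = 1) {s : ℝ} (y : 𝔼)
    {w : 𝔼} (hw : ‖w‖ = 1) :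
    |fderiv ℝ (smoothStep x a b e s) y w| ≤
      |a - b| * |deriv (fun t => Real.smoothTransition (t / s)) ⟪y - x, e⟫| := by
  set H : ℝ → ℝ := fun t => Real.smoothTransition (t / s) with hH
  have hHd : Differentiable ℝ H := by
    have : ContDiff ℝ 1 H := Real.smoothTransition.contDiff.comp (contDiff_id.div_const s)
    exact this.differentiable one_ne_zero
  have h1 : HasFDerivAt (fun y : 𝔼 => ⟪y - x, e⟫) (innerSL ℝ e) y := by
    have : HasFDerivAt (fun y : 𝔼 => innerSL ℝ e (y - x)) (innerSL ℝ e) y :=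
      (innerSL ℝ e).hasFDerivAt.comp y ((hasFDerivAt_id y).sub_const x)
    simpa [real_inner_comm] using this
  have h2 : HasFDerivAt (smoothStep x a b e s)
      ((a - b) • (deriv H ⟪y - x, e⟫ • innerSL ℝ e)) y :=
    (((hHd _).hasDerivAt.comp_hasFDerivAt y h1).const_mul (a - b)).const_add b
  rw [h2.fderiv]
  simp only [smul_apply, smul_eq_mul, innerSL_apply_apply, abs_mul]
  have : |⟪e, w⟫| ≤ 1 := by
    have := abs_real_inner_le_norm e w
    rwa [he, hw, one_mul] at this
  gcongr
  exact mul_le_of_le_one_right (abs_nonneg _) this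

lemma setIntegral_abs_fderiv_smoothStep_le {T : 𝔼 ≃ₗᵢ[ℝ] 𝔼} {i₀ : Fin n} {e : 𝔼}
    (hT : T (EuclideanSpace.single i₀ 1) = e) (he : ‖e‖ = 1) (x c : 𝔼) (a b : ℝ) {s r : ℝ}
    (hs : 0 < s) (hr : 0 ≤ r) {w : 𝔼} (hw : ‖w‖ = 1) :
    ∫ y in closedCube T c r, |fderiv ℝ (smoothStep x a b e s) y w| ≤ |a - b| * r ^ (n - 1) := by
  set H : ℝ → ℝ := fun t => Real.smoothTransition (t / s) with hH
  have hHc : ContDiff ℝ 1 H := Real.smoothTransition.contDiff.comp (contDiff_id.div_const s)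
  have hHd : Differentiable ℝ H := hHc.differentiable one_ne_zero
  have hHdc : Continuous (deriv H) := hHc.continuous_deriv le_rfl
  have hmono : Monotone H := fun t t' h => Real.smoothTransition.monotone (by gcongr)
  set k : ℝ := ⟪c - x, e⟫ with hk
  have hin : ∀ y, ⟪y - x, e⟫ = frameCoord T c y i₀ + k := by
    intro y
    rw [frameCoord_eq_inner hT, hk, ← inner_add_left]
    congr 1
    abel
  have hcK : IsCompact (closedCube T c r) :=
    (isCompact_closedBall _ _).of_isClosed_subset (isClosed_closedCube _ _ _)
      (closedCube_subset_closedBall _ _ _)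
  have hdgc : Continuous fun y => fderiv ℝ (smoothStep x a b e s) y w :=
    ((contDiff_smoothStep x a b e s).continuous_fderiv one_ne_zero).clm_apply continuous_const
  have hcf : Continuous fun y => frameCoord T c y i₀ :=
    (continuous_apply i₀).comp (continuous_frameCoord T c)
  calc ∫ y in closedCube T c r, |fderiv ℝ (smoothStep x a b e s) y w|
      ≤ ∫ y in closedCube T c r, |a - b| * deriv H (frameCoord T c y i₀ + k) := by
        refine setIntegral_mono (hdgc.abs.continuousOn.integrableOn_compact hcK)
          (ContinuousOn.integrableOn_compact hcK (Continuous.continuousOn ?_)) fun y => ?_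
        · exact continuous_const.mul (hHdc.comp (hcf.add continuous_const))
        · have := abs_fderiv_smoothStep_le x a b he (s := s) y hw
          rwa [hin, abs_of_nonneg (hmono.deriv_nonneg)] at this
    _ = |a - b| * ((∫ t in Set.Icc (-(r / 2)) (r / 2), deriv H (t + k)) * r ^ (n - 1)) := by
        rw [integral_const_mul, setIntegral_closedCube_comp T c hr i₀ fun t => deriv H (t + k)]
    _ ≤ |a - b| * (1 * r ^ (n - 1)) := by
        gcongr
        rw [integral_Icc_eq_integral_Ioc, ← intervalIntegral.integral_of_le (by linarith)]
        rw [intervalIntegral.integral_comp_add_right (deriv H),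
          intervalIntegral.integral_deriv_eq_sub (fun t _ => hHd t)
            (hHdc.intervalIntegrable _ _)]
        have h1 : H (r / 2 + k) ≤ 1 := Real.smoothTransition.le_one _
        have h2 : 0 ≤ H (-(r / 2) + k) := Real.smoothTransition.nonneg _
        linarith
    _ = _ := by rw [one_mul]

lemma setIntegral_abs_stepFun_sub_smoothStep_le {T : 𝔼 ≃ₗᵢ[ℝ] 𝔼} {i₀ : Fin n} {e : 𝔼}
    (hT : T (EuclideanSpace.single i₀ 1) = e) (x : 𝔼) (a b : ℝ) {s ρ : ℝ}
    (hs : 0 < s) (hρ : 0 ≤ ρ) :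
    ∫ y in ball x ρ, |stepFun x a b e y - smoothStep x a b e s y| ≤
      |a - b| * (s * (2 * ρ) ^ (n - 1)) := by
  set S : Set 𝔼 := {y | 0 < ⟪y - x, e⟫ ∧ ⟪y - x, e⟫ < s} with hS
  have hSm : MeasurableSet S := by
    have hm : Measurable fun y : 𝔼 => ⟪y - x, e⟫ := by fun_prop
    exact (measurableSet_lt measurable_const hm).inter (measurableSet_lt hm measurable_const)
  have hpt : ∀ y, |stepFun x a b e y - smoothStep x a b e s y| ≤
      S.indicator (fun _ => |a - b|) y := by
    intro y
    unfold stepFun smoothStep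
    split_ifs with h
    · by_cases h2 : ⟪y - x, e⟫ < s
      · rw [Set.indicator_of_mem (show y ∈ S from ⟨h, h2⟩)]
        have h3 : a - (b + (a - b) * Real.smoothTransition (⟪y - x, e⟫ / s)) =
            (a - b) * (1 - Real.smoothTransition (⟪y - x, e⟫ / s)) := by ring
        rw [h3, abs_mul]
        refine mul_le_of_le_one_right (abs_nonneg _) ?_
        rw [abs_le]
        constructor <;> linarith [Real.smoothTransition.nonneg (⟪y - x, e⟫ / s),
          Real.smoothTransition.le_one (⟪y - x, e⟫ / s)]
      · rw [Real.smoothTransition.one_of_one_le]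
        · simp only [mul_one, add_sub_cancel, sub_self, abs_zero]
          exact Set.indicator_nonneg (fun _ _ => abs_nonneg _) _
        · rw [le_div_iff₀ hs]
          linarith
    · rw [Real.smoothTransition.zero_of_nonpos]
      · simp only [mul_zero, add_zero, sub_self, abs_zero]
        exact Set.indicator_nonneg (fun _ _ => abs_nonneg _) _
      · exact div_nonpos_of_nonpos_of_nonneg (not_lt.1 h) hs.le
  have hvol : volume (S ∩ ball x ρ) ≤ ENNReal.ofReal (s * (2 * ρ) ^ (n - 1)) := by
    have h1 : S ∩ ball x ρ ⊆ {z | ∀ i, frameCoord T x z i ∈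
        (if i = i₀ then Set.Ioo 0 s else Set.Icc (-ρ) ρ)} := by
      rintro z ⟨hz1, hz2⟩ i
      split_ifs with hi
      · rw [hi, frameCoord_eq_inner hT]
        exact hz1
      · refine abs_le.1 ((abs_coord_le_norm _ i).trans ?_)
        rw [LinearIsometryEquiv.norm_map]
        exact (mem_ball_iff_norm.1 hz2).le
    refine (measure_mono h1).trans_eq ?_
    rw [volume_frameCoord_preimage_pi T x fun i => if i = i₀ then Set.Ioo 0 s else Set.Icc (-ρ) ρ]
    have : ∀ i, volume (if i = i₀ then Set.Ioo 0 s else Set.Icc (-ρ) ρ) =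
        if i = i₀ then ENNReal.ofReal s else ENNReal.ofReal (2 * ρ) := by
      intro i
      split_ifs
      · simp
      · rw [Real.volume_Icc]
        congr 1
        ring
    simp only [this]
    rw [prod_ite_eq_mul_pow, ENNReal.ofReal_mul hs.le, ENNReal.ofReal_pow (by positivity)]
  have hfin : volume (S ∩ ball x ρ) ≠ ⊤ := (hvol.trans_lt ENNReal.ofReal_lt_top).ne
  have hb : volume (ball x ρ) ≠ ⊤ := measure_ball_lt_top.ne
  calc ∫ y in ball x ρ, |stepFun x a b e y - smoothStep x a b e s y|
      ≤ ∫ y in ball x ρ, S.indicator (fun _ => |a - b|) y := by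
        refine setIntegral_mono ?_ ?_ hpt
        · refine ((integrableOn_stepFun x a b e hb).sub ?_).abs
          exact ((contDiff_smoothStep x a b e s).continuous.continuousOn.integrableOn_compact
            (isCompact_closedBall x ρ)).mono_set ball_subset_closedBall
        · exact (integrable_indicator_iff hSm).2 (integrableOn_const (by
            rw [Measure.restrict_apply hSm]
            exact hfin))
    _ = volume.real (S ∩ ball x ρ) * |a - b| := by
        rw [integral_indicator hSm, Measure.restrict_restrict hSm, setIntegral_const, smul_eq_mul]
    _ ≤ s * (2 * ρ) ^ (n - 1) * |a - b| := by
        gcongr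
        exact ENNReal.toReal_le_of_le_ofReal (by positivity) hvol
    _ = _ := mul_comm _ _

/-- At a flat Lebesgue point of the polar vector, the gradient measure of small cubes aligned
with the jump direction is almost bounded by the height of the jump times the area of a face. -/
lemma exists_eventually_measureReal_closedCube_le (hn : 1 ≤ n) {δ : ℝ} (hδ : 0 < δ) :
    ∃ θ₀ : ℝ, 0 < θ₀ ∧ ∀ {f : 𝔼 → ℝ} {Ω : Set 𝔼} {μ : Measure 𝔼} {σ : 𝔼 → 𝔼},
      IsVariationPair n f Ω μ σ → IsOpen Ω → LocallyIntegrableOn f Ω volume →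
      ∀ {x : 𝔼}, ‖σ x‖ = 1 →
      Tendsto (fun r => ⨍ y in closedBall x r, ‖σ y - σ x‖ ∂μ) (𝓝[>] 0) (𝓝 0) →
      ∀ {θ a b : ℝ} {e : 𝔼} {T : 𝔼 ≃ₗᵢ[ℝ] 𝔼} {i₀ : Fin n}, 0 ≤ θ → θ ≤ θ₀ → a ≠ b → ‖e‖ = 1 →
      T (EuclideanSpace.single i₀ 1) = e → (∀ᶠ r in 𝓝[>] 0, IsFlatAt f Ω θ x a b e r) →
      ∀ᶠ r in 𝓝[>] (0 : ℝ), ∀ c, ‖c - x‖ ≤ n * r →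
        μ.real (closedCube T c r) ≤ (1 + δ) * |a - b| * r ^ (n - 1) := by
  have hn1 : (1 : ℝ) ≤ n := by exact_mod_cast hn
  obtain ⟨δ', hδ'0, hδ'1, hδ'⟩ : ∃ δ' : ℝ, 0 < δ' ∧ δ' ≤ 1 ∧ (1 + δ') ^ (n - 1) ≤ 1 + δ / 4 := by
    have h1 : Tendsto (fun t : ℝ => (1 + t) ^ (n - 1)) (𝓝[>] 0) (𝓝 ((1 + 0) ^ (n - 1))) :=
      ((by fun_prop : Continuous fun t : ℝ => (1 + t) ^ (n - 1)).tendsto 0).mono_left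
        nhdsWithin_le_nhds
    rw [add_zero, one_pow] at h1
    obtain ⟨t, h2, h3, h4⟩ := ((h1.eventually_le_const (show 1 < 1 + δ / 4 by linarith)).and
      (Ioc_mem_nhdsGT one_pos)).exists
    exact ⟨t, h3, h4, h2⟩
  obtain ⟨M, hM0, hM⟩ := exists_measureReal_closedCube_le (n := n) hδ'0
  set R : ℝ := 3 * n with hR
  have hR0 : 0 < R := by positivity
  set M' := M + 1 with hM'
  have hM'0 : 0 < M' := by positivity
  set τ : ℝ := δ / 4 / (M' * (2 * R) ^ (n - 1)) with hτ
  have hτ0 : 0 < τ := by positivity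
  refine ⟨δ / 4 / (M' * R ^ n), by positivity, ?_⟩
  intro f Ω μ σ h hΩ hf x hσ hx θ a b e T i₀ hθ hθ₀ hab he hT hfl
  have hfin := h.1
  have hσi : Integrable σ μ := Integrable.of_bound h.2.2.1 1 (h.2.2.2.1.mono fun y hy => hy.le)
  obtain ⟨C, hC0, hC⟩ := exists_measureReal_closedBall_le hn h hΩ hf hσ hx hθ hfl
  have hab0 : 0 < |a - b| := abs_pos.2 (sub_ne_zero.2 hab)
  have hev := eventually_const_mul (hfl.and (eventually_setIntegral_norm_sub_le hσi hx
    (κ := δ / 4 * |a - b| / ((C + 1) * R ^ (n - 1))) (by positivity))) hR0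
  filter_upwards [hev, self_mem_nhdsWithin] with r ⟨⟨hsub, hflat⟩, hleb⟩ hr c hc
  have hr : 0 < r := hr
  have h1 := hM h hΩ hf hsub hσ (T := T) (c := c) hr (by
      refine (closedCube_subset_closedBall _ _ _).trans (closedBall_subset_ball' ?_)
      rw [hR, dist_eq_norm]
      have : n * ((1 + δ') * r / 2) ≤ n * r := by
        gcongr
        nlinarith
      have : 0 < n * r := by positivity
      linarith) (contDiff_smoothStep x a b e (τ * r))
  have h2 := setIntegral_abs_fderiv_smoothStep_le hT he x c a b (s := τ * r) (by positivity)
    (r := (1 + δ') * r) (by positivity) hσ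
  have h3 := setIntegral_abs_stepFun_sub_smoothStep_le hT x a b (s := τ * r) (ρ := R * r)
    (by positivity) (by positivity)
  have hfB : IntegrableOn f (ball x (R * r)) volume :=
    (hf.integrableOn_compact_subset hsub (isCompact_closedBall x _)).mono_set ball_subset_closedBall
  have hsB : IntegrableOn (stepFun x a b e) (ball x (R * r)) volume :=
    integrableOn_stepFun _ _ _ _ measure_ball_lt_top.ne
  have hgB : IntegrableOn (smoothStep x a b e (τ * r)) (ball x (R * r)) volume :=
    ((contDiff_smoothStep x a b e _).continuous.continuousOn.integrableOn_compact
            (isCompact_closedBall x _)).mono_set ball_subset_closedBall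
  have h4 : ∫ y in ball x (R * r), |f y - smoothStep x a b e (τ * r) y| ≤
      θ * |a - b| * (R * r) ^ n + |a - b| * (τ * r * (2 * (R * r)) ^ (n - 1)) := by
    have hI1 : IntegrableOn (fun y => |f y - stepFun x a b e y|) (ball x (R * r)) volume :=
      (hfB.sub hsB).abs
    have hI2 : IntegrableOn (fun y => |stepFun x a b e y - smoothStep x a b e (τ * r) y|)
      (ball x (R * r)) volume := (hsB.sub hgB).abs
    calc ∫ y in ball x (R * r), |f y - smoothStep x a b e (τ * r) y|
        ≤ ∫ y in ball x (R * r), (|f y - stepFun x a b e y|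
          + |stepFun x a b e y - smoothStep x a b e (τ * r) y|) :=
          integral_mono (hfB.sub hgB).abs (hI1.add hI2) fun y => abs_sub_le _ _ _
      _ ≤ _ := by
          rw [integral_add hI1 hI2]
          exact add_le_add hflat h3
  have h5 : r ^ n = r * r ^ (n - 1) := by
    rw [← pow_succ']
    congr 1
    omega
  have e1 : M / r * (∫ y in ball x (R * r), |f y - smoothStep x a b e (τ * r) y|) ≤
      δ / 2 * |a - b| * r ^ (n - 1) := by
    calc M / r * (∫ y in ball x (R * r), |f y - smoothStep x a b e (τ * r) y|)
        ≤ M' / r * (δ / 4 / (M' * R ^ n) * |a - b| * (R * r) ^ n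
          + |a - b| * (τ * r * (2 * (R * r)) ^ (n - 1))) := by
          have h6 : M ≤ M' := by linarith
          have h7 : θ * |a - b| * (R * r) ^ n ≤ δ / 4 / (M' * R ^ n) * |a - b| * (R * r) ^ n := by
            gcongr
          have h8 : 0 ≤ ∫ y in ball x (R * r), |f y - smoothStep x a b e (τ * r) y| :=
            integral_nonneg fun y => abs_nonneg (f y - smoothStep x a b e (τ * r) y)
          exact mul_le_mul (by gcongr) (h4.trans (by gcongr)) h8 (by positivity)
      _ = _ := by
          rw [hτ, ← mul_assoc 2 R r]
          simp only [mul_pow _ r, h5]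
          field_simp
          ring
  have e2 : |a - b| * ((1 + δ') * r) ^ (n - 1) ≤ (1 + δ / 4) * |a - b| * r ^ (n - 1) := by
    rw [mul_pow]
    calc |a - b| * ((1 + δ') ^ (n - 1) * r ^ (n - 1))
        ≤ |a - b| * ((1 + δ / 4) * r ^ (n - 1)) := by gcongr
      _ = _ := by ring
  have e3 : ∫ y in ball x (R * r), ‖σ y - σ x‖ ∂μ ≤ δ / 4 * |a - b| * r ^ (n - 1) := by
    refine hleb.trans ?_
    calc δ / 4 * |a - b| / ((C + 1) * R ^ (n - 1)) * μ.real (closedBall x (R * r))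
        ≤ δ / 4 * |a - b| / ((C + 1) * R ^ (n - 1)) * ((C + 1) * (R * r) ^ (n - 1)) := by
          gcongr
          refine (hC _ (by positivity)).trans ?_
          gcongr
          linarith
      _ = _ := by
          rw [mul_pow R r]
          have : 0 < R ^ (n - 1) := by positivity
          generalize R ^ (n - 1) = P at *
          field_simp
  calc μ.real (closedCube T c r) ≤ δ / 2 * |a - b| * r ^ (n - 1)
        + (1 + δ / 4) * |a - b| * r ^ (n - 1) + δ / 4 * |a - b| * r ^ (n - 1) :=
        h1.trans (add_le_add (add_le_add e1 (h2.trans e2)) e3)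
    _ = _ := by ring

end Density

section Flatness

variable {n : ℕ}

local notation "𝔼" => EuclideanSpace ℝ (Fin n)

lemma volume_hyperplane {e : 𝔼} (he : ‖e‖ = 1) (i₀ : Fin n) (x : 𝔼) :
    volume {y : 𝔼 | ⟪y - x, e⟫ = 0} = 0 := by
  obtain ⟨T, hT⟩ := exists_linearIsometryEquiv_single i₀ he
  have h1 : {y : 𝔼 | ⟪y - x, e⟫ = 0} ⊆ {z | ∀ i, frameCoord T x z i ∈
      (if i = i₀ then {0} else Set.univ : Set ℝ)} := by
    intro z hz i
    split_ifs with hi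
    · rw [hi, frameCoord_eq_inner hT]
      exact hz
    · trivial
  refine measure_mono_null h1 ?_
  rw [volume_frameCoord_preimage_pi T x fun i => if i = i₀ then {0} else Set.univ]
  exact Finset.prod_eq_zero (Finset.mem_univ i₀) (by simp)

lemma measureReal_slab_inter_ball_le {e : 𝔼} (he : ‖e‖ = 1) (i₀ : Fin n) (x : 𝔼) {s ρ : ℝ}
    (hs : 0 ≤ s) (hρ : 0 ≤ ρ) :
    volume.real ({y : 𝔼 | |⟪y - x, e⟫| ≤ s} ∩ ball x ρ) ≤ 2 * s * (2 * ρ) ^ (n - 1) := by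
  obtain ⟨T, hT⟩ := exists_linearIsometryEquiv_single i₀ he
  have h1 : {y : 𝔼 | |⟪y - x, e⟫| ≤ s} ∩ ball x ρ ⊆ {z | ∀ i, frameCoord T x z i ∈
      (if i = i₀ then Set.Icc (-s) s else Set.Icc (-ρ) ρ)} := by
    rintro z ⟨hz1, hz2⟩ i
    split_ifs with hi
    · rw [hi, frameCoord_eq_inner hT]
      exact abs_le.1 hz1
    · refine abs_le.1 ((abs_coord_le_norm _ i).trans ?_)
      rw [LinearIsometryEquiv.norm_map]
      exact (mem_ball_iff_norm.1 hz2).le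
  refine ENNReal.toReal_le_of_le_ofReal (by positivity) ((measure_mono h1).trans_eq ?_)
  rw [volume_frameCoord_preimage_pi T x
    fun i => if i = i₀ then Set.Icc (-s) s else Set.Icc (-ρ) ρ]
  have : ∀ i, volume (if i = i₀ then Set.Icc (-s) s else Set.Icc (-ρ) ρ) =
      if i = i₀ then ENNReal.ofReal (2 * s) else ENNReal.ofReal (2 * ρ) := by
    intro i
    split_ifs <;> rw [Real.volume_Icc] <;> congr 1 <;> ring
  simp only [this]
  rw [prod_ite_eq_mul_pow, ENNReal.ofReal_mul (show 0 ≤ 2 * s by positivity),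
    ENNReal.ofReal_pow (by positivity)]

lemma pow_le_measureReal_ball (hn : 1 ≤ n) (x : 𝔼) {r : ℝ} (hr : 0 < r) :
    (r / n) ^ n ≤ volume.real (ball x r) := by
  have hn0 : (0 : ℝ) < n := by exact_mod_cast hn
  have h1 : closedCube (LinearIsometryEquiv.refl ℝ 𝔼) x (r / n) ⊆ ball x r := by
    refine (closedCube_subset_closedBall _ _ _).trans (closedBall_subset_ball ?_)
    have : n * (r / n / 2) = r / 2 := by field_simp
    linarith
  have h2 := measureReal_mono (μ := volume) h1 measure_ball_lt_top.ne
  rwa [Measure.real, volume_closedCube _ _ (by positivity),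
    ENNReal.toReal_ofReal (by positivity)] at h2

lemma abs_stepFun_sub_stepFun_le (x : 𝔼) (a₀ b₀ a b : ℝ) (e₀ e : 𝔼) {r : ℝ} {y : 𝔼}
    (hy : y ∈ ball x r) :
    |stepFun x a₀ b₀ e₀ y - stepFun x a b e y| ≤ (|a - a₀| + |b - b₀|) +
      {y : 𝔼 | |⟪y - x, e₀⟫| ≤ ‖e - e₀‖ * r}.indicator (fun _ => |a₀ - b₀|) y := by
  have hin : |⟪y - x, e⟫ - ⟪y - x, e₀⟫| ≤ ‖e - e₀‖ * r := by
    rw [← inner_sub_right]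
    refine (abs_real_inner_le_norm _ _).trans ?_
    rw [mul_comm]
    gcongr
    exact (mem_ball_iff_norm.1 hy).le
  have hin := abs_le.1 hin
  have h1 := abs_sub_comm a a₀
  have h2 := abs_sub_comm b b₀
  have h3 := abs_nonneg (a - a₀)
  have h4 := abs_nonneg (b - b₀)
  have h5 : 0 ≤ {y : 𝔼 | |⟪y - x, e₀⟫| ≤ ‖e - e₀‖ * r}.indicator (fun _ => |a₀ - b₀|) y :=
    Set.indicator_nonneg (fun _ _ => abs_nonneg _) _
  unfold stepFun
  split_ifs with h h' h'
  · linarith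
  · have hm : y ∈ {y : 𝔼 | |⟪y - x, e₀⟫| ≤ ‖e - e₀‖ * r} := by
      rw [Set.mem_ofPred_eq, abs_le]
      constructor <;> linarith
    rw [Set.indicator_of_mem hm]
    linarith [abs_sub_le a₀ b₀ b]
  · have hm : y ∈ {y : 𝔼 | |⟪y - x, e₀⟫| ≤ ‖e - e₀‖ * r} := by
      rw [Set.mem_ofPred_eq, abs_le]
      constructor <;> linarith
    rw [Set.indicator_of_mem hm]
    linarith [abs_sub_le b₀ a₀ a, abs_sub_comm a₀ b₀]
  · linarith

lemma setIntegral_ball_abs_stepFun_sub_stepFun_le (hn : 1 ≤ n) (x : 𝔼) (a₀ b₀ a b : ℝ) {e₀ : 𝔼}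
    (he₀ : ‖e₀‖ = 1) (e : 𝔼) {r : ℝ} (hr : 0 < r) :
    ∫ y in ball x r, |stepFun x a₀ b₀ e₀ y - stepFun x a b e y| ≤
      (|a - a₀| + |b - b₀| + |a₀ - b₀| * ‖e - e₀‖) * (2 * r) ^ n := by
  set S := {y : 𝔼 | |⟪y - x, e₀⟫| ≤ ‖e - e₀‖ * r} with hS
  have hSm : MeasurableSet S := measurableSet_le (by fun_prop) measurable_const
  have hb : volume (ball x r) ≠ ⊤ := measure_ball_lt_top.ne
  have : Fact (volume (ball x r) < ⊤) := ⟨measure_ball_lt_top⟩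
  have hI : IntegrableOn (S.indicator fun _ => |a₀ - b₀|) (ball x r) volume :=
    (integrable_const _).indicator hSm
  calc ∫ y in ball x r, |stepFun x a₀ b₀ e₀ y - stepFun x a b e y|
      ≤ ∫ y in ball x r, ((|a - a₀| + |b - b₀|) + S.indicator (fun _ => |a₀ - b₀|) y) := by
        refine setIntegral_mono_on ?_ ((integrable_const _).add hI) measurableSet_ball
          fun y hy => abs_stepFun_sub_stepFun_le x a₀ b₀ a b e₀ e hy
        exact ((integrableOn_stepFun _ _ _ _ hb).sub (integrableOn_stepFun _ _ _ _ hb)).abs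
    _ = volume.real (ball x r) * (|a - a₀| + |b - b₀|)
          + volume.real (S ∩ ball x r) * |a₀ - b₀| := by
        rw [integral_add (integrable_const _) hI, integral_indicator hSm,
          Measure.restrict_restrict hSm, setIntegral_const, setIntegral_const]
        simp
    _ ≤ (2 * r) ^ n * (|a - a₀| + |b - b₀|)
          + 2 * (‖e - e₀‖ * r) * (2 * r) ^ (n - 1) * |a₀ - b₀| := by
        gcongr
        · exact measureReal_ball_le x hr.le
        · exact measureReal_slab_inter_ball_le he₀ ⟨0, hn⟩ x (by positivity) hr.le
    _ = _ := by
        have : (2 * r) ^ n = 2 * r * (2 * r) ^ (n - 1) := by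
          rw [← pow_succ']
          congr 1
          omega
        rw [this]
        ring

lemma eventually_setIntegral_ball_abs_sub_stepFun_le (hn : 1 ≤ n) {f : 𝔼 → ℝ} {Ω : Set 𝔼}
    (hΩ : IsOpen Ω) (hf : LocallyIntegrableOn f Ω volume) {x : 𝔼} (hx : x ∈ Ω) {e : 𝔼}
    (he : ‖e‖ = 1) {a b : ℝ}
    (ha : Tendsto (fun r : ℝ => ⨍ y in {y ∈ ball x r | 0 < ⟪y - x, e⟫}, |f y - a| ∂volume)
      (𝓝[>] 0) (𝓝 0))
    (hb : Tendsto (fun r : ℝ => ⨍ y in {y ∈ ball x r | ⟪y - x, e⟫ < 0}, |f y - b| ∂volume)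
      (𝓝[>] 0) (𝓝 0)) {η : ℝ} (hη : 0 < η) :
    ∀ᶠ r in 𝓝[>] 0, ∫ y in ball x r, |f y - stepFun x a b e y| ≤ η * r ^ n := by
  set η' := η / (2 * 2 ^ n) with hη'
  have hη'0 : 0 < η' := by positivity
  have hsub : ∀ᶠ r in 𝓝[>] (0 : ℝ), closedBall x r ⊆ Ω := by
    obtain ⟨ρ, hρ, hρΩ⟩ := Metric.isOpen_iff.1 hΩ x hx
    filter_upwards [Ioo_mem_nhdsGT hρ] with r hr
    exact (closedBall_subset_ball hr.2).trans hρΩ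
  filter_upwards [ha.eventually_lt_const hη'0, hb.eventually_lt_const hη'0, hsub,
    self_mem_nhdsWithin] with r h1 h2 hrΩ hr
  have hr : 0 < r := hr
  set P := {y ∈ ball x r | 0 < ⟪y - x, e⟫} with hP
  set N := {y ∈ ball x r | ⟪y - x, e⟫ < 0} with hN
  have hPb : P ⊆ ball x r := fun y hy => hy.1
  have hNb : N ⊆ ball x r := fun y hy => hy.1
  have hin : Measurable fun y : 𝔼 => ⟪y - x, e⟫ := by fun_prop
  have hPm : MeasurableSet P :=
    measurableSet_ball.inter (measurableSet_lt measurable_const hin)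
  have hNm : MeasurableSet N :=
    measurableSet_ball.inter (measurableSet_lt hin measurable_const)
  have hd : Disjoint P N := by
    rw [Set.disjoint_left]
    intro y hy hy'
    exact lt_asymm hy.2 hy'.2
  have hae : ball x r =ᵐ[volume] (P ∪ N : Set 𝔼) := by
    have hnull := volume_hyperplane he ⟨0, hn⟩ x
    have : ∀ᵐ y : 𝔼, ¬ ⟪y - x, e⟫ = 0 := by rwa [ae_iff, show {y : 𝔼 | ¬¬⟪y - x, e⟫ = 0} =
      {y : 𝔼 | ⟪y - x, e⟫ = 0} by simp]
    filter_upwards [this] with y hy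
    refine propext ⟨fun h => ?_, fun h => h.elim (fun h => h.1) fun h => h.1⟩
    rcases lt_or_gt_of_ne hy with h' | h'
    · exact Or.inr ⟨h, h'⟩
    · exact Or.inl ⟨h, h'⟩
  have hfB : IntegrableOn f (ball x r) volume :=
    (hf.integrableOn_compact_subset hrΩ (isCompact_closedBall x _)).mono_set ball_subset_closedBall
  have hI : IntegrableOn (fun y => |f y - stepFun x a b e y|) (ball x r) volume :=
    (hfB.sub (integrableOn_stepFun x a b e measure_ball_lt_top.ne)).abs
  have key : ∀ {S : Set 𝔼} {c : ℝ}, S ⊆ ball x r → ⨍ y in S, |f y - c| < η' →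
      ∫ y in S, |f y - c| ≤ (2 * r) ^ n * η' := by
    intro S c hS hlt
    have hSfin : volume S ≠ ⊤ := ((measure_mono hS).trans_lt measure_ball_lt_top).ne
    rw [← measure_smul_setAverage _ hSfin, smul_eq_mul]
    have h0 : 0 ≤ ⨍ y in S, |f y - c| := integral_nonneg fun y => abs_nonneg _
    have h3 : volume.real S ≤ (2 * r) ^ n :=
      (measureReal_mono hS measure_ball_lt_top.ne).trans (measureReal_ball_le x hr.le)
    exact mul_le_mul h3 hlt.le h0 (by positivity)
  calc ∫ y in ball x r, |f y - stepFun x a b e y|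
      = ∫ y in P ∪ N, |f y - stepFun x a b e y| := setIntegral_congr_set hae
    _ = (∫ y in P, |f y - stepFun x a b e y|) + ∫ y in N, |f y - stepFun x a b e y| :=
        setIntegral_union hd hNm (hI.mono_set hPb) (hI.mono_set hNb)
    _ = (∫ y in P, |f y - a|) + ∫ y in N, |f y - b| := by
        congr 1
        · refine setIntegral_congr_fun hPm fun y hy => ?_
          simp only [stepFun, if_pos hy.2]
        · refine setIntegral_congr_fun hNm fun y hy => ?_
          simp only [stepFun, if_neg (not_lt.2 hy.2.le)]
    _ ≤ (2 * r) ^ n * η' + (2 * r) ^ n * η' := add_le_add (key hPb h1) (key hNb h2)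
    _ = η * r ^ n := by
        rw [hη', mul_pow]
        field_simp
        ring

/-- Near a jump point, the function is flat for all jump data close to the exact data. -/
lemma eventually_eventually_isFlatAt (hn : 1 ≤ n) {f : 𝔼 → ℝ} {Ω : Set 𝔼}
    (hΩ : IsOpen Ω) (hf : LocallyIntegrableOn f Ω volume) {x : 𝔼} (hx : x ∈ Ω) {e₀ : 𝔼}
    (he : ‖e₀‖ = 1) {a₀ b₀ : ℝ} (hab : a₀ ≠ b₀)
    (ha : Tendsto (fun r : ℝ => ⨍ y in {y ∈ ball x r | 0 < ⟪y - x, e₀⟫}, |f y - a₀| ∂volume)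
      (𝓝[>] 0) (𝓝 0))
    (hb : Tendsto (fun r : ℝ => ⨍ y in {y ∈ ball x r | ⟪y - x, e₀⟫ < 0}, |f y - b₀| ∂volume)
      (𝓝[>] 0) (𝓝 0)) {θ : ℝ} (hθ : 0 < θ) :
    ∀ᶠ p : ℝ × ℝ × 𝔼 in 𝓝 (a₀, b₀, e₀), ∀ᶠ r in 𝓝[>] 0, IsFlatAt f Ω θ x p.1 p.2.1 p.2.2 r := by
  have hab0 : 0 < |a₀ - b₀| := abs_pos.2 (sub_ne_zero.2 hab)
  have hsub : ∀ᶠ r in 𝓝[>] (0 : ℝ), closedBall x r ⊆ Ω := by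
    obtain ⟨ρ, hρ, hρΩ⟩ := Metric.isOpen_iff.1 hΩ x hx
    filter_upwards [Ioo_mem_nhdsGT hρ] with r hr
    exact (closedBall_subset_ball hr.2).trans hρΩ
  have hc : Continuous fun p : ℝ × ℝ × 𝔼 => θ * |p.1 - p.2.1| -
      (|p.1 - a₀| + |p.2.1 - b₀| + |a₀ - b₀| * ‖p.2.2 - e₀‖) * 2 ^ n := by fun_prop
  have h0 := hc.tendsto (a₀, b₀, e₀)
  have h1 := h0.eventually_const_lt (u := θ * |a₀ - b₀| / 2) (by simp; positivity)
  filter_upwards [h1] with p hp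
  filter_upwards [eventually_setIntegral_ball_abs_sub_stepFun_le hn hΩ hf hx he ha hb
    (η := θ * |a₀ - b₀| / 2) (by positivity), hsub, self_mem_nhdsWithin] with r h2 hrΩ hr
  have hr : 0 < r := hr
  refine ⟨hrΩ, ?_⟩
  have hbt : volume (ball x r) ≠ ⊤ := measure_ball_lt_top.ne
  have hfB : IntegrableOn f (ball x r) volume :=
    (hf.integrableOn_compact_subset hrΩ (isCompact_closedBall x _)).mono_set ball_subset_closedBall
  have hI1 : IntegrableOn (fun y => |f y - stepFun x a₀ b₀ e₀ y|) (ball x r) volume :=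
    (hfB.sub (integrableOn_stepFun x a₀ b₀ e₀ hbt)).abs
  have hI2 : IntegrableOn (fun y => |stepFun x a₀ b₀ e₀ y - stepFun x p.1 p.2.1 p.2.2 y|)
    (ball x r) volume := ((integrableOn_stepFun _ _ _ _ hbt).sub
      (integrableOn_stepFun _ _ _ _ hbt)).abs
  calc ∫ y in ball x r, |f y - stepFun x p.1 p.2.1 p.2.2 y|
      ≤ ∫ y in ball x r, (|f y - stepFun x a₀ b₀ e₀ y|
          + |stepFun x a₀ b₀ e₀ y - stepFun x p.1 p.2.1 p.2.2 y|) :=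
        integral_mono (hfB.sub (integrableOn_stepFun _ _ _ _ hbt)).abs (hI1.add hI2)
          fun y => abs_sub_le _ _ _
    _ ≤ θ * |a₀ - b₀| / 2 * r ^ n
        + (|p.1 - a₀| + |p.2.1 - b₀| + |a₀ - b₀| * ‖p.2.2 - e₀‖) * (2 * r) ^ n := by
        rw [integral_add hI1 hI2]
        exact add_le_add h2 (setIntegral_ball_abs_stepFun_sub_stepFun_le hn x a₀ b₀ _ _ he _ hr)
    _ = (θ * |a₀ - b₀| / 2
        + (|p.1 - a₀| + |p.2.1 - b₀| + |a₀ - b₀| * ‖p.2.2 - e₀‖) * 2 ^ n) * r ^ n := by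
        rw [mul_pow]
        ring
    _ ≤ θ * |p.1 - p.2.1| * r ^ n := by
        gcongr
        linarith

/-- Points of flatness with the same jump data lie close to a common hyperplane. -/
lemma inner_sub_le_of_isFlatAt (hn : 1 ≤ n) {f : 𝔼 → ℝ} {Ω : Set 𝔼}
    (hf : LocallyIntegrableOn f Ω volume) {θ l : ℝ} (hl : 0 < l) (hl1 : l ≤ 1)
    (hθ : 2 * θ < (l / (4 * n)) ^ n) {a b : ℝ} (hab : a ≠ b) {e : 𝔼} (he : ‖e‖ = 1) {x y : 𝔼}
    {ρ : ℝ} (hρ : 0 < ρ) (hxy : ‖x - y‖ ≤ ρ) (hx : IsFlatAt f Ω θ x a b e (2 * ρ))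
    (hy : IsFlatAt f Ω θ y a b e (2 * ρ)) :
    ⟪y - x, e⟫ ≤ l * ρ := by
  by_contra! hcon
  have hn0 : (0 : ℝ) < n := by exact_mod_cast hn
  have hab0 : 0 < |a - b| := abs_pos.2 (sub_ne_zero.2 hab)
  set m : 𝔼 := (1 / 2 : ℝ) • (x + y) with hm
  have hmx : m - x = (1 / 2 : ℝ) • (y - x) := by
    rw [hm]
    module
  have hmy : m - y = -((1 / 2 : ℝ) • (y - x)) := by
    rw [hm]
    module
  have hyx : ‖y - x‖ ≤ ρ := by rwa [norm_sub_rev]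
  set B := ball m (l * ρ / 2) with hB
  have hlρ : l * ρ ≤ ρ := by nlinarith
  have hBx : B ⊆ ball x (2 * ρ) := by
    refine ball_subset_ball' ?_
    rw [dist_eq_norm, hmx, norm_smul, Real.norm_of_nonneg (by norm_num)]
    linarith
  have hBy : B ⊆ ball y (2 * ρ) := by
    refine ball_subset_ball' ?_
    rw [dist_eq_norm, hmy, norm_neg, norm_smul, Real.norm_of_nonneg (by norm_num)]
    linarith
  have hin : ∀ z ∈ B, |⟪z - m, e⟫| ≤ l * ρ / 2 := by
    intro z hz
    refine (abs_real_inner_le_norm _ _).trans ?_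
    rw [he, mul_one]
    exact (mem_ball_iff_norm.1 hz).le
  have hsx : ∀ z ∈ B, stepFun x a b e z = a := by
    intro z hz
    have : ⟪z - x, e⟫ = ⟪z - m, e⟫ + 1 / 2 * ⟪y - x, e⟫ := by
      rw [← real_inner_smul_left, ← hmx, ← inner_add_left]
      congr 1
      abel
    have h2 := abs_le.1 (hin z hz)
    rw [stepFun, if_pos]
    linarith
  have hsy : ∀ z ∈ B, stepFun y a b e z = b := by
    intro z hz
    have : ⟪z - y, e⟫ = ⟪z - m, e⟫ - 1 / 2 * ⟪y - x, e⟫ := by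
      rw [← real_inner_smul_left, ← neg_neg ((1 / 2 : ℝ) • (y - x)), ← hmy, inner_neg_left,
        sub_neg_eq_add, ← inner_add_left]
      congr 1
      abel
    have h2 := abs_le.1 (hin z hz)
    rw [stepFun, if_neg]
    linarith
  have hI : ∀ {w : 𝔼}, closedBall w (2 * ρ) ⊆ Ω →
      IntegrableOn (fun z => |f z - stepFun w a b e z|) (ball w (2 * ρ)) volume := fun hw =>
    (((hf.integrableOn_compact_subset hw (isCompact_closedBall _ _)).mono_set
      ball_subset_closedBall).sub (integrableOn_stepFun _ a b e measure_ball_lt_top.ne)).abs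
  have hmono : ∀ {w : 𝔼}, closedBall w (2 * ρ) ⊆ Ω → B ⊆ ball w (2 * ρ) →
      ∫ z in B, |f z - stepFun w a b e z| ≤ ∫ z in ball w (2 * ρ), |f z - stepFun w a b e z| :=
    fun hw hBw => setIntegral_mono_set (hI hw) (Eventually.of_forall fun _ => abs_nonneg _)
      hBw.eventuallyLE
  have hlow := pow_le_measureReal_ball hn m (r := l * ρ / 2) (by positivity)
  have hup : volume.real B * |a - b| ≤
      θ * |a - b| * (2 * ρ) ^ n + θ * |a - b| * (2 * ρ) ^ n := by
    calc volume.real B * |a - b| = ∫ z in B, |a - b| := by rw [setIntegral_const, smul_eq_mul]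
      _ ≤ ∫ z in B, (|f z - stepFun x a b e z| + |f z - stepFun y a b e z|) := by
          refine setIntegral_mono_on (integrableOn_const measure_ball_lt_top.ne)
            (((hI hx.1).mono_set hBx).add ((hI hy.1).mono_set hBy)) measurableSet_ball
            fun z hz => ?_
          simp only [hsx z hz, hsy z hz]
          rw [abs_sub_comm (f z) a]
          exact abs_sub_le _ _ _
      _ = (∫ z in B, |f z - stepFun x a b e z|) + ∫ z in B, |f z - stepFun y a b e z| :=
          integral_add ((hI hx.1).mono_set hBx) ((hI hy.1).mono_set hBy)
      _ ≤ _ := add_le_add ((hmono hx.1 hBx).trans hx.2) ((hmono hy.1 hBy).trans hy.2)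
  have h3 : (l * ρ / 2 / n) ^ n = (l / (4 * n)) ^ n * (2 * ρ) ^ n := by
    rw [← mul_pow]
    congr 1
    field_simp
    ring
  rw [h3] at hlow
  have h4 : 0 < (2 * ρ) ^ n := by positivity
  have h5 : volume.real B * |a - b| ≤ (2 * θ * (2 * ρ) ^ n) * |a - b| := by linarith
  have h6 := le_of_mul_le_mul_right h5 hab0
  have h7 := mul_lt_mul_of_pos_right hθ h4
  linarith

lemma half_mul_le_setIntegral_abs_stepFun_sub {T : 𝔼 ≃ₗᵢ[ℝ] 𝔼} (i₀ : Fin n) {e : 𝔼}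
    (he : ‖e‖ = 1) {x c : 𝔼} (hc : ⟪c - x, e⟫ = 0) (a b m : ℝ) {r : ℝ} (hr : 0 ≤ r) :
    |a - b| / 2 * r ^ n ≤ ∫ y in openCube T c r, |stepFun x a b e y - m| := by
  set Q := openCube T c r with hQ
  have hvol : volume.real Q = r ^ n := by
    rw [Measure.real, volume_openCube T c hr, ENNReal.toReal_ofReal (by positivity)]
  have hQfin : volume Q ≠ ⊤ := by
    rw [volume_openCube T c hr]
    exact ENNReal.ofReal_ne_top
  have : Fact (volume Q < ⊤) := ⟨hQfin.lt_top⟩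
  set g : 𝔼 → 𝔼 := fun z => (c + c) - z with hg
  have hgm : MeasurePreserving g volume volume := Measure.measurePreserving_sub_left volume (c + c)
  have hge : MeasurableEmbedding g := (Homeomorph.subLeft (c + c)).measurableEmbedding
  have hgQ : g ⁻¹' Q = Q := by
    ext z
    have : ∀ i, |frameCoord T c (g z) i| = |frameCoord T c z i| := by
      intro i
      have : c + c - z - c = -(z - c) := by abel
      simp only [frameCoord, hg, this, map_neg, PiLp.neg_apply, abs_neg]
    simp only [hQ, openCube, Set.mem_preimage, Set.mem_ofPred_eq, this]
  have hrefl : ∫ y in Q, |stepFun x a b e (g y) - m| = ∫ y in Q, |stepFun x a b e y - m| := by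
    have := hgm.setIntegral_preimage_emb hge (fun y => |stepFun x a b e y - m|) Q
    rwa [hgQ] at this
  have hI : IntegrableOn (fun y => |stepFun x a b e y - m|) Q volume :=
    ((integrableOn_stepFun x a b e hQfin).sub (integrable_const _)).abs
  have hI' : IntegrableOn (fun y => |stepFun x a b e (g y) - m|) Q volume := by
    have := (hgm.integrableOn_comp_preimage hge).2 hI
    rwa [hgQ] at this
  have hae : ∀ᵐ y ∂(volume.restrict Q),
      |a - b| ≤ |stepFun x a b e y - m| + |stepFun x a b e (g y) - m| := by
    have hnull := volume_hyperplane he i₀ x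
    have : ∀ᵐ y : 𝔼, ¬ ⟪y - x, e⟫ = 0 := by rwa [ae_iff, show {y : 𝔼 | ¬¬⟪y - x, e⟫ = 0} =
      {y : 𝔼 | ⟪y - x, e⟫ = 0} by simp]
    filter_upwards [ae_restrict_of_ae this] with y hy
    have hgy : ⟪g y - x, e⟫ = -⟪y - x, e⟫ := by
      have : g y - x = (c - x) + (c - x) - (y - x) := by
        simp only [hg]
        abel
      rw [this, inner_sub_left, inner_add_left, hc]
      ring
    unfold stepFun
    rw [hgy]
    rcases lt_or_gt_of_ne hy with h' | h'
    · rw [if_neg (by linarith), if_pos (by linarith), abs_sub_comm b m, add_comm]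
      exact abs_sub_le _ _ _
    · rw [if_pos (by linarith), if_neg (by linarith), abs_sub_comm b m]
      exact abs_sub_le _ _ _
  have h1 : ∫ y in Q, |a - b| ≤
      ∫ y in Q, (|stepFun x a b e y - m| + |stepFun x a b e (g y) - m|) :=
    integral_mono_ae (integrable_const _) (hI.add hI') hae
  rw [integral_add hI hI', hrefl, setIntegral_const, smul_eq_mul, hvol] at h1
  linarith

/-- Lower bound for the mean oscillation on a cube bisected by the jump hyperplane. -/
lemma le_meanOsc_of_isFlatAt (hn : 1 ≤ n) {f u : 𝔼 → ℝ} {Ω : Set 𝔼}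
    (hf : LocallyIntegrableOn f Ω volume) {θ a b : ℝ} {e : 𝔼} (he : ‖e‖ = 1) {x c : 𝔼}
    (hc : ⟪c - x, e⟫ = 0) {T : 𝔼 ≃ₗᵢ[ℝ] 𝔼} {r R η : ℝ} (hr : 0 < r)
    (hfl : IsFlatAt f Ω θ x a b e R) (hQ : openCube T c r ⊆ ball x R)
    (hu : IntegrableOn u (openCube T c r) volume)
    (hη : ∀ᵐ y ∂(volume.restrict (openCube T c r)), |u y - f y| ≤ η) :
    |a - b| / 2 - θ * |a - b| * (R / r) ^ n - η ≤ meanOsc u (openCube T c r) := by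
  set Q := openCube T c r with hQd
  have hvol : volume.real Q = r ^ n := by
    rw [Measure.real, volume_openCube T c hr.le, ENNReal.toReal_ofReal (by positivity)]
  have hQfin : volume Q ≠ ⊤ := by
    rw [volume_openCube T c hr.le]
    exact ENNReal.ofReal_ne_top
  have : Fact (volume Q < ⊤) := ⟨hQfin.lt_top⟩
  set m := ⨍ y in Q, u y with hm
  have h1 := half_mul_le_setIntegral_abs_stepFun_sub (T := T) ⟨0, hn⟩ he hc a b m hr.le
  have hIB : IntegrableOn (fun z => |f z - stepFun x a b e z|) (ball x R) volume :=
    (((hf.integrableOn_compact_subset hfl.1 (isCompact_closedBall _ _)).mono_set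
      ball_subset_closedBall).sub (integrableOn_stepFun _ a b e measure_ball_lt_top.ne)).abs
  have hI1 : IntegrableOn (fun z => |f z - stepFun x a b e z|) Q volume := hIB.mono_set hQ
  have hI3 : IntegrableOn (fun z => |u z - m|) Q volume := (hu.sub (integrable_const _)).abs
  have hI0 : IntegrableOn (fun y => |stepFun x a b e y - m|) Q volume :=
    ((integrableOn_stepFun x a b e hQfin).sub (integrable_const _)).abs
  have h2 : ∫ y in Q, |stepFun x a b e y - m| ≤
      ∫ y in Q, (|f y - stepFun x a b e y| + η + |u y - m|) := by
    refine integral_mono_ae hI0 ((hI1.add (integrable_const _)).add hI3) ?_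
    filter_upwards [hη] with y hy
    have e1 := abs_sub_le (stepFun x a b e y) (f y) m
    have e2 := abs_sub_le (f y) (u y) m
    have e3 := abs_sub_comm (f y) (u y)
    have e4 := abs_sub_comm (f y) (stepFun x a b e y)
    linarith
  have hI12 : IntegrableOn (fun y => |f y - stepFun x a b e y| + η) Q volume :=
    hI1.add (integrable_const _)
  rw [integral_add hI12 hI3, integral_add hI1 (integrable_const _), setIntegral_const,
    smul_eq_mul, hvol] at h2
  have h3 : ∫ y in Q, |f y - stepFun x a b e y| ≤ θ * |a - b| * R ^ n :=
    (setIntegral_mono_set hIB (Eventually.of_forall fun _ => abs_nonneg _)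
      hQ.eventuallyLE).trans hfl.2
  have h4 : r ^ n * meanOsc u Q = ∫ y in Q, |u y - m| := by
    rw [← hvol, meanOsc, ← smul_eq_mul, measure_smul_setAverage _ hQfin]
  have hrn : 0 < r ^ n := by positivity
  have h5 : r ^ n * (|a - b| / 2 - θ * |a - b| * (R / r) ^ n - η) ≤ r ^ n * meanOsc u Q := by
    have : r ^ n * (|a - b| / 2 - θ * |a - b| * (R / r) ^ n - η) =
        |a - b| / 2 * r ^ n - θ * |a - b| * R ^ n - r ^ n * η := by
      rw [div_pow]
      field_simp
    rw [h4, this]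
    linarith
  exact le_of_mul_le_mul_left h5 hrn

end Flatness

section Covering

variable {n : ℕ}

local notation "𝔼" => EuclideanSpace ℝ (Fin n)

lemma frameCoord_eq_sub (T : 𝔼 ≃ₗᵢ[ℝ] 𝔼) (c z : 𝔼) (i : Fin n) :
    frameCoord T c z i = T.symm z i - T.symm c i := by
  simp [frameCoord]

/-- A compact piece of an almost flat Lipschitz graph over the hyperplane orthogonal to `e` is
covered by a family of cubes with disjoint interiors centered near the graph. -/
lemma exists_cube_cover (hn : 1 ≤ n) {i₀ : Fin n} {e : 𝔼} {T : 𝔼 ≃ₗᵢ[ℝ] 𝔼}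
    (hT : T (EuclideanSpace.single i₀ 1) = e) (he : ‖e‖ = 1) {G K : Set 𝔼} (hKG : K ⊆ closure G)
    (hK : ∀ y ∈ K, ∀ z ∈ K, |⟪z - y, e⟫| ≤ 1 / (8 * n) * ‖z - y‖) {ε : ℝ} (hε : 0 < ε) :
    ∃ (ι : Set (Fin n → ℤ)) (c : ι → 𝔼),
      K ⊆ ⋃ j, closedCube T (c j) ε ∧
      Pairwise (Function.onFun Disjoint fun j => openCube T (c j) ε) ∧
      ∀ j, ∃ x ∈ G, ∃ y ∈ K, ⟪c j - x, e⟫ = 0 ∧ ‖c j - x‖ ≤ n * ε ∧ ‖c j - y‖ ≤ n * ε := by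
  have hn1 : (1 : ℝ) ≤ n := by exact_mod_cast hn
  set k : 𝔼 → Fin n → ℤ := fun z i => if i = i₀ then 0 else ⌊T.symm z i / ε⌋ with hk
  have hy : ∀ j : k '' K, ∃ y ∈ K, k y = j := fun j => j.2
  choose y hyK hyk using hy
  have hx : ∀ j : k '' K, ∃ x ∈ G, dist (y j) x < ε / 16 := fun j =>
    Metric.mem_closure_iff.1 (hKG (hyK j)) _ (by positivity)
  choose x hxG hxy using hx
  set v : k '' K → 𝔼 := fun j => WithLp.toLp 2
    (fun i => if i = i₀ then T.symm (x j) i₀ else ((j.1 i : ℝ) + 1 / 2) * ε) with hv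
  have hcoord : ∀ j z i, frameCoord T (T (v j)) z i = T.symm z i -
      (if i = i₀ then T.symm (x j) i₀ else ((j.1 i : ℝ) + 1 / 2) * ε) := by
    intro j z i
    rw [frameCoord_eq_sub, LinearIsometryEquiv.symm_apply_apply]
  have hmem : ∀ (j : k '' K) (z : 𝔼), z ∈ K → k z = j → z ∈ closedCube T (T (v j)) ε := by
    intro j z hz hzj
    have hfl : ∀ (w : 𝔼), k w = j → ∀ i, i ≠ i₀ →
        (j.1 i : ℝ) * ε ≤ T.symm w i ∧ T.symm w i ≤ ((j.1 i : ℝ) + 1) * ε := by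
      intro w hw i hi
      have h1 : ⌊T.symm w i / ε⌋ = j.1 i := by
        rw [← hw]
        simp only [hk, if_neg hi]
      have h2 := Int.floor_le (T.symm w i / ε)
      have h3 := Int.lt_floor_add_one (T.symm w i / ε)
      rw [h1] at h2 h3
      rw [le_div_iff₀ hε] at h2
      rw [div_lt_iff₀ hε] at h3
      exact ⟨h2, h3.le⟩
    have hyz := hfl (y j) (hyk j)
    have hzz := hfl z hzj
    have hin : frameCoord T (y j) z i₀ = ⟪z - y j, e⟫ := frameCoord_eq_inner hT _ _
    set t := |⟪z - y j, e⟫| with ht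
    have htb : t ≤ 1 / (8 * n) * ‖z - y j‖ := hK _ (hyK j) _ hz
    have hnorm : ‖z - y j‖ ≤ n * max ε t := by
      refine norm_sub_le_of_frameCoord (T := T) fun i => ?_
      by_cases hi : i = i₀
      · rw [hi, hin]
        exact le_max_right _ _
      · refine le_trans ?_ (le_max_left _ _)
        rw [frameCoord_eq_sub, abs_le]
        have h1 := hyz i hi
        have h2 := hzz i hi
        constructor <;> linarith
    have ht8 : t ≤ 1 / 8 * max ε t := by
      calc t ≤ 1 / (8 * n) * (n * max ε t) := htb.trans (by gcongr)
        _ = _ := by field_simp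
    have htε : t ≤ ε / 8 := by
      rcases le_total t ε with h | h
      · rw [max_eq_left h] at ht8
        linarith
      · rw [max_eq_right h] at ht8
        linarith
    intro i
    rw [hcoord]
    split_ifs with hi
    · rw [hi, ← frameCoord_eq_sub, frameCoord_eq_inner hT]
      have h1 : ⟪z - x j, e⟫ = ⟪z - y j, e⟫ + ⟪y j - x j, e⟫ := by
        rw [← inner_add_left]
        congr 1
        abel
      have h2 : |⟪y j - x j, e⟫| ≤ ε / 16 := by
        refine (abs_real_inner_le_norm _ _).trans ?_
        rw [he, mul_one, ← dist_eq_norm]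
        exact (hxy j).le
      rw [h1]
      refine (abs_add_le _ _).trans ?_
      linarith
    · have h2 := hzz i hi
      rw [abs_le]
      constructor <;> linarith
  refine ⟨k '' K, fun j => T (v j), ?_, ?_, ?_⟩
  · intro z hz
    exact Set.mem_iUnion.2 ⟨⟨k z, z, hz, rfl⟩, hmem _ z hz rfl⟩
  · intro j j' hjj'
    rw [Function.onFun, Set.disjoint_left]
    intro z hz hz'
    obtain ⟨i, hi⟩ : ∃ i, j.1 i ≠ j'.1 i := by
      by_contra! hcon
      exact hjj' (Subtype.ext (funext hcon))
    have hi0 : i ≠ i₀ := by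
      rintro rfl
      rw [← hyk j, ← hyk j'] at hi
      simp [hk] at hi
    have h1 := abs_lt.1 (hz i)
    have h2 := abs_lt.1 (hz' i)
    rw [hcoord, if_neg hi0] at h1 h2
    rcases lt_or_gt_of_ne hi with h | h
    · have h3 : (j.1 i : ℝ) + 1 ≤ j'.1 i := by exact_mod_cast h
      nlinarith
    · have h3 : (j'.1 i : ℝ) + 1 ≤ j.1 i := by exact_mod_cast h
      nlinarith
  · intro j
    have h1 := closedCube_subset_closedBall T _ _ (hmem j (y j) (hyK j) (hyk j))
    rw [mem_closedBall, dist_eq_norm, norm_sub_rev] at h1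
    have h2 := (hxy j).le
    rw [dist_eq_norm] at h2
    refine ⟨x j, hxG j, y j, hyK j, ?_, ?_, ?_⟩
    · rw [← frameCoord_eq_inner hT, frameCoord_eq_sub]
      simp [hv]
    · have h3 := norm_sub_le_norm_sub_add_norm_sub (T (v j)) (y j) (x j)
      nlinarith
    · nlinarith

/-- A set of points near which `f` uniformly looks like a fixed jump and on which the gradient
measure has almost the expected density. -/
structure IsJumpPiece (f : 𝔼 → ℝ) (Ω : Set 𝔼) (μ : Measure 𝔼) (δ θ : ℝ) (T : 𝔼 ≃ₗᵢ[ℝ] 𝔼)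
    (a b : ℝ) (e : 𝔼) (s : ℝ) (G : Set 𝔼) : Prop where
  pos : 0 < s
  dist_lt : ∀ x ∈ G, ∀ y ∈ G, ‖x - y‖ < s / 2
  isFlatAt : ∀ x ∈ G, ∀ r, 0 < r → r < s → IsFlatAt f Ω θ x a b e r
  measure_le : ∀ x ∈ G, ∀ r, 0 < r → r < s → ∀ c, ‖c - x‖ ≤ n * r →
    μ.real (closedCube T c r) ≤ (1 + δ) * |a - b| * r ^ (n - 1)

lemma IsJumpPiece.abs_inner_sub_le (hn : 1 ≤ n) {f : 𝔼 → ℝ} {Ω : Set 𝔼}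
    (hf : LocallyIntegrableOn f Ω volume) {μ : Measure 𝔼} {δ θ : ℝ} {T : 𝔼 ≃ₗᵢ[ℝ] 𝔼}
    {a b : ℝ} {e : 𝔼} {s : ℝ} {G : Set 𝔼} (hG : IsJumpPiece f Ω μ δ θ T a b e s G)
    (hab : a ≠ b) (he : ‖e‖ = 1) (hθ : 2 * θ < (1 / (8 * n) / (4 * n)) ^ n) {y z : 𝔼}
    (hy : y ∈ closure G) (hz : z ∈ closure G) : |⟪z - y, e⟫| ≤ 1 / (8 * n) * ‖z - y‖ := by
  have hn1 : (1 : ℝ) ≤ n := by exact_mod_cast hn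
  have h1 : ∀ x ∈ G, ∀ y ∈ G, ⟪y - x, e⟫ ≤ 1 / (8 * n) * ‖y - x‖ := by
    intro x hx y hy
    rcases eq_or_ne x y with rfl | hxy
    · simp
    have hρ : 0 < ‖y - x‖ := norm_pos_iff.2 (sub_ne_zero.2 hxy.symm)
    have hd := hG.dist_lt y hy x hx
    refine inner_sub_le_of_isFlatAt hn hf (by positivity) ?_ hθ hab he hρ (norm_sub_rev _ _).le
      (hG.isFlatAt x hx _ (by positivity) (by linarith))
      (hG.isFlatAt y hy _ (by positivity) (by linarith))
    rw [div_le_one (by positivity)]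
    linarith
  have h2 : closure (G ×ˢ G) ⊆ {p : 𝔼 × 𝔼 | |⟪p.1 - p.2, e⟫| ≤ 1 / (8 * n) * ‖p.1 - p.2‖} := by
    refine closure_minimal ?_ (isClosed_le (by fun_prop) (by fun_prop))
    rintro ⟨u, w⟩ ⟨hu, hw⟩
    refine abs_le.2 ⟨?_, h1 w hw u hu⟩
    have h3 := h1 u hu w hw
    rw [← neg_sub, inner_neg_left, norm_neg] at h3
    change -_ ≤ ⟪u - w, e⟫
    linarith
  rw [closure_prod_eq] at h2
  exact h2 (Set.mk_mem_prod hz hy)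

/-- The local form of the main estimate: on a jump piece, there are disjoint cubes of side `ε` on
which the oscillation controls the mass of a given compact subset of the closure. -/
lemma IsJumpPiece.exists_cubes (hn : 1 ≤ n) {f u : 𝔼 → ℝ} {Ω : Set 𝔼}
    (hf : LocallyIntegrableOn f Ω volume) (hu : LocallyIntegrableOn u Ω volume)
    {μ : Measure 𝔼} [IsFiniteMeasure μ] {δ θ : ℝ} (hδ : 0 < δ) (hδ1 : δ < 1) {T : 𝔼 ≃ₗᵢ[ℝ] 𝔼}
    {a b : ℝ} {e : 𝔼} {s : ℝ} {G : Set 𝔼} (hG : IsJumpPiece f Ω μ δ θ T a b e s G)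
    {i₀ : Fin n} (hT : T (EuclideanSpace.single i₀ 1) = e)
    (hab : a ≠ b) (he : ‖e‖ = 1) (hθ : 2 * θ < (1 / (8 * n) / (4 * n)) ^ n)
    (hθδ : θ * (2 * n) ^ n ≤ δ / 4) {K : Set 𝔼} (hKG : K ⊆ closure G) {ε : ℝ} (hε : 0 < ε)
    (hεs : 2 * n * ε < s)
    (hη : ∀ᵐ y ∂(volume.restrict (cthickening (2 * n * ε) K)), |u y - f y| ≤ δ / 4 * |a - b|) :
    ∃ (ι : Set (Fin n → ℤ)) (c : ι → 𝔼),
      Pairwise (Function.onFun Disjoint fun j => openCube T (c j) ε) ∧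
      (∀ j, openCube T (c j) ε ⊆ cthickening (2 * n * ε) K ∩ Ω) ∧
      μ K ≤ ENNReal.ofReal (2 * (1 + δ) / (1 - δ)) * (ENNReal.ofReal (ε ^ (n - 1)) *
        ∑' j, ENNReal.ofReal (meanOsc u (openCube T (c j) ε))) := by
  have hn1 : (1 : ℝ) ≤ n := by exact_mod_cast hn
  have hab0 : 0 < |a - b| := abs_pos.2 (sub_ne_zero.2 hab)
  obtain ⟨ι, c, hcov, hdis, hc⟩ := exists_cube_cover hn hT he hKG
    (fun y hy z hz => hG.abs_inner_sub_le hn hf hab he hθ (hKG hy) (hKG hz)) hε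
  have hnε : 0 < n * ε := by positivity
  have hεs' : ε < s := by nlinarith
  have hball : ∀ j (w : 𝔼), ‖c j - w‖ ≤ n * ε → openCube T (c j) ε ⊆ ball w (2 * n * ε) := by
    intro j w hw
    refine (openCube_subset_closedCube _ _ _).trans ((closedCube_subset_closedBall _ _ _).trans
      (closedBall_subset_ball' ?_))
    rw [dist_eq_norm]
    linarith
  have hthick : ∀ j, openCube T (c j) ε ⊆ cthickening (2 * n * ε) K := by
    intro j
    obtain ⟨x, hx, y, hy, h1, h2, h3⟩ := hc j
    exact (hball j y h3).trans (ball_subset_closedBall.trans (closedBall_subset_cthickening hy _))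
  have hosc : ∀ j, |a - b| * (1 - δ) / 2 ≤ meanOsc u (openCube T (c j) ε) := by
    intro j
    obtain ⟨x, hx, y, hy, h1, h2, h3⟩ := hc j
    have hfl := hG.isFlatAt x hx (2 * n * ε) (by positivity) hεs
    have hb := hball j x h2
    have h4 := le_meanOsc_of_isFlatAt hn hf (u := u) he h1 (T := T) hε hfl hb
      ((hu.integrableOn_compact_subset hfl.1 (isCompact_closedBall _ _)).mono_set
        (hb.trans ball_subset_closedBall)) (ae_restrict_of_ae_restrict_of_subset (hthick j) hη)
    rw [mul_div_cancel_right₀ _ hε.ne'] at h4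
    have h5 : θ * |a - b| * (2 * n) ^ n ≤ δ / 4 * |a - b| := by
      calc θ * |a - b| * (2 * n) ^ n = θ * (2 * n) ^ n * |a - b| := by ring
        _ ≤ _ := by gcongr
    linarith
  refine ⟨ι, c, hdis, fun j => Set.subset_inter (hthick j) ?_, ?_⟩
  · obtain ⟨x, hx, y, hy, h1, h2, h3⟩ := hc j
    exact (hball j x h2).trans (ball_subset_closedBall.trans
      (hG.isFlatAt x hx (2 * n * ε) (by positivity) hεs).1)
  · calc μ K ≤ μ (⋃ j, closedCube T (c j) ε) := measure_mono hcov
      _ ≤ ∑' j, μ (closedCube T (c j) ε) := measure_iUnion_le _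
      _ ≤ ∑' j, ENNReal.ofReal (2 * (1 + δ) / (1 - δ)) * (ENNReal.ofReal (ε ^ (n - 1)) *
            ENNReal.ofReal (meanOsc u (openCube T (c j) ε))) := by
          refine ENNReal.tsum_le_tsum fun j => ?_
          obtain ⟨x, hx, y, hy, h1, h2, h3⟩ := hc j
          have h4 := hG.measure_le x hx ε hε hεs' (c j) h2
          have h1δ : 0 < 1 - δ := by linarith
          rw [← ENNReal.ofReal_mul (by positivity), ← ENNReal.ofReal_mul (by positivity)]
          rw [← ENNReal.ofReal_toReal (measure_ne_top μ (closedCube T (c j) ε))]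
          refine ENNReal.ofReal_le_ofReal (h4.trans ?_)
          calc (1 + δ) * |a - b| * ε ^ (n - 1)
              = 2 * (1 + δ) / (1 - δ) * (ε ^ (n - 1) * (|a - b| * (1 - δ) / 2)) := by
                field_simp
            _ ≤ _ := by
                have := hosc j
                gcongr
      _ = _ := by rw [ENNReal.tsum_mul_left, ENNReal.tsum_mul_left]

end Covering

section Assembly

variable {n : ℕ}

local notation "𝔼" => EuclideanSpace ℝ (Fin n)

lemma eventually_ae_abs_sub_le {Ω : Set 𝔼} {f : 𝔼 → ℝ} {F : ℝ → 𝔼 → ℝ}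
    (hconv : ∀ K, IsCompact K → K ⊆ Ω →
      Tendsto (fun ε => eLpNorm (fun x => F ε x - f x) ⊤ (volume.restrict K))
        (𝓝[>] (0:ℝ)) (𝓝 0)) {K : Set 𝔼} (hK : IsCompact K) (hKΩ : K ⊆ Ω) {η : ℝ} (hη : 0 < η) :
    ∀ᶠ ε in 𝓝[>] (0:ℝ), ∀ᵐ y ∂(volume.restrict K), |F ε y - f y| ≤ η := by
  filter_upwards [(hconv K hK hKΩ).eventually_le_const (ENNReal.ofReal_pos.2 hη)] with ε hε
  rw [eLpNorm_exponent_top] at hε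
  filter_upwards [enorm_ae_le_eLpNormEssSup (fun x => F ε x - f x) (volume.restrict K)] with y hy
  have := hy.trans hε
  rwa [Real.enorm_eq_ofReal_abs, ENNReal.ofReal_le_ofReal_iff hη.le] at this

lemma eventually_cthickening_of_le {P : Set 𝔼 → Prop} (hP : ∀ s t, s ⊆ t → P t → P s)
    {K : Set 𝔼} {R : ℝ} (hR : 0 < R) (hPR : P (cthickening R K)) {c : ℝ} :
    ∀ᶠ ε in 𝓝[>] (0:ℝ), P (cthickening (c * ε) K) := by
  have : Tendsto (fun ε : ℝ => c * ε) (𝓝[>] 0) (𝓝 0) := by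
    have h : Tendsto (fun ε : ℝ => c * ε) (𝓝 0) (𝓝 (c * 0)) := (continuous_const_mul c).tendsto 0
    rw [mul_zero] at h
    exact h.mono_left nhdsWithin_le_nhds
  filter_upwards [this.eventually_le_const hR] with ε hε
  exact hP _ _ (cthickening_mono hε K) hPR

lemma eventually_sum_measure_le_kappa (hn : 1 ≤ n) {Ω : Set 𝔼} (hΩ : IsOpen Ω) {f : 𝔼 → ℝ}
    (hf : LocallyIntegrableOn f Ω volume) {F : ℝ → 𝔼 → ℝ}
    (hF : ∀ ε, 0 < ε → LocallyIntegrableOn (F ε) Ω volume)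
    (hconv : ∀ K, IsCompact K → K ⊆ Ω →
      Tendsto (fun ε => eLpNorm (fun x => F ε x - f x) ⊤ (volume.restrict K))
        (𝓝[>] (0:ℝ)) (𝓝 0))
    {μ : Measure 𝔼} [IsFiniteMeasure μ] {δ θ : ℝ} (hδ : 0 < δ) (hδ1 : δ < 1)
    (hθ : 2 * θ < (1 / (8 * n) / (4 * n)) ^ n) (hθδ : θ * (2 * n) ^ n ≤ δ / 4)
    {i₀ : Fin n} {T : ℕ → 𝔼 ≃ₗᵢ[ℝ] 𝔼} {a b s : ℕ → ℝ} {e : ℕ → 𝔼} {G K : ℕ → Set 𝔼}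
    (hG : ∀ q, IsJumpPiece f Ω μ δ θ (T q) (a q) (b q) (e q) (s q) (G q))
    (hT : ∀ q, T q (EuclideanSpace.single i₀ 1) = e q) (hab : ∀ q, a q ≠ b q)
    (he : ∀ q, ‖e q‖ = 1) (hK : ∀ q, IsCompact (K q)) (hKG : ∀ q, K q ⊆ closure (G q))
    (hKΩ : ∀ q, K q ⊆ Ω) (hd : Pairwise (Function.onFun Disjoint K)) (S : Finset ℕ) :
    ∀ᶠ ε in 𝓝[>] (0:ℝ), ∑ q ∈ S, μ (K q) ≤
      ENNReal.ofReal (2 * (1 + δ) / (1 - δ)) * kappa n ε (F ε) Ω := by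
  have hn0 : (0 : ℝ) < n := by exact_mod_cast hn
  have e1 : ∀ q ∈ S, ∀ᶠ ε in 𝓝[>] (0:ℝ), 2 * n * ε < s q := by
    intro q _
    have h : Tendsto (fun ε : ℝ => 2 * n * ε) (𝓝 0) (𝓝 (2 * n * 0)) :=
      (continuous_const_mul (2 * (n : ℝ))).tendsto 0
    rw [mul_zero] at h
    exact (h.mono_left nhdsWithin_le_nhds).eventually_lt_const (hG q).pos
  have e2 : ∀ q ∈ S, ∀ q' ∈ S, ∀ᶠ ε in 𝓝[>] (0:ℝ), q ≠ q' →
      Disjoint (cthickening (2 * n * ε) (K q)) (cthickening (2 * n * ε) (K q')) := by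
    intro q _ q' _
    rcases eq_or_ne q q' with rfl | hqq
    · simp
    obtain ⟨R, hR, hRd⟩ := (hd hqq).exists_cthickenings (hK q) (hK q').isClosed
    have h1 := eventually_cthickening_of_le (P := fun A => Disjoint A (cthickening R (K q')))
      (fun _ _ h hd => hd.mono_left h) hR hRd (c := 2 * n)
    have h2 : ∀ᶠ ε in 𝓝[>] (0:ℝ), 2 * n * ε ≤ R := by
      filter_upwards [Ioc_mem_nhdsGT (show (0:ℝ) < R / (2 * n) by positivity)] with ε hε
      rw [mul_comm]
      exact (le_div_iff₀ (by positivity)).1 hε.2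
    filter_upwards [h1, h2] with ε h1 h2 _
    exact h1.mono_right (cthickening_mono h2 _)
  have e3 : ∀ q ∈ S, ∀ᶠ ε in 𝓝[>] (0:ℝ), ∀ᵐ y ∂(volume.restrict (cthickening (2 * n * ε) (K q))),
      |F ε y - f y| ≤ δ / 4 * |a q - b q| := by
    intro q _
    have hab0 : 0 < |a q - b q| := abs_pos.2 (sub_ne_zero.2 (hab q))
    obtain ⟨R, hR, hRΩ⟩ := (hK q).exists_cthickening_subset_open hΩ (hKΩ q)
    filter_upwards [eventually_ae_abs_sub_le hconv (hK q).cthickening hRΩ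
        (show 0 < δ / 4 * |a q - b q| by positivity),
      eventually_cthickening_of_le (P := fun A => A ⊆ cthickening R (K q))
        (fun _ _ h h' => h.trans h') hR subset_rfl (c := 2 * n)] with ε h1 h2
    exact ae_restrict_of_ae_restrict_of_subset h2 h1
  filter_upwards [(S.eventually_all).2 e1, (S.eventually_all).2 fun q hq =>
    (S.eventually_all).2 (e2 q hq), (S.eventually_all).2 e3, self_mem_nhdsWithin]
    with ε h1 h2 h3 hε
  have hε : 0 < ε := hε
  have key : ∀ q : S, _ := fun q => (hG q).exists_cubes hn hf (hF ε hε) hδ hδ1 (hT q) (hab q)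
    (he q) hθ hθδ (hKG q) hε (h1 q q.2) (h3 q q.2)
  choose ι c hdis hsub hle using key
  have hmain := tsum_meanOsc_le_kappa (n := n) (ε := ε) (u := F ε) (Ω := Ω)
    (fun p : (Σ q : S, ι q) => openCube (T p.1) (c p.1 p.2) ε)
    (fun p => isCube_openCube _ _ _) (fun p => ⟨_, center_mem_openCube _ _ hε⟩)
    (fun p => (hsub p.1 p.2).trans Set.inter_subset_right) (by
      rintro ⟨q, j⟩ ⟨q', j'⟩ hne
      by_cases hqq : q = q'
      · subst hqq
        exact hdis q (fun h => hne (congrArg (Sigma.mk q) h))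
      · exact (h2 q q.2 q' q'.2 (fun h => hqq (Subtype.ext h))).mono
          ((hsub q j).trans Set.inter_subset_left) ((hsub q' j').trans Set.inter_subset_left))
  calc ∑ q ∈ S, μ (K q) = ∑ q : S, μ (K q) := (Finset.sum_coe_sort S fun q => μ (K q)).symm
    _ ≤ ∑ q : S, ENNReal.ofReal (2 * (1 + δ) / (1 - δ)) * (ENNReal.ofReal (ε ^ (n - 1)) *
        ∑' j, ENNReal.ofReal (meanOsc (F ε) (openCube (T q) (c q j) ε))) :=
      Finset.sum_le_sum fun q _ => hle q
    _ = ENNReal.ofReal (2 * (1 + δ) / (1 - δ)) * (ENNReal.ofReal (ε ^ (n - 1)) *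
        ∑' p : (Σ q : S, ι q), ENNReal.ofReal (meanOsc (F ε)
          (openCube (T p.1) (c p.1 p.2) ε))) := by
      rw [ENNReal.tsum_sigma', tsum_fintype, Finset.mul_sum, Finset.mul_sum]
    _ ≤ _ := by gcongr

lemma measure_iUnion_le_liminf_kappa (hn : 1 ≤ n) {Ω : Set 𝔼} (hΩ : IsOpen Ω) {f : 𝔼 → ℝ}
    (hf : LocallyIntegrableOn f Ω volume) {F : ℝ → 𝔼 → ℝ}
    (hF : ∀ ε, 0 < ε → LocallyIntegrableOn (F ε) Ω volume)
    (hconv : ∀ K, IsCompact K → K ⊆ Ω →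
      Tendsto (fun ε => eLpNorm (fun x => F ε x - f x) ⊤ (volume.restrict K))
        (𝓝[>] (0:ℝ)) (𝓝 0))
    {μ : Measure 𝔼} [IsFiniteMeasure μ] {δ θ : ℝ} (hδ : 0 < δ) (hδ1 : δ < 1)
    (hθ : 2 * θ < (1 / (8 * n) / (4 * n)) ^ n) (hθδ : θ * (2 * n) ^ n ≤ δ / 4)
    {i₀ : Fin n} {T : ℕ → 𝔼 ≃ₗᵢ[ℝ] 𝔼} {a b s : ℕ → ℝ} {e : ℕ → 𝔼} {G : ℕ → Set 𝔼}
    (hG : ∀ q, IsJumpPiece f Ω μ δ θ (T q) (a q) (b q) (e q) (s q) (G q))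
    (hT : ∀ q, T q (EuclideanSpace.single i₀ 1) = e q) (hab : ∀ q, a q ≠ b q)
    (he : ∀ q, ‖e q‖ = 1) :
    μ (⋃ q, G q) ≤ ENNReal.ofReal (2 * (1 + δ) / (1 - δ)) *
      liminf (fun ε => kappa n ε (F ε) Ω) (𝓝[>] (0:ℝ)) := by
  have hGΩ : ∀ q, G q ⊆ Ω := fun q x hx =>
    ((hG q).isFlatAt x hx (s q / 2) (half_pos (hG q).pos) (half_lt_self (hG q).pos)).1
      (mem_closedBall_self (half_pos (hG q).pos).le)
  set D : ℕ → Set 𝔼 := disjointed fun q => closure (G q) ∩ Ω with hD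
  have hDm : ∀ q, MeasurableSet (D q) := fun q =>
    MeasurableSet.disjointed (fun q => isClosed_closure.measurableSet.inter hΩ.measurableSet) q
  have hDs : ∀ q, D q ⊆ closure (G q) ∩ Ω := fun q => disjointed_subset _ q
  have hDd : Pairwise (Function.onFun Disjoint D) := disjoint_disjointed _
  have hU : μ (⋃ q, G q) ≤ ∑' q, μ (D q) := by
    rw [← measure_iUnion hDd hDm, iUnion_disjointed]
    exact measure_mono (Set.iUnion_mono fun q => Set.subset_inter subset_closure (hGΩ q))
  refine hU.trans ?_
  rw [ENNReal.tsum_eq_iSup_nat]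
  refine iSup_le fun N => ?_
  refine ENNReal.le_of_forall_pos_le_add fun ρ hρ _ => ?_
  have hρN : (ρ / (N + 1) : ENNReal) ≠ 0 := by
    rw [Ne, ENNReal.div_eq_zero_iff]
    push Not
    refine ⟨by exact_mod_cast hρ.ne', by finiteness⟩
  choose K hKD hKc hK using fun q => (hDm q).exists_isCompact_lt_add (measure_ne_top μ _) hρN
  have h1 := eventually_sum_measure_le_kappa hn hΩ hf hF hconv hδ hδ1 hθ hθδ hG hT hab he hKc
    (fun q => ((hKD q).trans (hDs q)).trans Set.inter_subset_left)
    (fun q => ((hKD q).trans (hDs q)).trans Set.inter_subset_right)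
    (fun q q' h => (hDd h).mono (hKD q) (hKD q')) (Finset.range N)
  have hC0 : ENNReal.ofReal (2 * (1 + δ) / (1 - δ)) ≠ 0 := by
    have : 0 < 1 - δ := by linarith
    rw [Ne, ENNReal.ofReal_eq_zero, not_le]
    positivity
  have h2 : ∑ q ∈ Finset.range N, μ (K q) ≤ ENNReal.ofReal (2 * (1 + δ) / (1 - δ)) *
      liminf (fun ε => kappa n ε (F ε) Ω) (𝓝[>] (0:ℝ)) := by
    have h3 : (∑ q ∈ Finset.range N, μ (K q)) / ENNReal.ofReal (2 * (1 + δ) / (1 - δ)) ≤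
        liminf (fun ε => kappa n ε (F ε) Ω) (𝓝[>] (0:ℝ)) := by
      refine le_liminf_of_le (by isBoundedDefault) ?_
      filter_upwards [h1] with ε h
      exact ENNReal.div_le_of_le_mul' h
    rw [ENNReal.div_le_iff_le_mul (Or.inl hC0) (Or.inl ENNReal.ofReal_ne_top)] at h3
    rwa [mul_comm]
  calc ∑ q ∈ Finset.range N, μ (D q)
      ≤ ∑ q ∈ Finset.range N, (μ (K q) + ρ / (N + 1)) := Finset.sum_le_sum fun q _ => (hK q).le
    _ = ∑ q ∈ Finset.range N, μ (K q) + N * (ρ / (N + 1)) := by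
      rw [Finset.sum_add_distrib]; simp
    _ ≤ _ := by
      refine add_le_add h2 ?_
      calc (N : ENNReal) * (ρ / (N + 1)) ≤ (N + 1) * (ρ / (N + 1)) := by gcongr; simp
        _ = ρ := ENNReal.mul_div_cancel (by simp) (by finiteness)

end Assembly

section JumpPart

variable {n : ℕ}

local notation "𝔼" => EuclideanSpace ℝ (Fin n)

/-- Parameters of an oriented jump: two distinct one-sided values and a unit normal. -/
abbrev JumpParam (n : ℕ) : Type :=
  {p : ℝ × ℝ × EuclideanSpace ℝ (Fin n) // p.1 ≠ p.2.1 ∧ ‖p.2.2‖ = 1}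

lemma exists_jumpPiece_mem (hn : 1 ≤ n) {Ω : Set 𝔼} (hΩ : IsOpen Ω) {f : 𝔼 → ℝ}
    (hf : LocallyIntegrableOn f Ω volume) {μ : Measure 𝔼} {δ θ : ℝ} (hθ : 0 < θ)
    {T : JumpParam n → 𝔼 ≃ₗᵢ[ℝ] 𝔼} {x : 𝔼} (hx : x ∈ jumpSet n f ∩ Ω)
    (hμ : ∀ p : JumpParam n, (∀ᶠ r in 𝓝[>] 0, IsFlatAt f Ω θ x p.1.1 p.1.2.1 p.1.2.2 r) →
      ∀ᶠ r in 𝓝[>] (0:ℝ), ∀ c, ‖c - x‖ ≤ n * r →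
        μ.real (closedCube (T p) c r) ≤ (1 + δ) * |p.1.1 - p.1.2.1| * r ^ (n - 1))
    {p : ℕ → JumpParam n} (hp : DenseRange p) {z : ℕ → 𝔼} (hz : DenseRange z) :
    ∃ k m l : ℕ, dist x (z l) < 1 / ((m : ℝ) + 1) / 4 ∧
      (∀ r, 0 < r → r < 1 / ((m : ℝ) + 1) →
        IsFlatAt f Ω θ x (p k).1.1 (p k).1.2.1 (p k).1.2.2 r) ∧
      (∀ r, 0 < r → r < 1 / ((m : ℝ) + 1) → ∀ c, ‖c - x‖ ≤ n * r →
        μ.real (closedCube (T (p k)) c r) ≤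
          (1 + δ) * |(p k).1.1 - (p k).1.2.1| * r ^ (n - 1)) := by
  obtain ⟨⟨e, he, a, b, hab, ha, hb⟩, hxΩ⟩ := hx
  have h1 := eventually_eventually_isFlatAt hn hΩ hf hxΩ he hab ha hb hθ
  let p₀ : JumpParam n := ⟨(a, b, e), hab, he⟩
  have h2 : ∀ᶠ q : JumpParam n in 𝓝 p₀,
      ∀ᶠ r in 𝓝[>] 0, IsFlatAt f Ω θ x q.1.1 q.1.2.1 q.1.2.2 r :=
    (continuous_subtype_val.tendsto p₀).eventually h1
  obtain ⟨k, hk⟩ := hp.exists_mem_open isOpen_interior ⟨p₀, mem_interior_iff_mem_nhds.2 h2⟩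
  have hk' : ∀ᶠ r in 𝓝[>] 0, IsFlatAt f Ω θ x (p k).1.1 (p k).1.2.1 (p k).1.2.2 r :=
    interior_subset (s := {q : JumpParam n | ∀ᶠ r in 𝓝[>] 0,
      IsFlatAt f Ω θ x q.1.1 q.1.2.1 q.1.2.2 r}) hk
  have h3 := hk'.and (hμ (p k) hk')
  obtain ⟨s, hs, hs'⟩ := mem_nhdsGT_iff_exists_Ioo_subset.1 h3
  obtain ⟨m, hm⟩ := exists_nat_one_div_lt (show (0:ℝ) < s from hs)
  have hm0 : (0 : ℝ) < 1 / ((m : ℝ) + 1) := by positivity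
  obtain ⟨l, hl⟩ := hz.exists_dist_lt x (show 0 < 1 / ((m : ℝ) + 1) / 4 by positivity)
  exact ⟨k, m, l, hl, fun r h h' => (hs' ⟨h, h'.trans hm⟩).1,
    fun r h h' => (hs' ⟨h, h'.trans hm⟩).2⟩

lemma IsVariationPair.ae_tendsto_average {Ω : Set 𝔼} {f : 𝔼 → ℝ} {μ : Measure 𝔼} {σ : 𝔼 → 𝔼}
    (h : IsVariationPair n f Ω μ σ) :
    ∀ᵐ x ∂μ, Tendsto (fun r => ⨍ y in closedBall x r, ‖σ y - σ x‖ ∂μ) (𝓝[>] 0) (𝓝 0) := by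
  have := h.1
  have hσ : Integrable σ μ := by
    refine Integrable.mono' (integrable_const (1 : ℝ)) h.2.2.1 ?_
    filter_upwards [h.2.2.2.1] with x hx using hx.le
  filter_upwards [(Besicovitch.vitaliFamily μ).ae_tendsto_average_norm_sub
    hσ.locallyIntegrable] with x hx
  exact hx.comp (Besicovitch.tendsto_filterAt μ x)

lemma IsVariationPair.measure_jumpSet_le (hn : 1 ≤ n) {Ω : Set 𝔼} (hΩ : IsOpen Ω) {f : 𝔼 → ℝ}
    (hf : LocallyIntegrableOn f Ω volume) {F : ℝ → 𝔼 → ℝ}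
    (hF : ∀ ε, 0 < ε → LocallyIntegrableOn (F ε) Ω volume)
    (hconv : ∀ K, IsCompact K → K ⊆ Ω →
      Tendsto (fun ε => eLpNorm (fun x => F ε x - f x) ⊤ (volume.restrict K))
        (𝓝[>] (0:ℝ)) (𝓝 0))
    {μ : Measure 𝔼} {σ : 𝔼 → 𝔼} (h : IsVariationPair n f Ω μ σ) {δ : ℝ} (hδ : 0 < δ)
    (hδ1 : δ < 1) :
    μ (jumpSet n f ∩ Ω) ≤ ENNReal.ofReal (2 * (1 + δ) / (1 - δ)) *
      liminf (fun ε => kappa n ε (F ε) Ω) (𝓝[>] (0:ℝ)) := by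
  have := h.1
  have hn0 : (0 : ℝ) < n := by exact_mod_cast hn
  obtain ⟨θ₀, hθ₀, hθ₀'⟩ := exists_eventually_measureReal_closedCube_le (n := n) hn hδ
  obtain ⟨θ, hθ, h1, h2, h3⟩ : ∃ θ > 0, θ ≤ θ₀ ∧ 2 * θ < (1 / (8 * n) / (4 * n)) ^ n ∧
      θ * (2 * n) ^ n ≤ δ / 4 := by
    have hA : (0:ℝ) < (1 / (8 * n) / (4 * n)) ^ n := by positivity
    have hB : (0:ℝ) < δ / 4 / (2 * n) ^ n := by positivity
    refine ⟨min θ₀ (min ((1 / (8 * n) / (4 * n)) ^ n / 3) (δ / 4 / (2 * n) ^ n)), by positivity,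
      min_le_left _ _, ?_, ?_⟩
    · have := (min_le_right θ₀ (min (((1:ℝ) / (8 * n) / (4 * n)) ^ n / 3)
        (δ / 4 / (2 * n) ^ n))).trans (min_le_left _ _)
      linarith
    · rw [← le_div_iff₀ (by positivity)]
      exact (min_le_right _ _).trans (min_le_right _ _)
  let i₀ : Fin n := ⟨0, hn⟩
  have hne : Nonempty (JumpParam n) := ⟨⟨(0, 1, EuclideanSpace.single i₀ 1), by simp, by simp⟩⟩
  choose T hT using fun p : JumpParam n => exists_linearIsometryEquiv_single i₀ p.2.2
  let p := TopologicalSpace.denseSeq (JumpParam n)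
  let z := TopologicalSpace.denseSeq 𝔼
  obtain ⟨N, hN⟩ := exists_surjective_nat (ℕ × ℕ × ℕ)
  let G : ℕ × ℕ × ℕ → Set 𝔼 := fun q => {x | dist x (z q.2.2) < 1 / ((q.2.1 : ℝ) + 1) / 4 ∧
      (∀ r, 0 < r → r < 1 / ((q.2.1 : ℝ) + 1) →
        IsFlatAt f Ω θ x (p q.1).1.1 (p q.1).1.2.1 (p q.1).1.2.2 r) ∧
      (∀ r, 0 < r → r < 1 / ((q.2.1 : ℝ) + 1) → ∀ c, ‖c - x‖ ≤ n * r →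
        μ.real (closedCube (T (p q.1)) c r) ≤
          (1 + δ) * |(p q.1).1.1 - (p q.1).1.2.1| * r ^ (n - 1))}
  have hG : ∀ q, IsJumpPiece f Ω μ δ θ (T (p q.1)) (p q.1).1.1 (p q.1).1.2.1 (p q.1).1.2.2
      (1 / ((q.2.1 : ℝ) + 1)) (G q) := fun q =>
    { pos := by positivity
      dist_lt := fun x hx y hy => by
        have := dist_triangle_right x y (z q.2.2)
        rw [← dist_eq_norm]
        linarith [hx.1, hy.1]
      isFlatAt := fun x hx => hx.2.1
      measure_le := fun x hx => hx.2.2 }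
  have hmain := measure_iUnion_le_liminf_kappa hn hΩ hf hF hconv hδ hδ1 h2 h3
    (fun j => hG (N j)) (fun j => hT (p (N j).1)) (fun j => (p (N j).1).2.1)
    (fun j => (p (N j).1).2.2)
  refine le_trans (measure_mono_ae ?_) hmain
  filter_upwards [h.2.2.2.1, h.ae_tendsto_average] with x hx1 hx2 hxJ
  obtain ⟨k, m, l, hkml⟩ := exists_jumpPiece_mem hn hΩ hf hθ (T := T) (μ := μ) (δ := δ) hxJ
    (fun p hp => hθ₀' h hΩ hf hx1 hx2 hθ.le h1 p.2.1 p.2.2 (hT p) hp)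
    (TopologicalSpace.denseRange_denseSeq (JumpParam n)) (TopologicalSpace.denseRange_denseSeq 𝔼)
  obtain ⟨j, hj⟩ := hN (k, m, l)
  exact Set.mem_iUnion.2 ⟨j, by rw [hj]; exact hkml⟩

lemma IsVariationPair.measure_jumpSet_le_two_mul (hn : 1 ≤ n) {Ω : Set 𝔼} (hΩ : IsOpen Ω)
    {f : 𝔼 → ℝ} (hf : LocallyIntegrableOn f Ω volume) {F : ℝ → 𝔼 → ℝ}
    (hF : ∀ ε, 0 < ε → LocallyIntegrableOn (F ε) Ω volume)
    (hconv : ∀ K, IsCompact K → K ⊆ Ω →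
      Tendsto (fun ε => eLpNorm (fun x => F ε x - f x) ⊤ (volume.restrict K))
        (𝓝[>] (0:ℝ)) (𝓝 0))
    {μ : Measure 𝔼} {σ : 𝔼 → 𝔼} (h : IsVariationPair n f Ω μ σ) :
    μ (jumpSet n f ∩ Ω) ≤ 2 * liminf (fun ε => kappa n ε (F ε) Ω) (𝓝[>] (0:ℝ)) := by
  have h1 : Tendsto (fun δ : ℝ => ENNReal.ofReal (2 * (1 + δ) / (1 - δ))) (𝓝[>] 0) (𝓝 2) := by
    have h2 : ContinuousAt (fun δ : ℝ => 2 * (1 + δ) / (1 - δ)) 0 := by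
      fun_prop (disch := norm_num)
    have h3 := ENNReal.tendsto_ofReal (h2.tendsto.mono_left (nhdsWithin_le_nhds (s := Set.Ioi 0)))
    simpa using h3
  refine ge_of_tendsto (ENNReal.Tendsto.mul_const h1 (Or.inl two_ne_zero)) ?_
  filter_upwards [Ioo_mem_nhdsGT (zero_lt_one' ℝ)] with δ hδ
  exact h.measure_jumpSet_le hn hΩ hf hF hconv hδ.1 hδ.2

end JumpPart

section Grid

variable {n : ℕ}

local notation "𝔼" => EuclideanSpace ℝ (Fin n)

/-- The index of the half-open box containing `x`, in the grid whose boxes have side `ε / 2` in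
direction `i` and side `ε` in all other directions. -/
def gridIndex (i : Fin n) (ε : ℝ) (x : 𝔼) : Fin n → ℤ :=
  fun j => ⌊x j / if j = i then ε / 2 else ε⌋

/-- The center of the cube of side `ε` consisting of the grid box with index `k` and the next box
in direction `i`. -/
def gridCenter (i : Fin n) (ε : ℝ) (k : Fin n → ℤ) : 𝔼 :=
  WithLp.toLp 2 fun j => if j = i then (k j + 1) * (ε / 2) else (k j + 1 / 2) * ε

/-- The union of the grid boxes whose associated cube is contained in `Ω`. -/
def gridRegion (i : Fin n) (ε : ℝ) (Ω : Set 𝔼) : Set 𝔼 :=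
  {x | closedCube (LinearIsometryEquiv.refl ℝ 𝔼) (gridCenter i ε (gridIndex i ε x)) ε ⊆ Ω}

lemma measurable_gridIndex (i : Fin n) (ε : ℝ) : Measurable (gridIndex i ε : 𝔼 → Fin n → ℤ) := by
  refine measurable_pi_lambda _ fun j => Int.measurable_floor.comp ?_
  exact Measurable.div_const (by fun_prop) _

lemma measurableSet_gridRegion (i : Fin n) (ε : ℝ) (Ω : Set 𝔼) :
    MeasurableSet (gridRegion i ε Ω) :=
  measurable_gridIndex i ε (Set.to_countable
    {k | closedCube (LinearIsometryEquiv.refl ℝ 𝔼) (gridCenter i ε k) ε ⊆ Ω}).measurableSet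

lemma frameCoord_gridCenter (i : Fin n) (ε : ℝ) (k : Fin n → ℤ) (z : 𝔼) (j : Fin n) :
    frameCoord (LinearIsometryEquiv.refl ℝ 𝔼) (gridCenter i ε k) z j =
      z j - if j = i then (k j + 1) * (ε / 2) else (k j + 1 / 2) * ε := rfl

lemma mem_closedCube_gridCenter (i : Fin n) {ε : ℝ} (hε : 0 < ε) (x : 𝔼) :
    x ∈ closedCube (LinearIsometryEquiv.refl ℝ 𝔼) (gridCenter i ε (gridIndex i ε x)) ε := by
  intro j
  have h1 := Int.floor_le (x j / if j = i then ε / 2 else ε)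
  have h2 := Int.lt_floor_add_one (x j / if j = i then ε / 2 else ε)
  simp only [frameCoord_gridCenter, gridIndex]
  rw [abs_le]
  split_ifs with hj
  · simp only [hj, if_true] at h1 h2 ⊢
    rw [le_div_iff₀ (by positivity)] at h1
    rw [div_lt_iff₀ (by positivity)] at h2
    constructor <;> nlinarith
  · simp only [hj, if_false] at h1 h2 ⊢
    rw [le_div_iff₀ (by positivity)] at h1
    rw [div_lt_iff₀ (by positivity)] at h2
    constructor <;> nlinarith

lemma add_mem_closedCube_gridCenter (i : Fin n) {ε : ℝ} (hε : 0 < ε) (x : 𝔼) :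
    x + EuclideanSpace.single i (ε / 2) ∈
      closedCube (LinearIsometryEquiv.refl ℝ 𝔼) (gridCenter i ε (gridIndex i ε x)) ε := by
  intro j
  have h1 := Int.floor_le (x j / if j = i then ε / 2 else ε)
  have h2 := Int.lt_floor_add_one (x j / if j = i then ε / 2 else ε)
  simp only [frameCoord_gridCenter, gridIndex, PiLp.add_apply]
  rw [abs_le]
  split_ifs with hj
  · simp only [hj, if_true, PiLp.single_apply] at h1 h2 ⊢
    rw [le_div_iff₀ (by positivity)] at h1
    rw [div_lt_iff₀ (by positivity)] at h2
    constructor <;> nlinarith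
  · simp only [hj, if_false, PiLp.single_apply] at h1 h2 ⊢
    rw [le_div_iff₀ (by positivity)] at h1
    rw [div_lt_iff₀ (by positivity)] at h2
    constructor <;> nlinarith

lemma disjoint_openCube_gridCenter (i : Fin n) {ε : ℝ} (hε : 0 < ε) {k l : Fin n → ℤ}
    (hkl : k ≠ l) (hpar : (2 : ℤ) ∣ k i - l i) :
    Disjoint (openCube (LinearIsometryEquiv.refl ℝ 𝔼) (gridCenter i ε k) ε)
      (openCube (LinearIsometryEquiv.refl ℝ 𝔼) (gridCenter i ε l) ε) := by
  rw [Set.disjoint_left]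
  intro z hz hz'
  refine hkl (funext fun j => ?_)
  have h1 := hz j
  have h2 := hz' j
  simp only [frameCoord_gridCenter] at h1 h2
  rw [abs_lt] at h1 h2
  rcases eq_or_ne j i with rfl | hj
  · simp only [if_true] at h1 h2
    obtain ⟨m, hm⟩ := hpar
    have hm' : (k j : ℝ) - l j = 2 * m := by exact_mod_cast hm
    have h3 : (m : ℝ) < 1 := by nlinarith
    have h4 : (-1 : ℝ) < m := by nlinarith
    have h3' : m < 1 := by exact_mod_cast h3
    have h4' : -1 < m := by exact_mod_cast h4
    omega
  · simp only [hj, if_false] at h1 h2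
    have h3 : (k j : ℝ) < l j + 1 := by nlinarith
    have h4 : (l j : ℝ) < k j + 1 := by nlinarith
    have h3' : k j < l j + 1 := by exact_mod_cast h3
    have h4' : l j < k j + 1 := by exact_mod_cast h4
    omega

lemma lintegral_closedCube_sub_average {u : 𝔼 → ℝ} {T : 𝔼 ≃ₗᵢ[ℝ] 𝔼} {c : 𝔼} {ε : ℝ} (hε : 0 < ε)
    (hu : IntegrableOn u (closedCube T c ε) volume) :
    ∫⁻ x in closedCube T c ε, ‖u x - ⨍ y in openCube T c ε, u y‖ₑ =
      ENNReal.ofReal (ε ^ n) * ENNReal.ofReal (meanOsc u (openCube T c ε)) := by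
  have : Fact (volume (openCube T c ε) < ⊤) :=
    ⟨by rw [volume_openCube T c hε.le]; exact ENNReal.ofReal_lt_top⟩
  have hu' : IntegrableOn u (openCube T c ε) volume :=
    hu.mono_set (openCube_subset_closedCube _ _ _)
  have hu'' : IntegrableOn (fun x => u x - ⨍ y in openCube T c ε, u y) (openCube T c ε) volume :=
    hu'.sub (integrable_const _)
  rw [← setLIntegral_congr (openCube_ae_eq_closedCube T c hε.le),
    ← ofReal_integral_norm_eq_lintegral_enorm hu'', ← ENNReal.ofReal_mul (by positivity)]
  congr 1
  have h := measure_smul_setAverage (fun x => |u x - ⨍ y in openCube T c ε, u y|)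
    (this.out.ne : volume (openCube T c ε) ≠ ⊤)
  rw [measureReal_def, volume_openCube T c hε.le, ENNReal.toReal_ofReal (by positivity),
    smul_eq_mul] at h
  exact h.symm

lemma lintegral_gridBox_le {Ω : Set 𝔼} (hΩ : IsOpen Ω) {u : 𝔼 → ℝ}
    (hu : LocallyIntegrableOn u Ω volume) (i : Fin n) {ε : ℝ} (hε : 0 < ε) {k : Fin n → ℤ}
    (hk : closedCube (LinearIsometryEquiv.refl ℝ 𝔼) (gridCenter i ε k) ε ⊆ Ω) :
    ∫⁻ x in gridIndex i ε ⁻¹' {k}, ‖Ω.indicator u (x + EuclideanSpace.single i (ε / 2)) -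
      Ω.indicator u x‖ₑ ≤ 2 * (ENNReal.ofReal (ε ^ n) * ENNReal.ofReal
        (meanOsc u (openCube (LinearIsometryEquiv.refl ℝ 𝔼) (gridCenter i ε k) ε))) := by
  set Q := closedCube (LinearIsometryEquiv.refl ℝ 𝔼) (gridCenter i ε k) ε with hQ
  set m := ⨍ y in openCube (LinearIsometryEquiv.refl ℝ 𝔼) (gridCenter i ε k) ε, u y with hm
  have hB : MeasurableSet (gridIndex (n := n) i ε ⁻¹' {k}) :=
    measurable_gridIndex i ε (measurableSet_singleton k)
  have hQm : MeasurableSet Q := (isClosed_closedCube _ _ _).measurableSet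
  have hG : AEStronglyMeasurable (Ω.indicator u) volume :=
    (aestronglyMeasurable_indicator_iff hΩ.measurableSet).2 hu.aestronglyMeasurable
  have hQc : IsCompact Q := (isCompact_closedBall _ _).of_isClosed_subset
    (isClosed_closedCube _ _ _) (closedCube_subset_closedBall _ _ _)
  have hQint := lintegral_closedCube_sub_average hε (hu.integrableOn_compact_subset hk hQc)
  have hQ' : ∫⁻ x in Q, ‖Ω.indicator u x - m‖ₑ = ∫⁻ x in Q, ‖u x - m‖ₑ :=
    setLIntegral_congr_fun hQm fun x hx => by simp only [Set.indicator_of_mem (hk hx)]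
  have h1 : ∫⁻ x in gridIndex i ε ⁻¹' {k},
      ‖Ω.indicator u (x + EuclideanSpace.single i (ε / 2)) - m‖ₑ ≤ ∫⁻ x in Q, ‖u x - m‖ₑ := by
    rw [← hQ', ← lintegral_indicator hB, ← lintegral_indicator hQm,
      ← lintegral_add_right_eq_self (Q.indicator fun x => ‖Ω.indicator u x - m‖ₑ)
        (EuclideanSpace.single i (ε / 2) : 𝔼)]
    refine lintegral_mono fun x => ?_
    by_cases hx : x ∈ gridIndex i ε ⁻¹' {k}
    · have hx' := add_mem_closedCube_gridCenter i hε x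
      rw [show gridIndex i ε x = k from hx] at hx'
      rw [Set.indicator_of_mem hx, Set.indicator_of_mem hx']
    · rw [Set.indicator_of_notMem hx]
      exact zero_le
  have h2 : ∫⁻ x in gridIndex i ε ⁻¹' {k}, ‖Ω.indicator u x - m‖ₑ ≤ ∫⁻ x in Q, ‖u x - m‖ₑ := by
    rw [← hQ']
    refine lintegral_mono_set fun x hx => ?_
    have hx' := mem_closedCube_gridCenter i hε x
    rwa [show gridIndex i ε x = k from hx] at hx'
  calc _ ≤ ∫⁻ x in gridIndex i ε ⁻¹' {k},
        (‖Ω.indicator u (x + EuclideanSpace.single i (ε / 2)) - m‖ₑ + ‖Ω.indicator u x - m‖ₑ) := by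
        refine lintegral_mono fun x => ?_
        have := enorm_sub_le (a := Ω.indicator u (x + EuclideanSpace.single i (ε / 2)) - m)
          (b := Ω.indicator u x - m)
        simpa using this
    _ = _ := lintegral_add_right' _ ((hG.sub aestronglyMeasurable_const).enorm.restrict)
    _ ≤ (∫⁻ x in Q, ‖u x - m‖ₑ) + ∫⁻ x in Q, ‖u x - m‖ₑ := add_le_add h1 h2
    _ = _ := by rw [hQint, two_mul]

lemma lintegral_gridRegion_le (hn : 1 ≤ n) {Ω : Set 𝔼} (hΩ : IsOpen Ω) {u : 𝔼 → ℝ}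
    (hu : LocallyIntegrableOn u Ω volume) (i : Fin n) {ε : ℝ} (hε : 0 < ε) :
    ∫⁻ x in gridRegion i ε Ω, ‖Ω.indicator u (x + EuclideanSpace.single i (ε / 2)) -
      Ω.indicator u x‖ₑ ≤ ENNReal.ofReal (4 * ε) * kappa n ε u Ω := by
  let S : Set (Fin n → ℤ) :=
    {k | closedCube (LinearIsometryEquiv.refl ℝ 𝔼) (gridCenter i ε k) ε ⊆ Ω}
  let t : (Fin n → ℤ) → ℝ≥0∞ := fun k => ENNReal.ofReal
        (meanOsc u (openCube (LinearIsometryEquiv.refl ℝ 𝔼) (gridCenter i ε k) ε))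
  have hU : gridRegion i ε Ω = ⋃ k : S, gridIndex (n := n) i ε ⁻¹' {k.1} := by
    ext x
    simp [gridRegion, S]
  have hpar : ∀ S' : Set (Fin n → ℤ), S' ⊆ S → (∀ k ∈ S', ∀ l ∈ S', (2 : ℤ) ∣ k i - l i) →
      ENNReal.ofReal (ε ^ (n - 1)) * ∑' k : S', t k ≤ kappa n ε u Ω := fun S' hS' hp =>
    tsum_meanOsc_le_kappa (fun k : S' => openCube (LinearIsometryEquiv.refl ℝ 𝔼)
      (gridCenter i ε k.1) ε) (fun k => isCube_openCube _ _ _)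
      (fun k => ⟨_, center_mem_openCube _ _ hε⟩)
      (fun k => (openCube_subset_closedCube _ _ _).trans (hS' k.2))
      fun k l hkl => disjoint_openCube_gridCenter i hε (fun h => hkl (Subtype.ext h))
        (hp k k.2 l l.2)
  have h0 := hpar (S ∩ {k | 2 ∣ k i}) Set.inter_subset_left
    fun k hk l hl => dvd_sub hk.2 hl.2
  have h1 := hpar (S ∩ {k | ¬ 2 ∣ k i}) Set.inter_subset_left fun k hk l hl => by
    have h2 : ¬ (2 : ℤ) ∣ k i := hk.2
    have h3 : ¬ (2 : ℤ) ∣ l i := hl.2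
    omega
  have hS : ∑' k : S, t k ≤ ∑' k : ↑(S ∩ {k | 2 ∣ k i}), t k +
      ∑' k : ↑(S ∩ {k | ¬ 2 ∣ k i}), t k := by
    have := ENNReal.tsum_union_le t (S ∩ {k | 2 ∣ k i}) (S ∩ {k | ¬ 2 ∣ k i})
    rwa [← Set.inter_union_distrib_left, show {k : Fin n → ℤ | 2 ∣ k i} ∪ {k | ¬ 2 ∣ k i} =
      Set.univ from Set.union_compl_self _, Set.inter_univ] at this
  have hεn : ε ^ n = ε * ε ^ (n - 1) := by
    rw [← pow_succ', Nat.sub_add_cancel hn]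
  calc _ ≤ ∑' k : S, ∫⁻ x in gridIndex (n := n) i ε ⁻¹' {k.1},
        ‖Ω.indicator u (x + EuclideanSpace.single i (ε / 2)) - Ω.indicator u x‖ₑ := by
        rw [hU]
        exact lintegral_iUnion_le _ _
    _ ≤ ∑' k : S, 2 * (ENNReal.ofReal (ε ^ n) * t k) :=
        ENNReal.tsum_le_tsum fun k => lintegral_gridBox_le hΩ hu i hε k.2
    _ = 2 * (ENNReal.ofReal ε * (ENNReal.ofReal (ε ^ (n - 1)) * ∑' k : S, t k)) := by
        rw [ENNReal.tsum_mul_left, ENNReal.tsum_mul_left, hεn, ENNReal.ofReal_mul hε.le, mul_assoc]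
    _ ≤ 2 * (ENNReal.ofReal ε * (kappa n ε u Ω + kappa n ε u Ω)) := by
        gcongr
        refine (mul_le_mul_right hS _).trans ?_
        rw [mul_add]
        exact add_le_add h0 h1
    _ = _ := by
        rw [← two_mul, ENNReal.ofReal_mul (by norm_num), ENNReal.ofReal_ofNat]
        ring

end Grid

section VagueLimit

open CompactlySupported

/-- Vague sequential compactness, phrased with ultrafilters: a family of measures of bounded mass
converges vaguely along any ultrafilter. -/
lemma exists_vague_limit {ι X : Type*} [TopologicalSpace X] [T2Space X] [LocallyCompactSpace X]
    [MeasurableSpace X] [BorelSpace X] (U : Ultrafilter ι) (m : ι → Measure X) {C : ℝ≥0∞}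
    (hC : C ≠ ⊤) (hm : ∀ᶠ ε in (U : Filter ι), m ε Set.univ ≤ C) :
    ∃ ν : Measure X, IsFiniteMeasure ν ∧ ∀ φ : C_c(X, ℝ),
      Tendsto (fun ε => ∫ x, φ x ∂(m ε)) U (𝓝 (∫ x, φ x ∂ν)) := by
  have hfin : ∀ᶠ ε in (U : Filter ι), IsFiniteMeasure (m ε) := by
    filter_upwards [hm] with ε h
    exact ⟨h.trans_lt hC.lt_top⟩
  have hint : ∀ φ : C_c(X, ℝ), ∀ᶠ ε in (U : Filter ι), Integrable φ (m ε) := by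
    intro φ
    filter_upwards [hfin] with ε h
    exact φ.continuous.integrable_of_hasCompactSupport φ.hasCompactSupport
  have hbd : ∀ (φ : C_c(X, ℝ)) (M : ℝ), 0 ≤ M → (∀ x, ‖φ x‖ ≤ M) →
      ∀ᶠ ε in (U : Filter ι), ‖∫ x, φ x ∂(m ε)‖ ≤ M * C.toReal := by
    intro φ M hM0 hM
    filter_upwards [hm, hfin] with ε h1 h2
    refine (norm_integral_le_of_norm_le_const (Eventually.of_forall hM)).trans ?_
    gcongr
    exact ENNReal.toReal_mono hC h1
  have hlim : ∀ φ : C_c(X, ℝ), ∃ L, Tendsto (fun ε => ∫ x, φ x ∂(m ε)) U (𝓝 L) := by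
    intro φ
    obtain ⟨M, hM⟩ := φ.hasCompactSupport.exists_bound_of_continuous φ.continuous
    have hM' : ∀ᶠ ε in (U : Filter ι),
        (∫ x, φ x ∂(m ε)) ∈ closedBall (0 : ℝ) (max M 0 * C.toReal) := by
      filter_upwards [hbd φ (max M 0) (le_max_right _ _)
        fun x => (hM x).trans (le_max_left _ _)] with ε h
      simpa using h
    obtain ⟨L, -, hL⟩ := (isCompact_closedBall (0 : ℝ) (max M 0 * C.toReal)).ultrafilter_le_nhds
      (U.map fun ε => ∫ x, φ x ∂(m ε)) (tendsto_principal.2 hM')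
    exact ⟨L, hL⟩
  choose L hL using hlim
  let Λ : C_c(X, ℝ) →ₗ[ℝ] ℝ :=
    { toFun := L
      map_add' := fun φ ψ => by
        refine tendsto_nhds_unique ((hL (φ + ψ)).congr' ?_) ((hL φ).add (hL ψ))
        filter_upwards [hint φ, hint ψ] with ε h1 h2
        exact integral_add h1 h2
      map_smul' := fun c φ => by
        refine tendsto_nhds_unique ((hL (c • φ)).congr' ?_) ((hL φ).const_mul c)
        exact Eventually.of_forall fun ε => integral_const_mul c _ }
  let Λ' : C_c(X, ℝ) →ₚ[ℝ] ℝ := PositiveLinearMap.mk₀ Λ fun φ hφ =>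
    ge_of_tendsto (hL φ) (Eventually.of_forall fun ε => integral_nonneg fun x => hφ x)
  refine ⟨RealRMK.rieszMeasure Λ', ⟨?_⟩, fun φ => ?_⟩
  · refine lt_of_le_of_lt ?_ hC.lt_top
    rw [isOpen_univ.measure_eq_iSup_isCompact]
    refine iSup₂_le fun K _ => iSup_le fun hK => ?_
    obtain ⟨g, hg1, -, hgc, hg⟩ := exists_continuous_one_zero_of_isCompact hK isClosed_empty
      (Set.disjoint_empty K)
    let g' : C_c(X, ℝ) := ⟨g, hgc⟩
    refine (RealRMK.rieszMeasure_le_of_eq_one Λ' (f := g') (fun x => (hg x).1) hK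
      fun x hx => hg1 hx).trans ?_
    rw [← ENNReal.ofReal_toReal hC]
    refine ENNReal.ofReal_le_ofReal (le_of_tendsto (hL g') ?_)
    filter_upwards [hbd g' 1 zero_le_one fun x => by
      have h1 : 0 ≤ g' x := (hg x).1
      rw [Real.norm_of_nonneg h1]; exact (hg x).2] with ε h
    rw [one_mul] at h
    exact (Real.le_norm_self _).trans h
  · rw [RealRMK.integral_rieszMeasure]
    exact hL φ

/-- A family of functions bounded in `L¹` converges vaguely, along any ultrafilter, to the
difference of two finite measures. -/
lemma exists_vague_limit_of_lintegral_enorm_le {ι X : Type*} [TopologicalSpace X] [T2Space X]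
    [LocallyCompactSpace X] [MeasurableSpace X] [BorelSpace X] (U : Ultrafilter ι) {m : Measure X}
    (w : ι → X → ℝ) (hw : ∀ᶠ ε in (U : Filter ι), AEStronglyMeasurable (w ε) m) {C : ℝ≥0∞}
    (hC : C ≠ ⊤) (hm : ∀ᶠ ε in (U : Filter ι), ∫⁻ x, ‖w ε x‖ₑ ∂m ≤ C) :
    ∃ ν ν' : Measure X, IsFiniteMeasure ν ∧ IsFiniteMeasure ν' ∧ ∀ φ : C_c(X, ℝ),
      Tendsto (fun ε => ∫ x, φ x * w ε x ∂m) U (𝓝 (∫ x, φ x ∂ν - ∫ x, φ x ∂ν')) := by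
  have hle : ∀ s : ι → X → ℝ, (∀ ε x, s ε x ≤ ‖w ε x‖) → ∀ᶠ ε in (U : Filter ι),
      (m.withDensity fun x => ENNReal.ofReal (s ε x)) Set.univ ≤ C := by
    intro s hs
    filter_upwards [hm] with ε h
    rw [withDensity_apply _ MeasurableSet.univ, setLIntegral_univ]
    refine (lintegral_mono fun x => ?_).trans h
    rw [← ofReal_norm]
    exact ENNReal.ofReal_le_ofReal (hs ε x)
  obtain ⟨ν, hν, hν'⟩ := exists_vague_limit U _ hC (hle w fun ε x => Real.le_norm_self _)
  obtain ⟨η, hη, hη'⟩ := exists_vague_limit U _ hC (hle (fun ε x => -w ε x)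
    fun ε x => by simpa using neg_le_abs (w ε x))
  refine ⟨ν, η, hν, hη, fun φ => ((hν' φ).sub (hη' φ)).congr' ?_⟩
  filter_upwards [hm, hw] with ε h hw
  have hint : Integrable (w ε) m := ⟨hw, h.trans_lt hC.lt_top⟩
  obtain ⟨M, hM⟩ := φ.hasCompactSupport.exists_bound_of_continuous φ.continuous
  have hmul : ∀ s : X → ℝ, Integrable s m → Integrable (fun x => s x * φ x) m := fun s hs =>
    Integrable.mul_bdd (c := M) hs φ.continuous.aestronglyMeasurable (Eventually.of_forall hM)
  have hneg : AEStronglyMeasurable (fun x => -w ε x) m := hw.neg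
  rw [integral_withDensity_eq_integral_toReal_smul₀ hw.aemeasurable.ennreal_ofReal
      (Eventually.of_forall fun x => ENNReal.ofReal_lt_top),
    integral_withDensity_eq_integral_toReal_smul₀ hneg.aemeasurable.ennreal_ofReal
      (Eventually.of_forall fun x => ENNReal.ofReal_lt_top)]
  simp only [smul_eq_mul, ENNReal.toReal_ofReal']
  rw [← integral_sub (hmul _ hint.pos_part) (hmul _ hint.neg_part)]
  refine integral_congr_ae (Eventually.of_forall fun x => ?_)
  simp only
  rw [← sub_mul, mul_comm]
  congr 1
  rcases le_total 0 (w ε x) with h0 | h0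
  · rw [max_eq_left h0, max_eq_right (by linarith), sub_zero]
  · rw [max_eq_right h0, max_eq_left (by linarith)]
    ring

end VagueLimit

section DifferenceQuotient

variable {n : ℕ}

local notation "𝔼" => EuclideanSpace ℝ (Fin n)

lemma mul_indicator_eq_indicator_mul {Ω K : Set 𝔼} (hKΩ : K ⊆ Ω) {ψ : 𝔼 → ℝ}
    (hψK : ∀ x, x ∉ K → ψ x = 0) (u : 𝔼 → ℝ) :
    (fun x => ψ x * Ω.indicator u x) = K.indicator fun x => ψ x * u x := by
  ext x
  by_cases hx : x ∈ K
  · rw [Set.indicator_of_mem hx, Set.indicator_of_mem (hKΩ hx)]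
  · rw [Set.indicator_of_notMem hx, hψK x hx, zero_mul]

lemma integrable_mul_indicator {Ω K : Set 𝔼} (hK : IsCompact K) (hKΩ : K ⊆ Ω) {ψ u : 𝔼 → ℝ}
    (hψ : Continuous ψ) (hψK : ∀ x, x ∉ K → ψ x = 0) (hu : LocallyIntegrableOn u Ω volume) :
    Integrable (fun x => ψ x * Ω.indicator u x) volume := by
  rw [mul_indicator_eq_indicator_mul hKΩ hψK, integrable_indicator_iff hK.measurableSet]
  exact (hu.integrableOn_compact_subset hKΩ hK).continuousOn_mul hψ.continuousOn hK

/-- The difference quotient in direction `i` of `u`, restricted to the grid boxes on which it is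
controlled by the mean oscillation of `u`. -/
def gridQuotient (i : Fin n) (ε : ℝ) (Ω : Set 𝔼) (u : 𝔼 → ℝ) (x : 𝔼) : ℝ :=
  (gridRegion i ε Ω).indicator (fun x => (ε / 2)⁻¹ *
    (Ω.indicator u (x + EuclideanSpace.single i (ε / 2)) - Ω.indicator u x)) x

lemma aestronglyMeasurable_gridQuotient (i : Fin n) (ε : ℝ) {Ω : Set 𝔼} (hΩ : IsOpen Ω)
    {u : 𝔼 → ℝ} (hu : LocallyIntegrableOn u Ω volume) :
    AEStronglyMeasurable (gridQuotient i ε Ω u) volume := by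
  have hG : AEStronglyMeasurable (Ω.indicator u) volume :=
    (aestronglyMeasurable_indicator_iff hΩ.measurableSet).2 hu.aestronglyMeasurable
  have hG' := hG.comp_measurePreserving
    (measurePreserving_add_right volume (EuclideanSpace.single i (ε / 2) : 𝔼))
  exact ((hG'.sub hG).const_mul _).indicator (measurableSet_gridRegion i ε Ω)

lemma lintegral_gridQuotient_le (hn : 1 ≤ n) (i : Fin n) {ε : ℝ} (hε : 0 < ε) {Ω : Set 𝔼}
    (hΩ : IsOpen Ω) {u : 𝔼 → ℝ} (hu : LocallyIntegrableOn u Ω volume) :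
    ∫⁻ x, ‖gridQuotient i ε Ω u x‖ₑ ≤ 8 * kappa n ε u Ω := by
  have h1 : ∀ x, ‖gridQuotient i ε Ω u x‖ₑ = (gridRegion i ε Ω).indicator (fun x =>
      ENNReal.ofReal (ε / 2)⁻¹ * ‖Ω.indicator u (x + EuclideanSpace.single i (ε / 2)) -
        Ω.indicator u x‖ₑ) x := by
    intro x
    rw [gridQuotient, enorm_indicator_eq_indicator_enorm]
    congr 1
    ext y
    rw [enorm_mul, Real.enorm_of_nonneg (by positivity)]
  simp_rw [h1]
  rw [lintegral_indicator (measurableSet_gridRegion i ε Ω),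
    lintegral_const_mul' _ _ ENNReal.ofReal_ne_top]
  calc _ ≤ ENNReal.ofReal (ε / 2)⁻¹ * (ENNReal.ofReal (4 * ε) * kappa n ε u Ω) := by
        gcongr
        exact lintegral_gridRegion_le hn hΩ hu i hε
    _ = _ := by
        rw [← mul_assoc, ← ENNReal.ofReal_mul (by positivity)]
        congr 1
        rw [show (ε / 2)⁻¹ * (4 * ε) = 8 by field_simp; norm_num, ENNReal.ofReal_ofNat]

lemma subset_gridRegion (i : Fin n) {ε : ℝ} (hε : 0 < ε) {Ω S : Set 𝔼} {R : ℝ}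
    (hS : cthickening R S ⊆ Ω) (hR : n * ε ≤ R) : S ⊆ gridRegion i ε Ω := by
  intro x hx
  have h1 := closedCube_subset_closedBall _ _ _ (mem_closedCube_gridCenter i hε x)
  refine (closedCube_subset_closedBall _ _ _).trans (Set.Subset.trans ?_ hS)
  refine Set.Subset.trans (closedBall_subset_closedBall' ?_) (closedBall_subset_cthickening hx R)
  rw [mem_closedBall'] at h1
  linarith

/-- Summation by parts for difference quotients. -/
lemma integral_mul_gridQuotient (i : Fin n) {ε : ℝ} (hε : 0 < ε) {Ω : Set 𝔼}
    {u : 𝔼 → ℝ} (hu : LocallyIntegrableOn u Ω volume) {φ : 𝔼 → ℝ} (hφ : Continuous φ)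
    (hφc : HasCompactSupport φ) {R : ℝ} (hRΩ : cthickening R (tsupport φ) ⊆ Ω)
    (hR : n * ε ≤ R) (hR' : ε / 2 ≤ R) :
    ∫ x, φ x * gridQuotient i ε Ω u x =
      ∫ x in cthickening R (tsupport φ), (ε / 2)⁻¹ *
        (φ (x + (ε / 2) • -EuclideanSpace.single i 1) - φ x) * u x := by
  set K := cthickening R (tsupport φ) with hKdef
  have hK : IsCompact K := hφc.isCompact.cthickening
  set v : 𝔼 := EuclideanSpace.single i (ε / 2) with hv
  have hv' : (ε / 2) • -(EuclideanSpace.single i 1 : 𝔼) = -v := by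
    rw [smul_neg, hv]
    congr 1
    ext j
    by_cases hj : j = i <;> simp [hj]
  rw [hv']
  have hsub : tsupport φ ⊆ K := self_subset_cthickening _
  have h0 : ∀ x, x ∉ K → φ x = 0 := fun x hx =>
    image_eq_zero_of_notMem_tsupport fun h => hx (hsub h)
  have h0' : ∀ x, x ∉ K → φ (x + -v) = 0 := by
    intro x hx
    refine image_eq_zero_of_notMem_tsupport fun h => hx ?_
    refine closedBall_subset_cthickening h R ?_
    rw [mem_closedBall, dist_eq_norm]
    have : ‖v‖ = ε / 2 := by
      rw [hv, PiLp.norm_single, Real.norm_of_nonneg (by positivity)]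
    simpa [this] using hR'
  have h1 : ∀ x, φ x * gridQuotient i ε Ω u x =
      (ε / 2)⁻¹ * (φ x * Ω.indicator u (x + v) - φ x * Ω.indicator u x) := by
    intro x
    by_cases hx : x ∈ tsupport φ
    · rw [gridQuotient, Set.indicator_of_mem (subset_gridRegion i hε hRΩ hR hx)]
      ring
    · rw [image_eq_zero_of_notMem_tsupport hx]
      ring
  have hi1 : Integrable (fun x => φ x * Ω.indicator u x) volume :=
    integrable_mul_indicator hK hRΩ hφ h0 hu
  have hi2 : Integrable (fun x => φ (x + -v) * Ω.indicator u x) volume :=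
    integrable_mul_indicator hK hRΩ (by fun_prop) h0' hu
  have hi3 : Integrable (fun x => φ x * Ω.indicator u (x + v)) volume := by
    simpa using hi2.comp_add_right v
  have h3 : ∫ x, φ x * Ω.indicator u (x + v) = ∫ x, φ (x + -v) * Ω.indicator u x := by
    rw [← integral_add_right_eq_self (fun x => φ (x + -v) * Ω.indicator u x) v]
    simp
  simp_rw [h1]
  rw [integral_const_mul, integral_sub hi3 hi1, h3, ← integral_sub hi2 hi1, ← integral_const_mul,
    ← integral_indicator hK.measurableSet]
  congr 1
  rw [← mul_indicator_eq_indicator_mul hRΩ (ψ := fun x => (ε / 2)⁻¹ * (φ (x + -v) - φ x))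
    (fun x hx => by rw [h0 x hx, h0' x hx]; ring)]
  ext x
  ring

lemma tendsto_integral_mul_gridQuotient (i : Fin n) {Ω : Set 𝔼} {f : 𝔼 → ℝ}
    (hf : LocallyIntegrableOn f Ω volume) {F : ℝ → 𝔼 → ℝ}
    (hF : ∀ ε, 0 < ε → LocallyIntegrableOn (F ε) Ω volume)
    (hconv : ∀ K, IsCompact K → K ⊆ Ω →
      Tendsto (fun ε => eLpNorm (fun x => F ε x - f x) ⊤ (volume.restrict K))
        (𝓝[>] (0:ℝ)) (𝓝 0)) (hΩ : IsOpen Ω) {φ : 𝔼 → ℝ} (hφ : ContDiff ℝ 1 φ)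
    (hφc : HasCompactSupport φ) (hφΩ : tsupport φ ⊆ Ω) :
    Tendsto (fun ε => ∫ x, φ x * gridQuotient i ε Ω (F ε) x) (𝓝[>] 0)
      (𝓝 (-∫ x in Ω, f x * fderiv ℝ φ x (EuclideanSpace.single i 1))) := by
  obtain ⟨R, hR, hRΩ⟩ := hφc.isCompact.exists_cthickening_subset_open hΩ hφΩ
  set K := cthickening R (tsupport φ) with hKdef
  have hK : IsCompact K := hφc.isCompact.cthickening
  have hKfin : volume K < ⊤ := hK.measure_lt_top
  set e : 𝔼 := EuclideanSpace.single i 1 with he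
  have he1 : ‖e‖ = 1 := by rw [he, PiLp.norm_single]; simp
  let q : ℝ → 𝔼 → ℝ := fun t x => t⁻¹ * (φ (x + t • -e) - φ x)
  have hqc : ∀ t, Continuous (q t) := fun t => by
    have := hφ.continuous
    fun_prop
  obtain ⟨M, hM⟩ := (hφc.fderiv (𝕜 := ℝ)).exists_bound_of_continuous
    (hφ.continuous_fderiv one_ne_zero)
  have hM0 : 0 ≤ M := (norm_nonneg _).trans (hM 0)
  have hq : ∀ t, 0 < t → ∀ x, ‖q t x‖ ≤ M := by
    intro t ht x
    have h1 := Convex.norm_image_sub_le_of_norm_fderiv_le (𝕜 := ℝ) (f := φ) (s := Set.univ)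
      (fun y _ => hφ.differentiable one_ne_zero y) (fun y _ => hM y) convex_univ
      (Set.mem_univ x) (Set.mem_univ (x + t • -e))
    rw [add_sub_cancel_left, norm_smul, norm_neg, he1, mul_one, Real.norm_of_nonneg ht.le] at h1
    rw [norm_mul, norm_inv, Real.norm_of_nonneg ht.le, inv_mul_le_iff₀ ht]
    linarith
  have hqlim : ∀ x, Tendsto (fun t => q t x) (𝓝[>] 0) (𝓝 (-fderiv ℝ φ x e)) := by
    intro x
    have h1 := ((hφ.differentiable one_ne_zero x).hasFDerivAt.hasLineDerivAt
      (-e)).tendsto_slope_zero_right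
    rw [map_neg] at h1
    exact h1
  have hhalf : Tendsto (fun ε : ℝ => ε / 2) (𝓝[>] 0) (𝓝[>] 0) := by
    refine tendsto_nhdsWithin_iff.2 ⟨?_, ?_⟩
    · have h : Tendsto (fun ε : ℝ => ε / 2) (𝓝 0) (𝓝 (0 / 2)) :=
        (continuous_id.div_const 2).tendsto 0
      rw [zero_div] at h
      exact h.mono_left nhdsWithin_le_nhds
    · filter_upwards [self_mem_nhdsWithin] with ε hε
      exact half_pos (show (0:ℝ) < ε from hε)
  have hfK : IntegrableOn f K volume := hf.integrableOn_compact_subset hRΩ hK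
  have hA : Tendsto (fun ε => ∫ x in K, q (ε / 2) x * f x) (𝓝[>] 0)
      (𝓝 (∫ x in K, -fderiv ℝ φ x e * f x)) := by
    have : Tendsto (fun t => ∫ x in K, q t x * f x) (𝓝[>] 0)
        (𝓝 (∫ x in K, -fderiv ℝ φ x e * f x)) := by
      refine tendsto_integral_filter_of_dominated_convergence (fun x => M * ‖f x‖)
        (Eventually.of_forall fun t => (hqc t).aestronglyMeasurable.mul hfK.aestronglyMeasurable)
        ?_ (hfK.norm.const_mul M) (Eventually.of_forall fun x => (hqlim x).mul_const _)
      filter_upwards [self_mem_nhdsWithin] with t ht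
      refine Eventually.of_forall fun x => ?_
      rw [norm_mul]
      gcongr
      exact hq t ht x
    exact this.comp hhalf
  have hB : Tendsto (fun ε => ∫ x in K, q (ε / 2) x * (F ε x - f x)) (𝓝[>] 0) (𝓝 0) := by
    rw [Metric.tendsto_nhds]
    intro ρ hρ
    have hη : 0 < ρ / (M * volume.real K + 1) := by positivity
    filter_upwards [eventually_ae_abs_sub_le hconv hK hRΩ hη, self_mem_nhdsWithin] with ε h hε
    have hε : 0 < ε := hε
    rw [dist_zero_right]
    calc ‖∫ x in K, q (ε / 2) x * (F ε x - f x)‖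
        ≤ M * (ρ / (M * volume.real K + 1)) * volume.real K := by
          refine norm_setIntegral_le_of_norm_le_const_ae hKfin ?_
          filter_upwards [h] with x hx
          rw [norm_mul]
          exact mul_le_mul (hq _ (half_pos hε) x) hx (norm_nonneg _) hM0
      _ = ρ * ((M * volume.real K) / (M * volume.real K + 1)) := by ring
      _ < ρ * 1 := by
          gcongr
          rw [div_lt_one (by positivity)]
          linarith
      _ = ρ := mul_one ρ
  have hlim := hB.add hA
  have hend : ∫ x in K, -fderiv ℝ φ x e * f x = -∫ x in Ω, f x * fderiv ℝ φ x e := by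
    rw [setIntegral_eq_of_subset_of_forall_sdiff_eq_zero hΩ.measurableSet hRΩ, ← integral_neg]
    · refine integral_congr_ae (Eventually.of_forall fun x => ?_)
      simp only
      ring
    · intro x hx
      have h1 : x ∉ tsupport φ := fun h => hx.2 (self_subset_cthickening _ h)
      rw [image_eq_zero_of_notMem_tsupport fun h => h1 (tsupport_fderiv_subset ℝ h)]
      simp
  rw [zero_add, hend] at hlim
  refine hlim.congr' ?_
  have hsmall : ∀ᶠ ε in 𝓝[>] (0:ℝ), ε < R / (n + 1) :=
    mem_nhdsGT_iff_exists_Ioo_subset.2 ⟨R / (n + 1), by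
      simp only [Set.mem_Ioi]; positivity, fun ε hε => hε.2⟩
  filter_upwards [hsmall, self_mem_nhdsWithin] with ε h hε
  have hε : 0 < ε := hε
  rw [lt_div_iff₀ (by positivity)] at h
  have hnε : 0 ≤ n * ε := by positivity
  rw [integral_mul_gridQuotient i hε (hF ε hε) hφ.continuous hφc hRΩ (by linarith) (by linarith)]
  have hi : ∀ u : 𝔼 → ℝ, IntegrableOn u K volume →
      IntegrableOn (fun x => q (ε / 2) x * u x) K volume := fun u hu =>
    hu.continuousOn_mul (hqc _).continuousOn hK
  have hFK : IntegrableOn (F ε) K volume := (hF ε hε).integrableOn_compact_subset hRΩ hK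
  have hi' : IntegrableOn (fun x => q (ε / 2) x * (F ε x - f x)) K volume := hi _ (hFK.sub hfK)
  rw [← integral_add hi' (hi _ hfK)]
  refine integral_congr_ae (Eventually.of_forall fun x => ?_)
  simp only [q]
  ring

end DifferenceQuotient

section VariationPair

variable {n : ℕ}

local notation "𝔼" => EuclideanSpace ℝ (Fin n)

open CompactlySupported

/-- A bound on `κ` along a sequence of scales produces signed measures representing the partial
derivatives of the limit. -/
lemma exists_measures_of_liminf_kappa_lt_top (hn : 1 ≤ n) {Ω : Set 𝔼} (hΩ : IsOpen Ω)
    {f : 𝔼 → ℝ} (hf : LocallyIntegrableOn f Ω volume) {F : ℝ → 𝔼 → ℝ}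
    (hF : ∀ ε, 0 < ε → LocallyIntegrableOn (F ε) Ω volume)
    (hconv : ∀ K, IsCompact K → K ⊆ Ω →
      Tendsto (fun ε => eLpNorm (fun x => F ε x - f x) ⊤ (volume.restrict K))
        (𝓝[>] (0:ℝ)) (𝓝 0))
    (h : liminf (fun ε => kappa n ε (F ε) Ω) (𝓝[>] (0:ℝ)) < ⊤) (i : Fin n) :
    ∃ ν ν' : Measure 𝔼, IsFiniteMeasure ν ∧ IsFiniteMeasure ν' ∧ ∀ φ : 𝔼 → ℝ,
      ContDiff ℝ 1 φ → HasCompactSupport φ → tsupport φ ⊆ Ω →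
      ∫ x in Ω, f x * fderiv ℝ φ x (EuclideanSpace.single i 1) =
        -((∫ x in Ω, φ x ∂ν) - ∫ x in Ω, φ x ∂ν') := by
  obtain ⟨C, hC, hCtop⟩ := exists_between h
  have hfreq : ∃ᶠ ε in 𝓝[>] (0:ℝ), kappa n ε (F ε) Ω ∈ Set.Iio C :=
    frequently_lt_of_liminf_lt (by isBoundedDefault) hC
  let l : Filter ℝ := 𝓝[>] (0:ℝ) ⊓ 𝓟 {ε | kappa n ε (F ε) Ω ∈ Set.Iio C}
  have hl : l.NeBot := frequently_mem_iff_neBot.1 hfreq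
  let U : Ultrafilter ℝ := Ultrafilter.of l
  have hU : (U : Filter ℝ) ≤ l := Ultrafilter.of_le l
  have hU0 : (U : Filter ℝ) ≤ 𝓝[>] (0:ℝ) := hU.trans inf_le_left
  have hUC : ∀ᶠ ε in (U : Filter ℝ), kappa n ε (F ε) Ω ∈ Set.Iio C :=
    (hU.trans inf_le_right) (mem_principal_self _)
  have hpos : ∀ᶠ ε in (U : Filter ℝ), 0 < ε := hU0 self_mem_nhdsWithin
  obtain ⟨ν, ν', hν, hν', hlim⟩ := exists_vague_limit_of_lintegral_enorm_le U (m := volume)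
    (C := 8 * C) (fun ε => gridQuotient i ε Ω (F ε))
    (hpos.mono fun ε hε => aestronglyMeasurable_gridQuotient i ε hΩ (hF ε hε))
    (ENNReal.mul_ne_top (by simp) hCtop.ne)
    (by
      filter_upwards [hpos, hUC] with ε hε hκ
      refine (lintegral_gridQuotient_le hn i hε hΩ (hF ε hε)).trans ?_
      gcongr
      exact le_of_lt hκ)
  refine ⟨ν, ν', hν, hν', fun φ hφ hφc hφΩ => ?_⟩
  have h1 := hlim ⟨⟨φ, hφ.continuous⟩, hφc⟩
  have h2 := (tendsto_integral_mul_gridQuotient i hf hF hconv hΩ hφ hφc hφΩ).mono_left hU0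
  have h3 := tendsto_nhds_unique h2 h1
  have h4 : ∀ m : Measure 𝔼, ∫ x in Ω, φ x ∂m = ∫ x, φ x ∂m := fun m =>
    setIntegral_eq_integral_of_forall_compl_eq_zero fun x hx =>
      image_eq_zero_of_notMem_tsupport fun h => hx (hφΩ h)
  rw [h4, h4, eq_neg_iff_add_eq_zero, ← neg_eq_iff_add_eq_zero]
  exact h3

/-- A function whose partial derivatives are differences of finite measures has a polar
decomposition of its gradient measure. -/
lemma exists_isVariationPair {Ω : Set 𝔼} (hΩ : IsOpen Ω) {f : 𝔼 → ℝ}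
    (hf : LocallyIntegrableOn f Ω volume) (ν ν' : Fin n → Measure 𝔼)
    (hν : ∀ i, IsFiniteMeasure (ν i)) (hν' : ∀ i, IsFiniteMeasure (ν' i))
    (h : ∀ i, ∀ φ : 𝔼 → ℝ, ContDiff ℝ 1 φ → HasCompactSupport φ → tsupport φ ⊆ Ω →
      ∫ x in Ω, f x * fderiv ℝ φ x (EuclideanSpace.single i 1) =
        -((∫ x in Ω, φ x ∂(ν i)) - ∫ x in Ω, φ x ∂(ν' i))) :
    ∃ p : Measure 𝔼 × (𝔼 → 𝔼), IsVariationPair n f Ω p.1 p.2 := by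
  let m : Measure 𝔼 := ∑ i, ((ν i).restrict Ω + (ν' i).restrict Ω)
  have hm : IsFiniteMeasure m := inferInstance
  have hm0 : m Ωᶜ = 0 := by
    simp [m, Measure.finsetSum_apply, Measure.restrict_apply hΩ.measurableSet.compl]
  have hle : ∀ i, (ν i).restrict Ω + (ν' i).restrict Ω ≤ m := fun i =>
    Finset.single_le_sum (f := fun i => (ν i).restrict Ω + (ν' i).restrict Ω)
      (fun _ _ => Measure.zero_le _) (Finset.mem_univ i)
  have hac : ∀ i, (ν i).restrict Ω ≪ m := fun i =>
    Measure.absolutelyContinuous_of_le ((Measure.le_add_right le_rfl).trans (hle i))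
  have hac' : ∀ i, (ν' i).restrict Ω ≪ m := fun i =>
    Measure.absolutelyContinuous_of_le ((Measure.le_add_left le_rfl).trans (hle i))
  have hL : ∀ i, ((ν i).restrict Ω).HaveLebesgueDecomposition m := fun i =>
    Measure.haveLebesgueDecomposition_of_sigmaFinite _ _
  have hL' : ∀ i, ((ν' i).restrict Ω).HaveLebesgueDecomposition m := fun i =>
    Measure.haveLebesgueDecomposition_of_sigmaFinite _ _
  let a : Fin n → 𝔼 → ℝ := fun i x => (((ν i).restrict Ω).rnDeriv m x).toReal
  let a' : Fin n → 𝔼 → ℝ := fun i x => (((ν' i).restrict Ω).rnDeriv m x).toReal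
  have ha : ∀ i, Integrable (a i) m := fun i => Measure.integrable_toReal_rnDeriv
  have ha' : ∀ i, Integrable (a' i) m := fun i => Measure.integrable_toReal_rnDeriv
  have ham : ∀ i, Measurable (a i) := fun i => (Measure.measurable_rnDeriv _ _).ennreal_toReal
  have ham' : ∀ i, Measurable (a' i) := fun i => (Measure.measurable_rnDeriv _ _).ennreal_toReal
  let g : 𝔼 → 𝔼 := fun x => WithLp.toLp 2 fun i => a i x - a' i x
  have hg : Measurable g :=
    (PiLp.continuous_toLp 2 _).measurable.comp
      (measurable_pi_lambda _ fun i => (ham i).sub (ham' i))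
  have hgn : Measurable fun x => ‖g x‖ₑ := hg.enorm
  have hgi : Integrable g m := by
    have h1 : g = fun x => ∑ i, (a i x - a' i x) • EuclideanSpace.single i (1:ℝ) := by
      ext x j
      simp [g, Pi.single_apply]
    rw [h1]
    exact integrable_finsetSum _ fun i _ => ((ha i).sub (ha' i)).smul_const _
  refine ⟨(m.withDensity fun x => ‖g x‖ₑ, fun x => ‖g x‖⁻¹ • g x), ?_, ?_, ?_, ?_, ?_⟩
  · exact isFiniteMeasure_withDensity hgi.2.ne
  · exact withDensity_absolutelyContinuous _ _ hm0
  · exact (hg.norm.inv.smul hg).aestronglyMeasurable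
  · rw [ae_withDensity_iff hgn]
    refine Eventually.of_forall fun x hx => ?_
    rw [norm_smul, norm_inv, norm_norm, inv_mul_cancel₀]
    simpa using hx
  · intro Φ hΦ hΦc hΦΩ
    let φ : Fin n → 𝔼 → ℝ := fun i x => Φ x i
    have hφ : ∀ i, ContDiff ℝ 1 (φ i) := fun i =>
      (EuclideanSpace.proj (𝕜 := ℝ) i).contDiff.comp hΦ
    have hsub : ∀ i, tsupport (φ i) ⊆ tsupport Φ := fun i =>
      closure_mono fun x hx h0 => hx (by simp [φ, h0])
    have hφc : ∀ i, HasCompactSupport (φ i) := fun i =>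
      hΦc.isCompact.of_isClosed_subset (isClosed_tsupport _) (hsub i)
    have hφb : ∀ i, ∃ C, ∀ x, ‖φ i x‖ ≤ C := fun i =>
      (hφc i).exists_bound_of_continuous (hφ i).continuous
    have hd : ∀ i x v, fderiv ℝ (φ i) x v = fderiv ℝ Φ x v i := fun i x v => by
      have h1 : HasFDerivAt (φ i) ((EuclideanSpace.proj (𝕜 := ℝ) i).comp (fderiv ℝ Φ x)) x :=
        (EuclideanSpace.proj (𝕜 := ℝ) i).hasFDerivAt.comp x
          (hΦ.differentiable one_ne_zero x).hasFDerivAt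
      rw [h1.fderiv]
      rfl
    have hint : ∀ i, IntegrableOn
        (fun x => f x * fderiv ℝ (φ i) x (EuclideanSpace.single i 1)) Ω volume := by
      intro i
      have hc : Continuous fun x => fderiv ℝ (φ i) x (EuclideanSpace.single i 1) :=
        ((hφ i).continuous_fderiv one_ne_zero).clm_apply continuous_const
      have h1 : IntegrableOn
          (fun x => f x * fderiv ℝ (φ i) x (EuclideanSpace.single i 1)) (tsupport Φ) volume :=
        (hf.integrableOn_compact_subset hΦΩ hΦc.isCompact).mul_continuousOn hc.continuousOn
          hΦc.isCompact
      refine h1.of_forall_sdiff_eq_zero hΩ.measurableSet fun x hx => ?_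
      rw [image_eq_zero_of_notMem_tsupport fun h => hx.2 (hsub i (tsupport_fderiv_subset ℝ h))]
      simp
    have hia : ∀ i, Integrable (fun x => a i x * φ i x) m := fun i => by
      obtain ⟨C, hC⟩ := hφb i
      exact (ha i).mul_bdd (c := C) (hφ i).continuous.aestronglyMeasurable
        (Eventually.of_forall hC)
    have hia' : ∀ i, Integrable (fun x => a' i x * φ i x) m := fun i => by
      obtain ⟨C, hC⟩ := hφb i
      exact (ha' i).mul_bdd (c := C) (hφ i).continuous.aestronglyMeasurable
        (Eventually.of_forall hC)
    have hib : ∀ i, Integrable (fun x => a i x * φ i x - a' i x * φ i x) m := fun i =>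
      (hia i).sub (hia' i)
    have hleft : ∫ x in Ω, f x * vdiv n Φ x =
        ∑ i, ∫ x in Ω, f x * fderiv ℝ (φ i) x (EuclideanSpace.single i 1) := by
      rw [← integral_finsetSum _ fun i _ => hint i]
      simp only [vdiv, Finset.mul_sum, hd]
    have hright : ∫ x, ⟪Φ x, ‖g x‖⁻¹ • g x⟫ ∂(m.withDensity fun x => ‖g x‖ₑ) =
        ∑ i, ∫ x, (a i x * φ i x - a' i x * φ i x) ∂m := by
      rw [integral_withDensity_eq_integral_toReal_smul₀ hgn.aemeasurable
        (Eventually.of_forall fun x => enorm_lt_top),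
        ← integral_finsetSum _ fun i _ => hib i]
      refine integral_congr_ae (Eventually.of_forall fun x => ?_)
      have h1 : ‖g x‖ * ⟪Φ x, ‖g x‖⁻¹ • g x⟫ = ⟪Φ x, g x⟫ := by
        rw [inner_smul_right, ← mul_assoc]
        rcases eq_or_ne (g x) 0 with h0 | h0
        · simp [h0]
        · rw [mul_inv_cancel₀ (norm_ne_zero_iff.2 h0), one_mul]
      simp only [toReal_enorm, smul_eq_mul]
      rw [h1, PiLp.inner_apply]
      refine Finset.sum_congr rfl fun i _ => ?_
      simp only [g, φ, RCLike.inner_apply, conj_trivial]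
      ring
    simp only
    rw [hleft, hright, ← Finset.sum_neg_distrib]
    refine Finset.sum_congr rfl fun i _ => ?_
    rw [h i _ (hφ i) (hφc i) ((hsub i).trans hΦΩ), integral_sub (hia i) (hia' i)]
    congr 2
    · exact (integral_rnDeriv_smul (hac i)).symm
    · exact (integral_rnDeriv_smul (hac' i)).symm

end VariationPair

/-- If `f_ε − f → 0` in `L^∞_loc(Ω)`, then
`(1/2)·|D^j f|(Ω) ≤ liminf_{ε→0} κ_ε(f_ε, Ω)`. -/
theorem half_jumpVar_le_liminf_kappa
    (n : ℕ) (hn : 1 ≤ n)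
    (Ω : Set (EuclideanSpace ℝ (Fin n))) (hΩ : IsOpen Ω)
    (f : EuclideanSpace ℝ (Fin n) → ℝ) (hf : LocallyIntegrableOn f Ω volume)
    (F : ℝ → EuclideanSpace ℝ (Fin n) → ℝ)
    (hFloc : ∀ ε, 0 < ε → LocallyIntegrableOn (F ε) Ω volume)
    (hFmem : ∀ ε, 0 < ε → ∀ K, IsCompact K → K ⊆ Ω →
      eLpNorm (fun x => F ε x - f x) ⊤ (volume.restrict K) < ⊤)
    (hconv : ∀ K, IsCompact K → K ⊆ Ω →
      Tendsto (fun ε => eLpNorm (fun x => F ε x - f x) ⊤ (volume.restrict K))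
        (𝓝[>] (0:ℝ)) (𝓝 0)) :
    jumpVar n f Ω / 2 ≤ liminf (fun ε => kappa n ε (F ε) Ω) (𝓝[>] (0:ℝ)) := by
  unfold jumpVar
  split_ifs with h
  · refine ENNReal.div_le_of_le_mul' ?_
    exact (Measure.singularPart_le _ _ _).trans
      (h.choose_spec.measure_jumpSet_le_two_mul hn hΩ hf hFloc hconv)
  · refine le_of_le_of_eq le_top (Eq.symm ?_)
    by_contra hne
    choose ν ν' hν hν' hi using exists_measures_of_liminf_kappa_lt_top hn hΩ hf hFloc hconv
      (lt_top_iff_ne_top.2 hne)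
    exact h (exists_isVariationPair hΩ hf ν ν' hν hν' hi)

end
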